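/- For every admissible function H : ℝ → ℝ (i.e., (ln ln T)/ln T < H(T) < T^(1/ln ln T) for all sufficiently large T), there exists a function η : ℝ → ℝ such that for all sufficiently large T one has T < η(T) < T + T^(0.5001), and | ∫_{η(T)}^{η(T)+H(T)} Z(u) du | ~ √(2π·H(T)) as T → ∞. -/

import Mathlib

open Filter

/-- The Riemann–Siegel theta function. -/
noncomputable def RSTheta (t : ℝ) : ℝ :=
  (Complex.log (Complex.Gamma (1 / 4 + Complex.I * t / 2))).im - t / 2 * Real.log Real.pi

/-- Hardy's Z-function, which is real-valued on `ℝ` (taken via the real part). -/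
noncomputable def HardyZ (t : ℝ) : ℝ :=
  (Complex.exp (Complex.I * RSTheta t) * riemannZeta (1 / 2 + Complex.I * t)).re

/-- A function `H` is admissible if `(ln ln T)/ln T < H(T) < T^(1/ln ln T)` for all
sufficiently large `T`. -/
def Admissible (H : ℝ → ℝ) : Prop :=
  ∀ᶠ T in atTop,
    Real.log (Real.log T) / Real.log T < H T ∧ H T < T ^ (1 / Real.log (Real.log T))

/-- The unimodular exponential `e^{iy}`. -/
noncomputable def ee (y : ℝ) : ℂ := Complex.exp (Complex.I * y)

lemma ee_add (x y : ℝ) : ee (x + y) = ee x * ee y := by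
  unfold ee; rw [← Complex.exp_add]; push_cast; ring_nf

lemma ee_zero : ee 0 = 1 := by simp [ee]

lemma ee_norm (x : ℝ) : ‖ee x‖ = 1 := by
  unfold ee; exact Complex.norm_exp_I_mul_ofReal x

lemma ee_ne_zero (x : ℝ) : ee x ≠ 0 := Complex.exp_ne_zero _

lemma ee_neg (x : ℝ) : ee (-x) = (ee x)⁻¹ := by
  unfold ee; rw [← Complex.exp_neg]; push_cast; ring_nf

lemma ee_conj (x : ℝ) : (starRingEnd ℂ) (ee x) = ee (-x) := by
  unfold ee; rw [← Complex.exp_conj]; simp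

lemma ee_sub_one_le (x : ℝ) : ‖ee x - 1‖ ≤ |x| := Real.norm_exp_I_mul_ofReal_sub_one_le

lemma ee_sub_le (x y : ℝ) : ‖ee x - ee y‖ ≤ |x - y| := by
  have : ee x - ee y = ee y * (ee (x - y) - 1) := by
    rw [mul_sub, ← ee_add]; simp
  rw [this, norm_mul, ee_norm, one_mul]; exact ee_sub_one_le _

@[fun_prop]
lemma ee_continuous : Continuous ee := by unfold ee; fun_prop

lemma ee_eq_cos (x : ℝ) : ee x = (Real.cos x : ℂ) + (Real.sin x : ℂ) * Complex.I := by
  unfold ee; rw [mul_comm, Complex.exp_mul_I]; push_cast; rfl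


/-- `z` has phase `y`. -/
def HasPh (z : ℂ) (y : ℝ) : Prop := ∃ r : ℝ, 0 ≤ r ∧ z = r * ee y

lemma HasPh.mul {z w : ℂ} {x y : ℝ} (hz : HasPh z x) (hw : HasPh w y) : HasPh (z * w) (x + y) := by
  obtain ⟨r, hr, rfl⟩ := hz
  obtain ⟨s, hs, rfl⟩ := hw
  refine ⟨r * s, by positivity, ?_⟩
  rw [ee_add]; push_cast; ring

lemma HasPh.inv {z : ℂ} {x : ℝ} (hz : HasPh z x) : HasPh (z⁻¹) (-x) := by
  obtain ⟨r, hr, rfl⟩ := hz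
  refine ⟨r⁻¹, by positivity, ?_⟩
  rw [ee_neg, mul_inv]; push_cast; ring

lemma HasPh.prod {ι : Type*} (s : Finset ι) (f : ι → ℂ) (g : ι → ℝ) (h : ∀ i ∈ s, HasPh (f i) (g i)) :
    HasPh (∏ i ∈ s, f i) (∑ i ∈ s, g i) := by
  classical
  induction s using Finset.induction_on with
  | empty => exact ⟨1, by simp, by simp [ee_zero]⟩
  | insert a s ha ih =>
    rw [Finset.prod_insert ha, Finset.sum_insert ha]
    exact (h a (by simp)).mul (ih fun i hi => h i (by simp [hi]))

lemma HasPh.eq {z : ℂ} {y : ℝ} (h : HasPh z y) (hz : z ≠ 0) : ee y = z / ‖z‖ := by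
  obtain ⟨r, hr, rfl⟩ := h
  have hr0 : (r : ℂ) ≠ 0 := by
    intro h0; simp [h0] at hz
  rw [norm_mul, ee_norm, mul_one, Complex.norm_real, Real.norm_of_nonneg hr]
  field_simp

lemma hasPh_of_re_pos (a t : ℝ) (ha : 0 < a) : HasPh (a + Complex.I * t) (Real.arctan (t / a)) := by
  refine ⟨a * Real.sqrt (1 + (t / a) ^ 2), by positivity, ?_⟩
  have h : Real.sqrt (1 + (t / a) ^ 2) ≠ 0 := by positivity
  have hc : (Real.sqrt (1 + (t / a) ^ 2) : ℂ) ≠ 0 := by exact_mod_cast h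
  have ha' : (a : ℂ) ≠ 0 := by exact_mod_cast ha.ne'
  rw [ee_eq_cos, Real.cos_arctan, Real.sin_arctan]
  generalize Real.sqrt (1 + (t / a) ^ 2) = r at *
  push_cast
  field_simp

/-- Finite approximations to the phase. -/
noncomputable def phn (n : ℕ) (t : ℝ) : ℝ :=
  t / 2 * Real.log n - ∑ j ∈ Finset.range (n + 1), Real.arctan (t / (2 * j + 1 / 2))
    - t / 2 * Real.log Real.pi

lemma hasPh_GammaSeq (n : ℕ) (hn : 1 ≤ n) (t : ℝ) :
    HasPh (Complex.GammaSeq (1 / 4 + Complex.I * t / 2) n) (phn n t + t / 2 * Real.log Real.pi) := by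
  have h1 : HasPh ((n : ℂ) ^ (1 / 4 + Complex.I * t / 2 : ℂ)) (t / 2 * Real.log n) := by
    refine ⟨Real.exp (Real.log n / 4), by positivity, ?_⟩
    rw [Complex.cpow_def_of_ne_zero (by exact_mod_cast (by omega : n ≠ 0))]
    unfold ee
    rw [Complex.ofReal_exp, ← Complex.exp_add, ← Complex.natCast_log]
    push_cast; ring_nf
  have h2 : HasPh ((n.factorial : ℂ)) 0 := ⟨n.factorial, by positivity, by simp [ee_zero]⟩
  have h3 : HasPh (∏ j ∈ Finset.range (n + 1), ((1 / 4 + Complex.I * t / 2 : ℂ) + j))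
      (∑ j ∈ Finset.range (n + 1), Real.arctan (t / (2 * j + 1 / 2))) := by
    apply HasPh.prod
    intro j _
    have := hasPh_of_re_pos (j + 1 / 4) (t / 2) (by positivity)
    have e1 : (t / 2) / ((j : ℝ) + 1 / 4) = t / (2 * j + 1 / 2) := by field_simp; ring
    rw [e1] at this
    convert this using 1
    push_cast; ring
  have := (h1.mul h2).mul h3.inv
  unfold Complex.GammaSeq phn
  rw [div_eq_mul_inv]
  convert this using 1
  ring

lemma gam_ne (t : ℝ) : Complex.Gamma (1 / 4 + Complex.I * t / 2) ≠ 0 := by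
  apply Complex.Gamma_ne_zero_of_re_pos
  simp

lemma ee_theta (t : ℝ) : ee (RSTheta t) =
    Complex.Gamma (1 / 4 + Complex.I * t / 2) / ‖Complex.Gamma (1 / 4 + Complex.I * t / 2)‖
      * ee (-(t / 2 * Real.log Real.pi)) := by
  unfold RSTheta
  rw [sub_eq_add_neg, ee_add]
  congr 1
  apply HasPh.eq _ (gam_ne t)
  refine ⟨‖Complex.Gamma (1 / 4 + Complex.I * t / 2)‖, by positivity, ?_⟩
  conv_lhs => rw [← Complex.norm_mul_exp_arg_mul_I (Complex.Gamma (1 / 4 + Complex.I * t / 2))]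
  rw [Complex.log_im]; unfold ee; congr 2; ring

lemma tendsto_phn (t : ℝ) : Tendsto (fun n => ee (phn n t)) atTop (nhds (ee (RSTheta t))) := by
  rw [ee_theta]
  have hG := Complex.GammaSeq_tendsto_Gamma (1 / 4 + Complex.I * t / 2)
  have h2 : Tendsto (fun n => Complex.GammaSeq (1 / 4 + Complex.I * t / 2) n /
      ‖Complex.GammaSeq (1 / 4 + Complex.I * t / 2) n‖ * ee (-(t / 2 * Real.log Real.pi))) atTop
      (nhds (Complex.Gamma (1 / 4 + Complex.I * t / 2) /
        ‖Complex.Gamma (1 / 4 + Complex.I * t / 2)‖ * ee (-(t / 2 * Real.log Real.pi)))) := by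
    apply Tendsto.mul_const
    apply hG.div
    · exact (Complex.continuous_ofReal.tendsto _).comp hG.norm
    · exact_mod_cast (norm_ne_zero_iff.mpr (gam_ne t))
  apply h2.congr'
  filter_upwards [eventually_ge_atTop 1, hG.eventually_ne (gam_ne t)] with n hn hne
  rw [← (hasPh_GammaSeq n hn t).eq hne, ← ee_add]
  congr 1; ring


/-- first derivative -/
noncomputable def ph1 (n : ℕ) (t : ℝ) : ℝ :=
  1 / 2 * Real.log n - ∑ j ∈ Finset.range (n + 1), (2 * j + 1 / 2 : ℝ) / ((2 * j + 1 / 2) ^ 2 + t ^ 2)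
    - 1 / 2 * Real.log Real.pi
/-- second derivative -/
noncomputable def ph2 (n : ℕ) (t : ℝ) : ℝ :=
  ∑ j ∈ Finset.range (n + 1), 2 * (2 * j + 1 / 2 : ℝ) * t / ((2 * j + 1 / 2) ^ 2 + t ^ 2) ^ 2
/-- third derivative -/
noncomputable def ph3 (n : ℕ) (t : ℝ) : ℝ :=
  ∑ j ∈ Finset.range (n + 1), 2 * (2 * j + 1 / 2 : ℝ) * ((2 * j + 1 / 2) ^ 2 - 3 * t ^ 2) /
    ((2 * j + 1 / 2) ^ 2 + t ^ 2) ^ 3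

lemma phn_deriv (n : ℕ) (t : ℝ) : HasDerivAt (phn n) (ph1 n t) t := by
  unfold phn ph1
  apply HasDerivAt.sub
  apply HasDerivAt.sub
  · simpa [mul_comm] using ((hasDerivAt_id t).div_const 2).mul_const (Real.log n)
  · apply HasDerivAt.fun_sum
    intro j _
    have ha : (0 : ℝ) < 2 * j + 1 / 2 := by positivity
    have := ((hasDerivAt_id t).div_const (2 * (j : ℝ) + 1 / 2)).arctan
    refine this.congr_deriv ?_
    simp only [id]
    field_simp
  · simpa [mul_comm] using ((hasDerivAt_id t).div_const 2).mul_const (Real.log Real.pi)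

lemma ph1_deriv (n : ℕ) (t : ℝ) : HasDerivAt (ph1 n) (ph2 n t) t := by
  unfold ph1 ph2
  have h : HasDerivAt (fun t : ℝ => ∑ j ∈ Finset.range (n + 1), (2 * j + 1 / 2 : ℝ) / ((2 * j + 1 / 2) ^ 2 + t ^ 2))
     (∑ j ∈ Finset.range (n + 1), -(2 * (2 * j + 1 / 2 : ℝ) * t / ((2 * j + 1 / 2) ^ 2 + t ^ 2) ^ 2)) t := by
    apply HasDerivAt.fun_sum
    intro j _
    have ha : (0 : ℝ) < 2 * j + 1 / 2 := by positivity
    have hD : ((2 * j + 1 / 2 : ℝ) ^ 2 + t ^ 2) ≠ 0 := by positivity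
    have h1 : HasDerivAt (fun t : ℝ => (2 * j + 1 / 2 : ℝ) ^ 2 + t ^ 2) (2 * t) t := by
      simpa using (hasDerivAt_pow 2 t).const_add ((2 * j + 1 / 2 : ℝ) ^ 2)
    refine ((hasDerivAt_const t (2 * j + 1 / 2 : ℝ)).fun_div h1 hD).congr_deriv ?_
    field_simp; ring
  refine ((h.const_sub (1 / 2 * Real.log n)).sub_const (1 / 2 * Real.log Real.pi)).congr_deriv ?_
  rw [Finset.sum_neg_distrib, neg_neg]

lemma ph2_deriv (n : ℕ) (t : ℝ) : HasDerivAt (ph2 n) (ph3 n t) t := by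
  unfold ph2 ph3
  apply HasDerivAt.fun_sum
  intro j _
  have ha : (0 : ℝ) < 2 * j + 1 / 2 := by positivity
  have hD : ((2 * j + 1 / 2 : ℝ) ^ 2 + t ^ 2) ^ 2 ≠ 0 := by positivity
  have h1 : HasDerivAt (fun t : ℝ => ((2 * j + 1 / 2 : ℝ) ^ 2 + t ^ 2) ^ 2)
      (2 * ((2 * j + 1 / 2 : ℝ) ^ 2 + t ^ 2) * (2 * t)) t := by
    simpa using ((hasDerivAt_pow 2 t).const_add ((2 * j + 1 / 2 : ℝ) ^ 2)).fun_pow 2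
  have h2 : HasDerivAt (fun t : ℝ => 2 * (2 * j + 1 / 2 : ℝ) * t) (2 * (2 * j + 1 / 2 : ℝ)) t := by
    simpa using (hasDerivAt_id t).const_mul (2 * (2 * j + 1 / 2 : ℝ))
  refine (h2.fun_div h1 hD).congr_deriv ?_
  field_simp; ring

lemma sum_aux (m : ℕ) (t : ℝ) (ht : 0 < t) :
    ∑ j ∈ Finset.range m, (2 * j + 1 / 2 : ℝ) / ((2 * j + 1 / 2) ^ 2 + t ^ 2) ^ 2 ≤ 7 / t ^ 2 := by
  have key : ∑ j ∈ Finset.range m, (2 * j + 1 / 2 : ℝ) / ((2 * j + 1 / 2) ^ 2 + t ^ 2) ^ 2 ≤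
      25 / 4 * (1 / t ^ 2 - 1 / ((2 * m + 1 / 2) ^ 2 + t ^ 2)) := by
    induction m with
    | zero =>
      simp only [Finset.range_zero, Finset.sum_empty]
      have : 1 / ((2 * ((0:ℕ):ℝ) + 1 / 2) ^ 2 + t ^ 2) ≤ 1 / t ^ 2 := by
        apply one_div_le_one_div_of_le (by positivity); norm_num
      linarith
    | succ m ih =>
      rw [Finset.sum_range_succ]
      have ha : (1 / 2 : ℝ) ≤ 2 * m + 1 / 2 := by
        have : (0:ℝ) ≤ m := by positivity
        linarith
      push_cast
      have e : (2 * ((m:ℝ) + 1) + 1 / 2) = (2 * m + 1 / 2) + 2 := by ring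
      rw [e]
      generalize (2 * (m:ℝ) + 1 / 2) = a at *
      have h1 : a / (a ^ 2 + t ^ 2) ^ 2 ≤ 25 / 4 * (1 / (a ^ 2 + t ^ 2) - 1 / ((a + 2) ^ 2 + t ^ 2)) := by
        have : 25 / 4 * (1 / (a ^ 2 + t ^ 2) - 1 / ((a + 2) ^ 2 + t ^ 2)) =
          25 * (a + 1) / ((a ^ 2 + t ^ 2) * ((a + 2) ^ 2 + t ^ 2)) := by field_simp; ring
        rw [this, div_le_div_iff₀ (by positivity) (by positivity)]
        have h2 : (a + 2) ^ 2 + t ^ 2 ≤ 25 * (a ^ 2 + t ^ 2) := by nlinarith [sq_nonneg t]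
        have hD : 0 < a ^ 2 + t ^ 2 := by positivity
        have : a * ((a + 2) ^ 2 + t ^ 2) ≤ 25 * (a + 1) * (a ^ 2 + t ^ 2) := by
          nlinarith [mul_le_mul_of_nonneg_left h2 (by linarith : 0 ≤ a)]
        nlinarith [mul_le_mul_of_nonneg_right this hD.le]
      linarith
  have : 0 ≤ 1 / ((2 * m + 1 / 2) ^ 2 + t ^ 2) := by positivity
  have h7 : 7 / t ^ 2 = 7 * (1 / t ^ 2) := by ring
  have : 0 ≤ 1 / t ^ 2 := by positivity
  rw [h7]; linarith

lemma ph2_bound (n : ℕ) (t : ℝ) (ht : 0 < t) : |ph2 n t| ≤ 14 / t := by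
  have h := sum_aux (n + 1) t ht
  have e : ph2 n t = 2 * t * ∑ j ∈ Finset.range (n + 1), (2 * j + 1 / 2 : ℝ) / ((2 * j + 1 / 2) ^ 2 + t ^ 2) ^ 2 := by
    unfold ph2; rw [Finset.mul_sum]; apply Finset.sum_congr rfl; intros; ring
  rw [e, abs_of_nonneg (by positivity)]
  calc _ ≤ 2 * t * (7 / t ^ 2) := by gcongr
    _ = 14 / t := by field_simp; norm_num

lemma ph3_bound (n : ℕ) (t : ℝ) (ht : 0 < t) : |ph3 n t| ≤ 42 / t ^ 2 := by
  have h := sum_aux (n + 1) t ht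
  calc |ph3 n t| ≤ ∑ j ∈ Finset.range (n + 1), |2 * (2 * j + 1 / 2 : ℝ) * ((2 * j + 1 / 2) ^ 2 - 3 * t ^ 2) /
    ((2 * j + 1 / 2) ^ 2 + t ^ 2) ^ 3| := Finset.abs_sum_le_sum_abs _ _
    _ ≤ ∑ j ∈ Finset.range (n + 1), 6 * ((2 * j + 1 / 2 : ℝ) / ((2 * j + 1 / 2) ^ 2 + t ^ 2) ^ 2) := by
      apply Finset.sum_le_sum
      intro j _
      have ha : (0 : ℝ) < 2 * j + 1 / 2 := by positivity
      generalize (2 * (j:ℝ) + 1 / 2) = a at *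
      rw [abs_div, abs_of_pos (by positivity : 0 < (a ^ 2 + t ^ 2) ^ 3), abs_mul, abs_of_pos (by positivity : 0 < 2 * a),
        mul_div_assoc', div_le_div_iff₀ (by positivity) (by positivity)]
      have h1 : |a ^ 2 - 3 * t ^ 2| ≤ 3 * (a ^ 2 + t ^ 2) := by
        rw [abs_le]; constructor <;> nlinarith [sq_nonneg a, sq_nonneg t]
      calc 2 * a * |a ^ 2 - 3 * t ^ 2| * (a ^ 2 + t ^ 2) ^ 2 ≤ 2 * a * (3 * (a ^ 2 + t ^ 2)) * (a ^ 2 + t ^ 2) ^ 2 := by gcongr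
        _ = _ := by ring
    _ ≤ 6 * (7 / t ^ 2) := by rw [← Finset.mul_sum]; gcongr
    _ = _ := by ring

lemma log_aux (a t : ℝ) (ha : 1 / 2 ≤ a) :
    |1 / 4 * (Real.log ((a + 2) ^ 2 + t ^ 2) - Real.log (a ^ 2 + t ^ 2)) - a / (a ^ 2 + t ^ 2)| ≤ 37 / a ^ 2 := by
  have hD : 0 < a ^ 2 + t ^ 2 := by positivity
  have hD2 : 0 < (a + 2) ^ 2 + t ^ 2 := by positivity
  rw [← Real.log_div hD2.ne' hD.ne']
  set y := (4 * a + 4) / (a ^ 2 + t ^ 2) with hy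
  have hy0 : 0 < y := by positivity
  have e : ((a + 2) ^ 2 + t ^ 2) / (a ^ 2 + t ^ 2) = 1 + y := by rw [hy]; field_simp; ring
  rw [e]
  have h1 : Real.log (1 + y) ≤ y := by have := Real.log_le_sub_one_of_pos (by linarith : 0 < 1 + y); linarith
  have h2 : y - y ^ 2 ≤ Real.log (1 + y) := by
    have := Real.one_sub_inv_le_log_of_pos (by linarith : 0 < 1 + y)
    have h3 : y - y ^ 2 ≤ 1 - (1 + y)⁻¹ := by
      have : 1 - (1 + y)⁻¹ - (y - y ^ 2) = y ^ 3 / (1 + y) := by field_simp; ring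
      have : 0 ≤ y ^ 3 / (1 + y) := by positivity
      linarith
    linarith
  have e2 : y / 4 = a / (a ^ 2 + t ^ 2) + 1 / (a ^ 2 + t ^ 2) := by rw [hy]; field_simp
  have h4 : y ^ 2 ≤ 144 / (a ^ 2 + t ^ 2) := by
    rw [hy, div_pow, div_le_div_iff₀ (by positivity) (by positivity)]
    have : (4 * a + 4) ^ 2 ≤ 144 * (a ^ 2 + t ^ 2) := by nlinarith [sq_nonneg t]
    nlinarith
  have h5 : 1 / (a ^ 2 + t ^ 2) ≤ 1 / a ^ 2 := by
    apply one_div_le_one_div_of_le (by positivity); nlinarith [sq_nonneg t]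
  have e3 : 144 / (a ^ 2 + t ^ 2) = 144 * (1 / (a ^ 2 + t ^ 2)) := by ring
  have e4 : 37 / a ^ 2 = 37 * (1 / a ^ 2) := by ring
  rw [e4, abs_le]
  constructor <;> nlinarith

lemma sum_sq_aux (m : ℕ) : ∑ j ∈ Finset.range m, 37 / (2 * j + 1 / 2 : ℝ) ^ 2 ≤ 185 := by
  have key : ∑ j ∈ Finset.range m, 37 / (2 * j + 1 / 2 : ℝ) ^ 2 ≤ 185 / 4 * (4 - 1 / ((m:ℝ) + 1 / 4)) := by
    induction m with
    | zero => norm_num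
    | succ m ih =>
      rw [Finset.sum_range_succ]
      have hm : (0:ℝ) ≤ m := by positivity
      have : 37 / (2 * m + 1 / 2 : ℝ) ^ 2 ≤ 185 / 4 * (1 / (m + 1 / 4) - 1 / ((m:ℝ) + 1 + 1 / 4)) := by
        have e : 185 / 4 * (1 / (m + 1 / 4) - 1 / ((m:ℝ) + 1 + 1 / 4)) = 185 / 4 / ((m + 1 / 4) * (m + 1 + 1 / 4)) := by
          field_simp; ring
        rw [e, div_le_div_iff₀ (by positivity) (by positivity)]
        nlinarith
      push_cast
      linarith
  have : (0:ℝ) ≤ 1 / ((m:ℝ) + 1 / 4) := by positivity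
  linarith

lemma ph1_bound (n : ℕ) (t : ℝ) (ht : 1 ≤ t) (hn : t ≤ n) : |ph1 n t - 1 / 2 * Real.log t| ≤ 200 := by
  have hn1 : (1:ℝ) ≤ n := le_trans ht hn
  set f : ℕ → ℝ := fun j => 1 / 4 * Real.log ((2 * j + 1 / 2) ^ 2 + t ^ 2) with hf
  have h1 : |∑ j ∈ Finset.range (n + 1), ((f (j + 1) - f j) - (2 * j + 1 / 2 : ℝ) / ((2 * j + 1 / 2) ^ 2 + t ^ 2))| ≤ 185 := by
    refine (Finset.abs_sum_le_sum_abs _ _).trans (le_trans ?_ (sum_sq_aux (n + 1)))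
    apply Finset.sum_le_sum
    intro j _
    have ha : (1 / 2 : ℝ) ≤ 2 * j + 1 / 2 := by
      have : (0:ℝ) ≤ j := by positivity
      linarith
    have := log_aux (2 * j + 1 / 2) t ha
    have hfj : f (j + 1) = 1 / 4 * Real.log ((2 * ((j:ℝ) + 1) + 1 / 2) ^ 2 + t ^ 2) := by
      simp only [hf]; push_cast; rfl
    rw [hfj, show (2 * ((j:ℝ) + 1) + 1 / 2) = 2 * j + 1 / 2 + 2 by ring, ← mul_sub]
    exact this
  rw [Finset.sum_sub_distrib, Finset.sum_range_sub] at h1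
  have hA : 2 * Real.log n ≤ Real.log ((2 * ((n:ℝ) + 1) + 1 / 2) ^ 2 + t ^ 2) := by
    have : 2 * Real.log n = Real.log ((n:ℝ) ^ 2) := by rw [Real.log_pow]; norm_num
    rw [this]; apply Real.log_le_log (by positivity); nlinarith
  have hB : Real.log ((2 * ((n:ℝ) + 1) + 1 / 2) ^ 2 + t ^ 2) ≤ 2 * Real.log n + 24 := by
    have : 2 * Real.log n = Real.log ((n:ℝ) ^ 2) := by rw [Real.log_pow]; norm_num
    have h25 : Real.log 25 ≤ 24 := by have := Real.log_le_sub_one_of_pos (by norm_num : (0:ℝ) < 25); linarith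
    have h3 : Real.log ((2 * ((n:ℝ) + 1) + 1 / 2) ^ 2 + t ^ 2) ≤ Real.log (25 * (n:ℝ) ^ 2) := by
      apply Real.log_le_log (by positivity); nlinarith
    rw [Real.log_mul (by norm_num) (by positivity)] at h3
    linarith
  have hC : 2 * Real.log t ≤ Real.log ((1 / 2) ^ 2 + t ^ 2) := by
    have : 2 * Real.log t = Real.log (t ^ 2) := by rw [Real.log_pow]; norm_num
    rw [this]; apply Real.log_le_log (by positivity); nlinarith
  have hE : Real.log ((1 / 2) ^ 2 + t ^ 2) ≤ 2 * Real.log t + 1 := by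
    have : 2 * Real.log t = Real.log (t ^ 2) := by rw [Real.log_pow]; norm_num
    have h25 : Real.log 2 ≤ 1 := by have := Real.log_le_sub_one_of_pos (by norm_num : (0:ℝ) < 2); linarith
    have h3 : Real.log ((1 / 2) ^ 2 + t ^ 2) ≤ Real.log (2 * t ^ 2) := by
      apply Real.log_le_log (by positivity); nlinarith
    rw [Real.log_mul (by norm_num) (by positivity)] at h3
    linarith
  have hpi0 : 0 ≤ Real.log Real.pi := Real.log_nonneg (by linarith [Real.pi_gt_three])
  have hpi1 : Real.log Real.pi ≤ 3 := by
    have := Real.log_le_sub_one_of_pos Real.pi_pos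
    linarith [Real.pi_le_four]
  unfold ph1
  simp only [hf] at h1
  push_cast at h1
  rw [mul_zero, zero_add] at h1
  rw [abs_le] at h1 ⊢
  constructor <;> linarith [h1.1, h1.2]

/-- Taylor estimates for a function with bounded second and third derivative. -/
lemma taylor_aux (f f1 f2 f3 : ℝ → ℝ) (hf : ∀ t, HasDerivAt f (f1 t) t) (hf1 : ∀ t, HasDerivAt f1 (f2 t) t)
    (hf2 : ∀ t, HasDerivAt f2 (f3 t) t) (a x M : ℝ) (hM : ∀ t ∈ Set.uIcc a (a + x), |f3 t| ≤ M) :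
    |f1 (a + x) - (f1 a + f2 a * x)| ≤ M * x ^ 2 ∧
    |f (a + x) - (f a + f1 a * x + f2 a * x ^ 2 / 2)| ≤ M * |x| ^ 3 := by
  have hconv : Convex ℝ (Set.uIcc a (a + x)) := convex_uIcc _ _
  have hdist : ∀ t ∈ Set.uIcc a (a + x), |t - a| ≤ |x| := by
    intro t ht
    have := Set.abs_sub_left_of_mem_uIcc ht
    simpa using this
  have hM0 : 0 ≤ M := le_trans (abs_nonneg _) (hM a Set.left_mem_uIcc)
  have s1 : ∀ t ∈ Set.uIcc a (a + x), |f2 t - f2 a| ≤ M * |x| := by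
    intro t ht
    have := Convex.norm_image_sub_le_of_norm_hasDerivWithin_le (f := f2) (f' := f3) (C := M)
      (fun y _ => (hf2 y).hasDerivWithinAt) (fun y hy => hM y hy) hconv Set.left_mem_uIcc ht
    exact this.trans (mul_le_mul_of_nonneg_left (hdist t ht) hM0)
  have s2 : ∀ t ∈ Set.uIcc a (a + x), |f1 t - f2 a * (t - a) - f1 a| ≤ M * |x| * |x| := by
    intro t ht
    have := Convex.norm_image_sub_le_of_norm_hasDerivWithin_le (f := fun t => f1 t - f2 a * (t - a)) (f' := fun t => f2 t - f2 a)
      (C := M * |x|) (s := Set.uIcc a (a + x)) (x := a) (y := t)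
      (fun y _ => by
        have h := (hf1 y).sub (((hasDerivAt_id y).sub_const a).const_mul (f2 a))
        simp only [mul_one] at h
        exact h.hasDerivWithinAt) (fun y hy => s1 y hy) hconv Set.left_mem_uIcc ht
    simp only [sub_self, mul_zero, sub_zero] at this
    exact this.trans (mul_le_mul_of_nonneg_left (hdist t ht) (by positivity))
  have s3 : ∀ t ∈ Set.uIcc a (a + x), |f t - f2 a * (t - a) ^ 2 / 2 - f1 a * (t - a) - f a| ≤ M * |x| * |x| * |x| := by
    intro t ht
    have := Convex.norm_image_sub_le_of_norm_hasDerivWithin_le (f := fun t => f t - f2 a * (t - a) ^ 2 / 2 - f1 a * (t - a))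
      (f' := fun t => f1 t - f2 a * (t - a) - f1 a)
      (C := M * |x| * |x|) (s := Set.uIcc a (a + x)) (x := a) (y := t)
      (fun y _ => by
        have h0 : HasDerivAt (fun t => f2 a * (t - a) ^ 2 / 2) (f2 a * (y - a)) y := by
          have := ((((hasDerivAt_id y).sub_const a).pow 2).const_mul (f2 a)).div_const 2
          refine this.congr_deriv ?_
          simp only [id]; ring
        have h := ((hf y).sub h0).sub (((hasDerivAt_id y).sub_const a).const_mul (f1 a))
        simp only [mul_one] at h
        exact h.hasDerivWithinAt) (fun y hy => s2 y hy) hconv Set.left_mem_uIcc ht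
    simp only [sub_self, mul_zero, sub_zero] at this
    have h0 : ‖f t - f2 a * (t - a) ^ 2 / 2 - f1 a * (t - a) - (f a - f2 a * 0 ^ 2 / 2)‖ =
      |f t - f2 a * (t - a) ^ 2 / 2 - f1 a * (t - a) - f a| := by simp
    rw [h0] at this
    exact this.trans (mul_le_mul_of_nonneg_left (hdist t ht) (by positivity))
  constructor
  · have := s2 (a + x) Set.right_mem_uIcc
    have e : M * |x| * |x| = M * x ^ 2 := by rw [mul_assoc, ← abs_mul, ← sq, abs_of_nonneg (sq_nonneg x)]
    rw [e] at this
    have e2 : f1 (a + x) - (f1 a + f2 a * x) = f1 (a + x) - f2 a * (a + x - a) - f1 a := by ring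
    rw [e2]; exact this
  · have := s3 (a + x) Set.right_mem_uIcc
    have e2 : f (a + x) - (f a + f1 a * x + f2 a * x ^ 2 / 2) =
      f (a + x) - f2 a * (a + x - a) ^ 2 / 2 - f1 a * (a + x - a) - f a := by ring
    rw [e2]; exact this.trans (le_of_eq (by ring))


lemma phn_two (n : ℕ) (T x v : ℝ) (hT : 0 < T) (hx : |x| ≤ T / 4) (hv : 0 ≤ v) (hv' : v ≤ T / 4) :
    |phn n (T + x + v) - phn n (T + x) - (ph1 n T * v + ph2 n T * x * v)| ≤
      168 * x ^ 2 * v / T ^ 2 + 28 * v ^ 2 / T := by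
  rw [abs_le] at hx
  have hb : ∀ t : ℝ, T / 2 ≤ t → |ph3 n t| ≤ 168 / T ^ 2 := by
    intro t ht
    refine (ph3_bound n t (by linarith)).trans ?_
    rw [div_le_div_iff₀ (by nlinarith) (by positivity)]
    nlinarith
  have hb2 : ∀ t : ℝ, T / 2 ≤ t → |ph2 n t| ≤ 28 / T := by
    intro t ht
    refine (ph2_bound n t (by linarith)).trans ?_
    rw [div_le_div_iff₀ (by linarith) (by positivity)]
    nlinarith
  have h1 := (taylor_aux (phn n) (ph1 n) (ph2 n) (ph3 n) (phn_deriv n) (ph1_deriv n) (ph2_deriv n) T x (168 / T ^ 2)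
    (fun t ht => hb t (by
      rcases Set.mem_uIcc.mp ht with h | h <;> linarith [h.1]))).1
  have s1 : ∀ t ∈ Set.Icc (T + x) (T + x + v), |ph1 n t - ph1 n (T + x)| ≤ 28 / T * v := by
    intro t ht
    have := Convex.norm_image_sub_le_of_norm_hasDerivWithin_le (f := ph1 n) (f' := ph2 n) (C := 28 / T)
      (s := Set.Icc (T + x) (T + x + v)) (x := T + x) (y := t)
      (fun y _ => (ph1_deriv n y).hasDerivWithinAt) (fun y hy => hb2 y (by linarith [hy.1])) (convex_Icc _ _)
      (Set.left_mem_Icc.mpr (by linarith)) ht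
    refine this.trans (mul_le_mul_of_nonneg_left ?_ (by positivity))
    rw [Real.norm_eq_abs, abs_of_nonneg (by linarith [ht.1])]; linarith [ht.2]
  have s2 := Convex.norm_image_sub_le_of_norm_hasDerivWithin_le (f := fun t => phn n t - ph1 n (T + x) * t)
      (f' := fun t => ph1 n t - ph1 n (T + x)) (C := 28 / T * v)
      (s := Set.Icc (T + x) (T + x + v)) (x := T + x) (y := T + x + v)
      (fun y _ => by
        have h := (phn_deriv n y).sub ((hasDerivAt_id y).const_mul (ph1 n (T + x)))
        simp only [mul_one] at h
        exact h.hasDerivWithinAt) s1 (convex_Icc _ _)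
      (Set.left_mem_Icc.mpr (by linarith)) (Set.right_mem_Icc.mpr (by linarith))
  have e1 : ‖(T + x + v) - (T + x)‖ = v := by rw [Real.norm_eq_abs, add_sub_cancel_left, abs_of_nonneg hv]
  rw [e1, Real.norm_eq_abs] at s2
  have e2 : phn n (T + x + v) - phn n (T + x) - (ph1 n T * v + ph2 n T * x * v) =
    (phn n (T + x + v) - ph1 n (T + x) * (T + x + v) - (phn n (T + x) - ph1 n (T + x) * (T + x))) +
    v * (ph1 n (T + x) - (ph1 n T + ph2 n T * x)) := by ring
  rw [e2]
  refine (abs_add_le _ _).trans ?_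
  rw [abs_mul, abs_of_nonneg hv]
  calc _ ≤ 28 / T * v * v + v * (168 / T ^ 2 * x ^ 2) := by gcongr
    _ = _ := by ring

theorem theta_approx (T : ℝ) (hT : 10 ≤ T) : ∃ L q : ℝ, |L - 1 / 2 * Real.log T| ≤ 200 ∧ |q| ≤ 14 / T ∧
    (∀ x, |x| ≤ T / 2 → ‖ee (RSTheta (T + x)) - ee (RSTheta T) * ee (L * x + q * x ^ 2 / 2)‖ ≤
      168 * |x| ^ 3 / T ^ 2) ∧
    (∀ x v, |x| ≤ T / 4 → 0 ≤ v → v ≤ T / 4 →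
      ‖ee (RSTheta (T + x + v)) - ee (RSTheta (T + x)) * ee (L * v + q * x * v)‖ ≤
      168 * x ^ 2 * v / T ^ 2 + 28 * v ^ 2 / T) := by
  have hT0 : 0 < T := by linarith
  set K : Set (ℝ × ℝ) := Set.Icc (1 / 2 * Real.log T - 200) (1 / 2 * Real.log T + 200) ×ˢ Set.Icc (-(14 / T)) (14 / T) with hK
  have hKc : IsCompact K := isCompact_Icc.prod isCompact_Icc
  have hmem : ∀ᶠ n : ℕ in atTop, (ph1 n T, ph2 n T) ∈ K := by
    filter_upwards [eventually_ge_atTop (Nat.ceil T)] with n hn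
    have h1 := ph1_bound n T (by linarith) (Nat.ceil_le.mp hn)
    have h2 := ph2_bound n T hT0
    rw [abs_le] at h1 h2
    refine ⟨⟨?_, ?_⟩, h2⟩ <;> simp only <;> linarith [h1.1, h1.2]
  obtain ⟨⟨L, q⟩, hLq, φ, hφ, hlim⟩ := hKc.tendsto_subseq' hmem.frequently
  have hL : Tendsto (fun n => ph1 (φ n) T) atTop (nhds L) := (continuous_fst.tendsto _).comp hlim
  have hq : Tendsto (fun n => ph2 (φ n) T) atTop (nhds q) := (continuous_snd.tendsto _).comp hlim
  have hth : ∀ t, Tendsto (fun n => ee (phn (φ n) t)) atTop (nhds (ee (RSTheta t))) := fun t =>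
    (tendsto_phn t).comp hφ.tendsto_atTop
  refine ⟨L, q, ?_, abs_le.mpr hLq.2, ?_, ?_⟩
  · have := hLq.1; simp only [Set.mem_Icc] at this
    rw [abs_le]; constructor <;> linarith [this.1, this.2]
  · intro x hx
    have hlimit : Tendsto (fun n => ‖ee (phn (φ n) (T + x)) - ee (phn (φ n) T) *
        ee (ph1 (φ n) T * x + ph2 (φ n) T * x ^ 2 / 2)‖) atTop
        (nhds ‖ee (RSTheta (T + x)) - ee (RSTheta T) * ee (L * x + q * x ^ 2 / 2)‖) := by
      apply Tendsto.norm
      apply (hth _).sub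
      apply (hth _).mul
      exact (ee_continuous.tendsto _).comp ((hL.mul_const x).add ((hq.mul_const (x ^ 2)).div_const 2))
    apply le_of_tendsto' hlimit
    intro n
    rw [← ee_add]
    refine (ee_sub_le _ _).trans ?_
    rw [abs_le] at hx
    have h1 := (taylor_aux (phn (φ n)) (ph1 (φ n)) (ph2 (φ n)) (ph3 (φ n)) (phn_deriv _) (ph1_deriv _) (ph2_deriv _) T x (168 / T ^ 2)
      (fun t ht => by
        have ht2 : T / 2 ≤ t := by rcases Set.mem_uIcc.mp ht with h | h <;> linarith [h.1]
        refine (ph3_bound _ t (by linarith)).trans ?_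
        rw [div_le_div_iff₀ (by nlinarith) (by positivity)]
        nlinarith)).2
    rw [← add_assoc]
    exact h1.trans (le_of_eq (by ring))
  · intro x v hx hv hv'
    have hlimit : Tendsto (fun n => ‖ee (phn (φ n) (T + x + v)) - ee (phn (φ n) (T + x)) *
        ee (ph1 (φ n) T * v + ph2 (φ n) T * x * v)‖) atTop
        (nhds ‖ee (RSTheta (T + x + v)) - ee (RSTheta (T + x)) * ee (L * v + q * x * v)‖) := by
      apply Tendsto.norm
      apply (hth _).sub
      apply (hth _).mul
      exact (ee_continuous.tendsto _).comp ((hL.mul_const v).add ((hq.mul_const x).mul_const v))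
    apply le_of_tendsto' hlimit
    intro n
    rw [← ee_add]
    refine (ee_sub_le _ _).trans ?_
    rw [← sub_sub]
    exact phn_two (φ n) T x v hT0 hx hv hv'


/-- Euler–Maclaurin remainder term. -/
noncomputable def emt (n : ℕ) (s : ℂ) : ℂ :=
  (s - 1) * ((n : ℂ) + 1) ^ (-s) + ((n : ℂ) + 1) ^ (1 - s) - (n : ℂ) ^ (1 - s)

lemma cpow_deriv_aux (r : ℂ) (y : ℝ) (hy : 0 < y) :
    HasDerivAt (fun y : ℝ => (y : ℂ) ^ r) (r * (y : ℂ) ^ (r - 1)) y := by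
  have h := ((hasDerivAt_id (y : ℂ)).cpow_const (c := r) (by
    simp [Complex.slitPlane, hy])).comp_ofReal
  simpa using h

lemma sum_Icc_range (f : ℕ → ℂ) (N : ℕ) : ∑ m ∈ Finset.Icc 1 N, f m = ∑ m ∈ Finset.range N, f (m + 1) := by
  induction N with
  | zero => simp
  | succ N ih => rw [Finset.sum_range_succ, ← ih, Finset.sum_Icc_succ_top (by omega)]

lemma emt_bound (n : ℕ) (hn : 1 ≤ n) (s : ℂ) (hs : 0 < s.re) :
    ‖emt n s‖ ≤ ‖s - 1‖ * ‖s‖ * (n : ℝ) ^ (-s.re - 1) := by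
  have hn' : (0:ℝ) < n := by exact_mod_cast hn
  have h1 : ∀ y ∈ Set.Icc (n:ℝ) (n+1), ‖((n:ℂ) + 1) ^ (-s) - (y:ℂ) ^ (-s)‖ ≤ ‖s‖ * (n : ℝ) ^ (-s.re - 1) := by
    intro y hy
    have hc := (convex_Icc (n:ℝ) (n+1)).norm_image_sub_le_of_norm_hasDerivWithin_le
      (f := fun y : ℝ => (y:ℂ) ^ (-s)) (f' := fun y : ℝ => (-s) * (y : ℂ) ^ (-s - 1))
      (C := ‖s‖ * (n : ℝ) ^ (-s.re - 1)) (x := y) (y := (n:ℝ)+1)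
      (fun z hz => (cpow_deriv_aux (-s) z (by linarith [hz.1])).hasDerivWithinAt)
      (fun z hz => by
        have hz0 : 0 < z := by linarith [hz.1]
        rw [norm_mul, norm_neg, Complex.norm_cpow_eq_rpow_re_of_pos hz0]
        gcongr
        simp only [Complex.sub_re, Complex.neg_re, Complex.one_re]
        exact Real.rpow_le_rpow_of_nonpos hn' hz.1 (by linarith)) hy ⟨by linarith, le_refl _⟩
    push_cast at hc
    refine hc.trans ?_
    have : ‖(n:ℝ) + 1 - y‖ ≤ 1 := by
      rw [Real.norm_eq_abs, abs_le]; constructor <;> linarith [hy.1, hy.2]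
    have h0 : 0 ≤ ‖s‖ * (n : ℝ) ^ (-s.re - 1) := by positivity
    nlinarith
  have hc := (convex_Icc (n:ℝ) (n+1)).norm_image_sub_le_of_norm_hasDerivWithin_le
      (f := fun y : ℝ => (s - 1) * ((n : ℂ) + 1) ^ (-s) * (y:ℂ) + (y:ℂ) ^ (1 - s))
      (f' := fun y : ℝ => (s - 1) * (((n : ℂ) + 1) ^ (-s) - (y:ℂ) ^ (-s)))
      (C := ‖s - 1‖ * (‖s‖ * (n : ℝ) ^ (-s.re - 1))) (x := (n:ℝ)) (y := (n:ℝ)+1)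
      (fun z hz => by
        have h2 := (cpow_deriv_aux (1 - s) z (by linarith [hz.1]))
        have h3 : HasDerivAt (fun y : ℝ => (s - 1) * ((n : ℂ) + 1) ^ (-s) * (y:ℂ)) ((s - 1) * ((n : ℂ) + 1) ^ (-s) * 1) z :=
          (Complex.ofRealCLM.hasDerivAt (x := z)).const_mul _
        refine ((h3.add h2).congr_deriv ?_).hasDerivWithinAt
        rw [show (1 - s - 1) = -s by ring]; ring)
      (fun z hz => by
        rw [norm_mul]
        gcongr
        exact h1 z hz) ⟨le_refl _, by linarith⟩ ⟨by linarith, le_refl _⟩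
  push_cast at hc
  have e : ((s - 1) * ((n : ℂ) + 1) ^ (-s) * ((n:ℂ)+1) + ((n:ℂ)+1) ^ (1 - s)) - ((s - 1) * ((n : ℂ) + 1) ^ (-s) * (n:ℂ) + (n:ℂ) ^ (1 - s)) = emt n s := by
    unfold emt; ring
  rw [e] at hc
  refine hc.trans ?_
  have : ‖(n:ℝ) + 1 - n‖ = 1 := by simp
  rw [this]; linarith

lemma sum32_bound (N K : ℕ) (hN : 1 ≤ N) : ∑ k ∈ Finset.range K, ((N + k : ℕ) : ℝ) ^ (-(1/2:ℝ) - 1) ≤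
    6 * (1 / Real.sqrt N - 1 / Real.sqrt ((N + K : ℕ) : ℝ)) := by
  induction K with
  | zero => simp
  | succ K ih =>
    rw [Finset.sum_range_succ]
    have key : ∀ n : ℕ, 1 ≤ n → (n : ℝ) ^ (-(1/2:ℝ) - 1) ≤ 6 * (1 / Real.sqrt n - 1 / Real.sqrt ((n + 1 : ℕ) : ℝ)) := by
      intro n hn
      have hn' : (1:ℝ) ≤ n := by exact_mod_cast hn
      set a := Real.sqrt n with ha
      set b := Real.sqrt ((n + 1 : ℕ) : ℝ) with hb
      have ha0 : 0 < a := Real.sqrt_pos.mpr (by linarith)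
      have hb0 : 0 < b := Real.sqrt_pos.mpr (by positivity)
      have ha2 : a ^ 2 = n := Real.sq_sqrt (by linarith)
      have hb2 : b ^ 2 = n + 1 := by rw [hb, Real.sq_sqrt (by positivity)]; push_cast; ring
      have e1 : (n : ℝ) ^ (-(1/2:ℝ) - 1) = 1 / a ^ 3 := by
        rw [show (-(1/2:ℝ) - 1) = -(3/2) by ring, Real.rpow_neg (by linarith), ha, Real.sqrt_eq_rpow,
          ← Real.rpow_natCast, ← Real.rpow_mul (by linarith)]
        norm_num
      rw [e1]
      have hab : a ≤ b := by nlinarith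
      have hb3 : b ≤ 3/2 * a := by nlinarith
      have e2 : 1 / a - 1 / b = 1 / (a * b * (a + b)) := by
        field_simp; nlinarith
      rw [e2, ← div_eq_mul_one_div, div_le_div_iff₀ (by positivity) (by positivity)]
      have h1 : a * b * (a+b) ≤ a * (3/2*a) * (a + 3/2*a) := by gcongr
      nlinarith [pow_pos ha0 3]
    have := key (N+K) (by omega)
    rw [show N + (K+1) = N + K + 1 by ring]
    linarith

lemma emt_tsum_bound (N : ℕ) (hN : 1 ≤ N) (t : ℝ) :
    ‖∑' k : ℕ, emt (N + k) (1/2 + Complex.I * t)‖ ≤ ‖(1/2 + Complex.I * t : ℂ) - 1‖ * ‖(1/2 + Complex.I * t : ℂ)‖ * (6 / Real.sqrt N) := by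
  set s : ℂ := 1/2 + Complex.I * t with hs
  have hre : s.re = 1/2 := by simp [hs]
  have hb : ∀ K, ∑ k ∈ Finset.range K, ((N + k : ℕ) : ℝ) ^ (-(1/2:ℝ) - 1) ≤ 6 / Real.sqrt N := by
    intro K
    refine (sum32_bound N K hN).trans ?_
    have : 0 ≤ 1 / Real.sqrt ((N + K : ℕ) : ℝ) := by positivity
    rw [div_eq_mul_one_div 6]
    nlinarith
  have hsum : Summable (fun k : ℕ => ((N + k : ℕ) : ℝ) ^ (-(1/2:ℝ) - 1)) :=
    summable_of_sum_range_le (fun k => by positivity) hb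
  have hle := Real.tsum_le_of_sum_range_le (fun k : ℕ => by positivity) hb
  have := tsum_of_norm_bounded (hsum.hasSum.mul_left (‖s-1‖*‖s‖)) (fun k => by
    have := emt_bound (N+k) (by omega) s (by rw [hre]; norm_num)
    rwa [hre] at this)
  refine this.trans ?_
  gcongr

lemma em_identity_gt (N : ℕ) (hN : 1 ≤ N) (s : ℂ) (hs : 1 < s.re) :
    riemannZeta₁ s = (s - 1) * ∑ m ∈ Finset.range N, ((m : ℂ) + 1) ^ (-s) + (N : ℂ) ^ (1 - s) + ∑' k : ℕ, emt (N + k) s := by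
  have hs1 : s ≠ 1 := by rintro rfl; simp at hs
  have hz := riemannZeta_eq_inv_sub_mul hs1
  have hz2 : riemannZeta₁ s = (s - 1) * riemannZeta s := by
    rw [hz, mul_inv_cancel_left₀ (sub_ne_zero.mpr hs1)]
  rw [hz2, zeta_eq_tsum_one_div_nat_add_one_cpow hs]
  have hsm : Summable (fun n : ℕ => 1 / ((n:ℂ) + 1) ^ s) := by
    have := (Complex.summable_one_div_nat_cpow (p := s)).mpr hs
    have := (summable_nat_add_iff 1).mpr this
    simpa using this
  have hsm' : Summable (fun n : ℕ => ((n:ℂ) + 1) ^ (-s)) := by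
    refine hsm.congr (fun n => ?_); rw [Complex.cpow_neg, one_div]
  have e0 : ∑' n : ℕ, 1 / ((n:ℂ) + 1) ^ s = ∑' n : ℕ, ((n:ℂ) + 1) ^ (-s) := by
    congr 1; ext n; rw [Complex.cpow_neg, one_div]
  rw [e0, ← hsm'.sum_add_tsum_nat_add N]
  have htel : HasSum (fun k : ℕ => ((N + k : ℕ) + 1 : ℂ) ^ (1 - s) - ((N + k : ℕ) : ℂ) ^ (1 - s)) (0 - (N:ℂ) ^ (1-s)) := by
    have hlim : Tendsto (fun k : ℕ => ((N + k : ℕ) : ℂ) ^ (1 - s)) atTop (nhds 0) := by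
      rw [tendsto_zero_iff_norm_tendsto_zero]
      have : Tendsto (fun k : ℕ => ((N + k : ℕ) : ℝ) ^ (-(s.re - 1))) atTop (nhds 0) := by
        apply (tendsto_rpow_neg_atTop (by linarith : 0 < s.re - 1)).comp
        apply tendsto_natCast_atTop_atTop.comp
        exact tendsto_atTop_mono (fun k => by simp) tendsto_id
      refine this.congr (fun k => ?_)
      have hp : (0:ℝ) < ((N+k : ℕ) : ℝ) := by exact_mod_cast (by omega : 0 < N + k)
      have := Complex.norm_cpow_eq_rpow_re_of_pos hp (1 - s)
      rw [Complex.ofReal_natCast] at this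
      rw [this]; congr 1; simp
    have hsmT : Summable (fun k : ℕ => ((N + k : ℕ) + 1 : ℂ) ^ (1 - s) - ((N + k : ℕ) : ℂ) ^ (1 - s)) := by
      have hA : Summable (fun k : ℕ => emt (N+k) s) := by
        have hr : Summable (fun k : ℕ => ((N + k : ℕ) : ℝ) ^ (-s.re - 1)) := by
          have := (Real.summable_nat_rpow (p := -s.re - 1)).mpr (by linarith)
          have := (summable_nat_add_iff N).mpr this
          refine this.congr (fun k => ?_); rw [add_comm k N]
        exact Summable.of_norm_bounded (hr.mul_left (‖s-1‖*‖s‖)) (fun k => emt_bound (N+k) (by omega) s (by linarith))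
      have hB : Summable (fun k : ℕ => (s - 1) * ((N + k : ℕ) + 1 : ℂ) ^ (-s)) := by
        have := (summable_nat_add_iff N).mpr hsm'
        refine (this.mul_left (s-1)).congr (fun k => ?_); rw [add_comm k N]
      refine (hA.sub hB).congr (fun k => ?_)
      unfold emt; ring
    have := hsmT.hasSum.tendsto_sum_nat
    have h2 : Tendsto (fun K => ∑ k ∈ Finset.range K, (((N + k : ℕ) + 1 : ℂ) ^ (1 - s) - ((N + k : ℕ) : ℂ) ^ (1 - s))) atTop (nhds (0 - (N:ℂ) ^ (1-s))) := by
      have h3 : ∀ K, ∑ k ∈ Finset.range K, (((N + k : ℕ) + 1 : ℂ) ^ (1 - s) - ((N + k : ℕ) : ℂ) ^ (1 - s)) = ((N + K : ℕ) : ℂ) ^ (1 - s) - (N:ℂ) ^ (1-s) := by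
        intro K
        have := Finset.sum_range_sub (fun k : ℕ => ((N + k : ℕ) : ℂ) ^ (1 - s)) K
        simp only [add_zero] at this
        rw [← this]
        apply Finset.sum_congr rfl; intro k _
        push_cast; ring_nf
      simp_rw [h3]
      exact hlim.sub_const _
    have := tendsto_nhds_unique this h2
    rw [← this]; exact hsmT.hasSum
  have hB : HasSum (fun k : ℕ => (s - 1) * ((N + k : ℕ) + 1 : ℂ) ^ (-s)) ((s-1) * ∑' k : ℕ, (((k + N : ℕ) : ℂ) + 1) ^ (-s)) := by
    have := (summable_nat_add_iff N).mpr hsm'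
    refine (this.hasSum.mul_left (s-1)).congr_fun (fun k => ?_)
    rw [add_comm k N]
  have hE := (hB.add htel).tsum_eq
  have : (fun k : ℕ => (s - 1) * ((N + k : ℕ) + 1 : ℂ) ^ (-s) + ( ((N + k : ℕ) + 1 : ℂ) ^ (1 - s) - ((N + k : ℕ) : ℂ) ^ (1 - s))) = fun k : ℕ => emt (N + k) s := by
    ext k; unfold emt; ring
  rw [this] at hE
  rw [hE]; push_cast; ring

lemma em_identity (N : ℕ) (hN : 1 ≤ N) (s : ℂ) (hs : 1/4 < s.re) :
    riemannZeta₁ s = (s - 1) * ∑ m ∈ Finset.range N, ((m : ℂ) + 1) ^ (-s) + (N : ℂ) ^ (1 - s) + ∑' k : ℕ, emt (N + k) s := by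
  set R := ‖s‖ + 3 with hR
  set U : Set ℂ := {z | 1/4 < z.re} ∩ Metric.ball 0 R with hU
  have hUo : IsOpen U := (isOpen_lt continuous_const Complex.continuous_re).inter Metric.isOpen_ball
  have hUc : IsPreconnected U := ((convex_halfSpace_re_gt _).inter (convex_ball _ _)).isPreconnected
  have hd : DifferentiableOn ℂ (fun s => (s - 1) * ∑ m ∈ Finset.range N, ((m : ℂ) + 1) ^ (-s) + (N : ℂ) ^ (1 - s) + ∑' k : ℕ, emt (N + k) s) U := by
    have hN0 : (N:ℂ) ≠ 0 := by exact_mod_cast (by omega : N ≠ 0)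
    have hm0 : ∀ m : ℕ, ((m:ℂ) + 1) ≠ 0 := fun m => by exact_mod_cast (by omega : m + 1 ≠ 0)
    have hp : ∀ (a : ℂ), a ≠ 0 → Differentiable ℂ (fun s : ℂ => a ^ (-s)) := fun a ha =>
      (differentiable_neg).const_cpow (Or.inl ha)
    have hp1 : ∀ (a : ℂ), a ≠ 0 → Differentiable ℂ (fun s : ℂ => a ^ (1-s)) := fun a ha =>
      (by fun_prop : Differentiable ℂ (fun s : ℂ => 1 - s)).const_cpow (Or.inl ha)
    apply DifferentiableOn.add
    · apply Differentiable.differentiableOn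
      apply Differentiable.add
      · apply Differentiable.mul (by fun_prop)
        apply Differentiable.fun_sum
        intro m _
        exact hp _ (hm0 m)
      · exact hp1 _ hN0
    · have hr : Summable (fun k : ℕ => (R+1)*R*((N + k : ℕ) : ℝ) ^ (-(1/4:ℝ) - 1)) := by
        have := (Real.summable_nat_rpow (p := -(1/4:ℝ) - 1)).mpr (by norm_num)
        have := (summable_nat_add_iff N).mpr this
        refine (this.mul_left ((R+1)*R)).congr (fun k => ?_); rw [add_comm k N]
      refine Complex.differentiableOn_tsum_of_summable_norm hr (fun k => ?_) hUo ?_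
      · apply Differentiable.differentiableOn
        unfold emt
        have h1 : ((N + k : ℕ) : ℂ) ≠ 0 := by exact_mod_cast (by omega : N + k ≠ 0)
        exact (((by fun_prop : Differentiable ℂ (fun s : ℂ => s - 1)).mul (hp _ (hm0 _))).add (hp1 _ (hm0 _))).sub (hp1 _ h1)
      · rintro k w ⟨hw1, hw2⟩
        simp only [Set.mem_ofPred_eq] at hw1
        have hw2 : ‖w‖ < R := by simpa using hw2
        refine (emt_bound (N+k) (by omega) w (by linarith)).trans ?_
        have h1 : (1:ℝ) ≤ ((N + k : ℕ) : ℝ) := by exact_mod_cast (by omega : 1 ≤ N + k)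
        gcongr
        · calc ‖w - 1‖ ≤ ‖w‖ + ‖(1:ℂ)‖ := norm_sub_le _ _
            _ ≤ R + 1 := by rw [norm_one]; linarith
  have h2 : (2:ℂ) ∈ U := by
    refine ⟨by simp; norm_num, ?_⟩
    simp only [Metric.mem_ball, dist_zero_right, Complex.norm_ofNat, hR]
    linarith [norm_nonneg s]
  have := AnalyticOnNhd.eqOn_of_preconnected_of_eventuallyEq
    (differentiable_riemannZeta₁.differentiableOn.analyticOnNhd hUo)
    (hd.analyticOnNhd hUo) hUc h2 (by
      have : {z : ℂ | 1 < z.re} ∈ nhds (2:ℂ) := (isOpen_lt continuous_const Complex.continuous_re).mem_nhds (by simp)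
      filter_upwards [this] with z hz
      exact em_identity_gt N hN z hz)
  exact this ⟨hs, by simp [hR]⟩

/-- The pole term. -/
noncomputable def pole (N : ℕ) (t : ℝ) : ℂ := (Real.sqrt N : ℂ) * ee (-(t * Real.log N)) / (1/2 - Complex.I * t)

/-- The truncated Dirichlet sum approximating zeta. -/
noncomputable def zN (N : ℕ) (t : ℝ) : ℂ :=
  ∑ m ∈ Finset.Icc 1 N, ((1 / Real.sqrt m : ℝ) : ℂ) * ee (-(t * Real.log m)) - pole N t

lemma nat_cpow_neg (m : ℕ) (hm : 1 ≤ m) (t : ℝ) :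
    (m : ℂ) ^ (-(1/2 + Complex.I * t)) = ((1 / Real.sqrt m : ℝ) : ℂ) * ee (-(t * Real.log m)) := by
  have hm0 : (0:ℝ) < m := by exact_mod_cast hm
  rw [Complex.cpow_def_of_ne_zero (by exact_mod_cast hm0.ne'), ← Complex.natCast_log]
  have : (1 / Real.sqrt m : ℝ) = Real.exp (-(Real.log m)/2) := by
    rw [Real.sqrt_eq_rpow, Real.rpow_def_of_pos hm0, one_div, ← Real.exp_neg]; ring_nf
  rw [this]; unfold ee; push_cast
  rw [← Complex.exp_add]; ring_nf

lemma nat_cpow_pos (m : ℕ) (hm : 1 ≤ m) (t : ℝ) :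
    (m : ℂ) ^ (1 - (1/2 + Complex.I * t)) = (Real.sqrt m : ℂ) * ee (-(t * Real.log m)) := by
  have hm0 : (0:ℝ) < m := by exact_mod_cast hm
  rw [Complex.cpow_def_of_ne_zero (by exact_mod_cast hm0.ne'), ← Complex.natCast_log]
  have : (Real.sqrt m : ℝ) = Real.exp ((Real.log m)/2) := by
    rw [Real.sqrt_eq_rpow, Real.rpow_def_of_pos hm0]; ring_nf
  rw [this]; unfold ee; push_cast
  rw [← Complex.exp_add]; ring_nf

lemma zeta_approx (N : ℕ) (hN : 1 ≤ N) (t : ℝ) :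
    ‖riemannZeta (1/2 + Complex.I * t) - zN N t‖ ≤ 6 * (1 + |t|) / Real.sqrt N := by
  set s : ℂ := 1/2 + Complex.I * t with hs
  have hs1 : s ≠ 1 := by
    intro h; have := congrArg Complex.re h; norm_num [hs] at this
  have hs1' : s - 1 ≠ 0 := sub_ne_zero.mpr hs1
  have hid := em_identity N hN s (by norm_num [hs])
  have hz : zN N t = ∑ m ∈ Finset.range N, ((m : ℂ) + 1) ^ (-s) + (s-1)⁻¹ * (N : ℂ) ^ (1 - s) := by
    unfold zN pole
    rw [hs, nat_cpow_pos N hN t, ← hs]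
    have : (1/2 - Complex.I * t : ℂ) = -(s - 1) := by rw [hs]; ring
    rw [this, div_neg, sub_neg_eq_add]
    congr 1
    · rw [sum_Icc_range]
      apply Finset.sum_congr rfl
      intro m _
      rw [hs, ← nat_cpow_neg (m+1) (by omega) t]; push_cast; rfl
    · rw [div_eq_inv_mul]
  have e : riemannZeta s - zN N t = (s-1)⁻¹ * ∑' k : ℕ, emt (N + k) s := by
    rw [riemannZeta_eq_inv_sub_mul hs1, hid, hz]; field_simp; ring
  rw [e, norm_mul, norm_inv]
  have hb := emt_tsum_bound N hN t
  rw [← hs] at hb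
  have hn : 0 < ‖s - 1‖ := norm_pos_iff.mpr hs1'
  have hsn : ‖s‖ ≤ 1 + |t| := by
    rw [hs]
    refine (norm_add_le _ _).trans ?_
    rw [norm_mul, Complex.norm_I, Complex.norm_real, Real.norm_eq_abs]; norm_num
  calc ‖s-1‖⁻¹ * ‖∑' k : ℕ, emt (N + k) s‖ ≤ ‖s-1‖⁻¹ * (‖s - 1‖ * ‖s‖ * (6 / Real.sqrt N)) := by gcongr
    _ = ‖s‖ * (6 / Real.sqrt N) := by field_simp
    _ ≤ (1 + |t|) * (6 / Real.sqrt N) := by gcongr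
    _ = _ := by ring


/-- Gaussian window. -/
noncomputable def gw (V x : ℝ) : ℝ := Real.exp (-(x / V) ^ 2)

@[fun_prop]
lemma gw_cont (V : ℝ) : Continuous (gw V) := by unfold gw; fun_prop

lemma gw_pos (V x : ℝ) : 0 < gw V x := Real.exp_pos _

/-- Windowed Gaussian integral with chirp. -/
noncomputable def JJ (V X ξ q : ℝ) : ℂ := ∫ x in (-X)..X, (gw V x : ℂ) * ee (ξ * x + q * x ^ 2)

/-- Total mass of the window. -/
noncomputable def J0 (V X : ℝ) : ℝ := ∫ x in (-X)..X, gw V x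

lemma gw_eq (V x : ℝ) : gw V x = Real.exp (-(1 / V ^ 2) * x ^ 2) := by
  unfold gw; congr 1; rw [div_pow]; ring

lemma gw_integrable (V : ℝ) (hV : 0 < V) : MeasureTheory.Integrable (gw V) := by
  have := integrable_exp_neg_mul_sq (b := 1 / V ^ 2) (by positivity)
  exact this.congr (by filter_upwards with x; rw [gw_eq])

lemma gw_integral (V : ℝ) (hV : 0 < V) : ∫ x, gw V x = Real.sqrt Real.pi * V := by
  have := integral_gaussian (1 / V ^ 2)
  simp_rw [← gw_eq] at this
  rw [this]
  rw [show Real.pi / (1 / V^2) = Real.pi * V^2 by field_simp, Real.sqrt_mul Real.pi_pos.le, Real.sqrt_sq hV.le]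

lemma sqrt_pi_le : Real.sqrt Real.pi ≤ 2 := by
  rw [Real.sqrt_le_left (by norm_num)]; linarith [Real.pi_lt_four]

lemma J0_le (V X : ℝ) (hV : 0 < V) (hX : 0 ≤ X) : J0 V X ≤ 2 * V := by
  unfold J0
  rw [intervalIntegral.integral_of_le (by linarith)]
  calc ∫ x in Set.Ioc (-X) X, gw V x ≤ ∫ x, gw V x :=
        MeasureTheory.setIntegral_le_integral (gw_integrable V hV) (by filter_upwards with x; exact (gw_pos V x).le)
    _ = Real.sqrt Real.pi * V := gw_integral V hV
    _ ≤ 2 * V := by gcongr; exact sqrt_pi_le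

lemma le_J0 (V X : ℝ) (hV : 0 < V) (hX : V ≤ X) : V / 2 ≤ J0 V X := by
  have h1 : ∫ x in (-V)..V, gw V x ≤ J0 V X := by
    unfold J0
    apply intervalIntegral.integral_mono_interval (by linarith) (by linarith) hX
    · filter_upwards with x; exact (gw_pos V x).le
    · exact (gw_cont V).intervalIntegrable _ _
  have h2 : ∫ x in (-V)..V, (1/4 : ℝ) ≤ ∫ x in (-V)..V, gw V x := by
    apply intervalIntegral.integral_mono_on (by linarith) (by simp) ((gw_cont V).intervalIntegrable _ _)
    intro x hx
    have h3 : (x / V) ^ 2 ≤ 1 := by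
      rw [div_pow, div_le_one (by positivity)]
      exact sq_le_sq' hx.1 hx.2
    have : Real.exp (-1) ≤ gw V x := by unfold gw; gcongr
    have h4 : (1/4:ℝ) ≤ Real.exp (-1) := by
      rw [Real.exp_neg, one_div]
      gcongr
      linarith [Real.exp_one_lt_d9]
    linarith
  rw [intervalIntegral.integral_const, smul_eq_mul] at h2
  linarith

lemma tail_bound (V X : ℝ) (hV : 0 < V) (hX : 0 ≤ X) (f : ℝ → ℂ) (hf : MeasureTheory.Integrable f)
    (hb : ∀ x, ‖f x‖ ≤ gw V x) :
    ‖∫ x in (-X)..X, f x‖ ≤ ‖∫ x, f x‖ + 4 * V * Real.exp (-(X^2 / (2 * V^2))) := by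
  rw [intervalIntegral.integral_of_le (by linarith)]
  have h := MeasureTheory.integral_add_compl (measurableSet_Ioc (a := -X) (b := X)) hf
  have e : ∫ x in Set.Ioc (-X) X, f x = (∫ x, f x) - ∫ x in (Set.Ioc (-X) X)ᶜ, f x := by
    rw [← h]; ring
  rw [e]
  refine (norm_sub_le _ _).trans ?_
  gcongr
  have hi : MeasureTheory.Integrable (fun x => Real.exp (-(X^2 / (2 * V^2))) * gw (Real.sqrt 2 * V) x) :=
    (gw_integrable _ (by positivity)).const_mul _
  calc ‖∫ x in (Set.Ioc (-X) X)ᶜ, f x‖ ≤ ∫ x in (Set.Ioc (-X) X)ᶜ, Real.exp (-(X^2 / (2 * V^2))) * gw (Real.sqrt 2 * V) x := by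
        apply MeasureTheory.norm_integral_le_of_norm_le hi.integrableOn
        filter_upwards [MeasureTheory.ae_restrict_mem measurableSet_Ioc.compl] with x hx
        refine (hb x).trans ?_
        have hx2 : X ^ 2 ≤ x ^ 2 := by
          simp only [Set.mem_compl_iff, Set.mem_Ioc, not_and_or, not_lt, not_le] at hx
          rcases hx with h | h <;> nlinarith
        unfold gw
        rw [← Real.exp_add]
        gcongr
        rw [div_pow, div_pow, mul_pow, Real.sq_sqrt (by norm_num)]
        have : X^2 / (2 * V^2) ≤ x^2 / (2 * V^2) := by gcongr
        have e2 : x^2 / V^2 = x^2/(2*V^2) + x^2/(2*V^2) := by field_simp; ring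
        linarith
    _ ≤ ∫ x, Real.exp (-(X^2 / (2 * V^2))) * gw (Real.sqrt 2 * V) x :=
        MeasureTheory.setIntegral_le_integral hi (by filter_upwards with x; exact mul_nonneg (Real.exp_pos _).le (gw_pos _ x).le)
    _ = Real.exp (-(X^2 / (2 * V^2))) * (Real.sqrt Real.pi * (Real.sqrt 2 * V)) := by
        rw [MeasureTheory.integral_const_mul, gw_integral _ (by positivity)]
    _ ≤ Real.exp (-(X^2 / (2 * V^2))) * (2 * (2 * V)) := by
        gcongr
        · exact sqrt_pi_le
        · rw [Real.sqrt_le_left (by norm_num)]; norm_num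
    _ = _ := by ring

lemma gauss_full (V ξ q : ℝ) (hV : 0 < V) :
    ‖∫ x : ℝ, (gw V x : ℂ) * ee (ξ * x + q * x ^ 2)‖ ≤ 2 * V * Real.exp (-(ξ^2 * V^2 / (4 * (1 + q^2 * V^4)))) := by
  set b : ℂ := (1 / V^2 : ℝ) - Complex.I * q with hb
  have hre : b.re = 1 / V^2 := by
    rw [hb, Complex.sub_re, Complex.ofReal_re]; simp
  have him : b.im = -q := by
    rw [hb, Complex.sub_im, Complex.ofReal_im]; simp
  have hbpos : 0 < b.re := by rw [hre]; positivity
  have hF := fourierIntegral_gaussian hbpos ξ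
  have e : (fun x : ℝ => (gw V x : ℂ) * ee (ξ * x + q * x ^ 2)) = fun x : ℝ => Complex.exp (Complex.I * ξ * x) * Complex.exp (-b * x^2) := by
    ext x
    rw [gw_eq]; unfold ee
    rw [Complex.ofReal_exp, ← Complex.exp_add, ← Complex.exp_add]
    congr 1; rw [hb]; push_cast; ring
  rw [e, hF, norm_mul, Complex.norm_exp]
  have hb0 : b ≠ 0 := by intro h; rw [h] at hbpos; simp at hbpos
  have hnb : 1 / V^2 ≤ ‖b‖ := by rw [← hre]; exact Complex.re_le_norm b
  have h1 : ‖((Real.pi : ℂ) / b) ^ (1/2 : ℂ)‖ ≤ 2 * V := by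
    have : (1/2 : ℂ) = ((1/2 : ℝ) : ℂ) := by push_cast; rfl
    rw [this, Complex.norm_cpow_real, norm_div, Complex.norm_real, Real.norm_of_nonneg Real.pi_pos.le, ← Real.sqrt_eq_rpow]
    rw [Real.sqrt_le_left (by positivity)]
    calc Real.pi / ‖b‖ ≤ 4 / (1 / V^2) := by gcongr; exact Real.pi_lt_four.le
      _ = (2 * V)^2 := by field_simp; ring
  have h2 : (-(ξ:ℂ)^2 / (4 * b)).re = -(ξ^2 * V^2 / (4 * (1 + q^2 * V^4))) := by
    have hns : Complex.normSq b = 1 / V^4 + q^2 := by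
      rw [Complex.normSq_apply, hre, him]; field_simp
    have : (-(ξ:ℂ)^2 / (4 * b)) = ((-(ξ^2) / 4 : ℝ) : ℂ) * b⁻¹ := by push_cast; field_simp
    rw [this, Complex.re_ofReal_mul, Complex.inv_re, hns, hre]
    field_simp
  rw [h2]
  gcongr

lemma JJ_bound (V X ξ q : ℝ) (hV : 0 < V) (hX : 0 ≤ X) :
    ‖JJ V X ξ q‖ ≤ 2 * V * (Real.exp (-(ξ^2 * V^2 / (4 * (1 + q^2 * V^4)))) + 2 * Real.exp (-(X^2 / (2 * V^2)))) := by
  unfold JJ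
  have hn : ∀ x, ‖(gw V x : ℂ) * ee (ξ * x + q * x ^ 2)‖ = gw V x := by
    intro x; rw [norm_mul, ee_norm, mul_one, Complex.norm_real, Real.norm_of_nonneg (gw_pos V x).le]
  have hc : Continuous (fun x : ℝ => (gw V x : ℂ) * ee (ξ * x + q * x ^ 2)) := by fun_prop
  have hIItg : MeasureTheory.Integrable (fun x : ℝ => (gw V x : ℂ) * ee (ξ * x + q * x ^ 2)) := by
    apply (gw_integrable V hV).mono' hc.aestronglyMeasurable
    filter_upwards with x; exact (hn x).le
  have := tail_bound V X hV hX _ hIItg (fun x => (hn x).le)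
  have h2 := gauss_full V ξ q hV
  linarith

lemma JJ_zero (V X : ℝ) : JJ V X 0 0 = (J0 V X : ℂ) := by
  unfold JJ J0
  rw [← intervalIntegral.integral_ofReal]
  congr 1; ext x; simp [ee_zero]

/-- bounding a weighted integral -/
lemma win_bound (V X B : ℝ) (hX : 0 ≤ X) (f : ℝ → ℂ) (hb : ∀ x, |x| ≤ X → ‖f x‖ ≤ B) :
    ‖∫ x in (-X)..X, (gw V x : ℂ) * f x‖ ≤ B * J0 V X := by
  have h : ‖∫ x in (-X)..X, (gw V x : ℂ) * f x‖ ≤ ∫ x in (-X)..X, B * gw V x := by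
    apply intervalIntegral.norm_integral_le_of_norm_le (by linarith)
    · filter_upwards with x hx
      rw [norm_mul, Complex.norm_real, Real.norm_of_nonneg (gw_pos V x).le, mul_comm]
      exact mul_le_mul_of_nonneg_right (hb x (abs_le.mpr ⟨hx.1.le, hx.2⟩)) (gw_pos V x).le
    · exact ((gw_cont V).const_mul B |>.intervalIntegrable _ _)
  rwa [intervalIntegral.integral_const_mul] at h

lemma JJ_diff (V X ξ : ℝ) (hX : 0 ≤ X) : ‖JJ V X ξ 0 - J0 V X‖ ≤ |ξ| * X * J0 V X := by
  rw [← JJ_zero]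
  unfold JJ
  rw [← intervalIntegral.integral_sub]
  · have : ∀ x : ℝ, (gw V x : ℂ) * ee (ξ * x + 0 * x ^ 2) - (gw V x : ℂ) * ee (0 * x + 0 * x ^ 2) = (gw V x : ℂ) * (ee (ξ * x) - 1) := by
      intro x; simp [ee_zero]; ring
    simp_rw [this]
    apply win_bound V X _ hX
    intro x hx
    refine (ee_sub_one_le _).trans ?_
    rw [abs_mul]; gcongr
  · apply Continuous.intervalIntegrable; fun_prop
  · apply Continuous.intervalIntegrable; fun_prop


lemma sum_inv_sqrt (N : ℕ) : ∑ m ∈ Finset.Icc 1 N, 1 / Real.sqrt m ≤ 2 * Real.sqrt N := by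
  induction N with
  | zero => simp
  | succ N ih =>
    rw [Finset.sum_Icc_succ_top (by omega)]
    set a := Real.sqrt N with ha
    set b := Real.sqrt ((N + 1 : ℕ) : ℝ) with hb
    have ha0 : 0 ≤ a := Real.sqrt_nonneg _
    have hb0 : 0 < b := Real.sqrt_pos.mpr (by positivity)
    have ha2 : a ^ 2 = N := Real.sq_sqrt (by positivity)
    have hb2 : b ^ 2 = N + 1 := by rw [hb, Real.sq_sqrt (by positivity)]; push_cast; ring
    have : 1 / b ≤ 2 * b - 2 * a := by
      rw [div_le_iff₀ hb0]; nlinarith [sq_nonneg (a - b)]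
    linarith

lemma half_sub_norm (t : ℝ) : |t| ≤ ‖(1/2 - Complex.I * t : ℂ)‖ := by
  have := Complex.abs_im_le_norm (1/2 - Complex.I * t : ℂ)
  simpa using this

lemma half_sub_ne (t : ℝ) : (1/2 - Complex.I * t : ℂ) ≠ 0 := by
  intro h; have := congrArg Complex.re h; norm_num at this

lemma zeta_bound (t : ℝ) (ht : 1 ≤ t) : ‖riemannZeta (1/2 + Complex.I * t)‖ ≤ 20 * Real.sqrt t := by
  obtain ⟨N, hN⟩ : ∃ N : ℕ, N = ⌈t⌉₊ := ⟨_, rfl⟩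
  have hN1 : t ≤ N := by rw [hN]; exact Nat.le_ceil t
  have hN2 : (N:ℝ) ≤ 2 * t := by rw [hN]; linarith [(Nat.ceil_lt_add_one (by linarith : 0 ≤ t)).le]
  have hN0 : 1 ≤ N := by exact_mod_cast ht.trans hN1
  have h := zeta_approx N hN0 t
  have ht0 : |t| = t := abs_of_nonneg (by linarith)
  have hz : ‖zN N t‖ ≤ 3 * Real.sqrt N := by
    unfold zN
    refine (norm_sub_le _ _).trans ?_
    have h1 : ‖∑ m ∈ Finset.Icc 1 N, ((1 / Real.sqrt m : ℝ) : ℂ) * ee (-(t * Real.log m))‖ ≤ 2 * Real.sqrt N := by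
      refine (norm_sum_le _ _).trans (le_trans (Finset.sum_le_sum (fun m _ => ?_)) (sum_inv_sqrt N))
      rw [norm_mul, ee_norm, mul_one, Complex.norm_real, Real.norm_of_nonneg (by positivity)]
    have h2 : ‖pole N t‖ ≤ Real.sqrt N := by
      unfold pole
      rw [norm_div, norm_mul, ee_norm, mul_one, Complex.norm_real, Real.norm_of_nonneg (by positivity)]
      apply div_le_self (by positivity)
      have := half_sub_norm t
      rw [ht0] at this; linarith
    linarith
  have hs : Real.sqrt N ≤ 3/2 * Real.sqrt t := by
    calc Real.sqrt N ≤ Real.sqrt ((3/2)^2 * t) := Real.sqrt_le_sqrt (by nlinarith)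
      _ = 3/2 * Real.sqrt t := by rw [Real.sqrt_mul (by norm_num), Real.sqrt_sq (by norm_num)]
  have hs0 : 0 < Real.sqrt t := Real.sqrt_pos.mpr (by linarith)
  have he : 6 * (1 + |t|) / Real.sqrt N ≤ 12 * Real.sqrt t := by
    rw [ht0]
    calc 6 * (1 + t) / Real.sqrt N ≤ 6 * (2 * t) / Real.sqrt t := by
          gcongr; linarith
      _ = 12 * Real.sqrt t := by
          rw [div_eq_iff hs0.ne', mul_assoc, Real.mul_self_sqrt (by linarith)]; ring
  have := norm_sub_norm_le (riemannZeta (1/2 + Complex.I * t)) (zN N t)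
  linarith

/-- Coefficients of the Dirichlet polynomial approximating zeta near height `T0`. -/
noncomputable def dco (N : ℕ) (T0 : ℝ) (m : ℕ) : ℂ :=
  ((1 / Real.sqrt m : ℝ) : ℂ) - if m = N then (Real.sqrt N : ℂ) / (1/2 - Complex.I * T0) else 0

lemma dco_eq (N : ℕ) (T0 : ℝ) (m : ℕ) (h : m ≠ N) : dco N T0 m = ((1 / Real.sqrt m : ℝ) : ℂ) := by
  simp [dco, h]

lemma dco_le (N : ℕ) (T0 : ℝ) (hT : 1 ≤ T0) (m : ℕ) (hm : 1 ≤ m) (hN : 1 ≤ N) : ‖dco N T0 m‖ ≤ 2 * Real.sqrt N := by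
  have hm1 : 1 ≤ Real.sqrt m := by rw [Real.one_le_sqrt]; exact_mod_cast hm
  have hN1 : 1 ≤ Real.sqrt N := by rw [Real.one_le_sqrt]; exact_mod_cast hN
  have h1 : ‖((1 / Real.sqrt m : ℝ) : ℂ)‖ ≤ 1 := by
    rw [Complex.norm_real, Real.norm_of_nonneg (by positivity)]
    exact (div_le_one (by linarith)).mpr hm1
  have h2 : ‖(if m = N then (Real.sqrt N : ℂ) / (1/2 - Complex.I * T0) else 0)‖ ≤ Real.sqrt N := by
    split_ifs
    · rw [norm_div, Complex.norm_real, Real.norm_of_nonneg (by positivity)]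
      apply div_le_self (by positivity)
      have := half_sub_norm T0
      rw [abs_of_nonneg (by linarith)] at this; linarith
    · simp
  unfold dco
  refine (norm_sub_le _ _).trans ?_
  linarith

lemma zeta_dir (N : ℕ) (hN : 1 ≤ N) (T0 Y : ℝ) (hT : 1 ≤ T0) (hY : Y ≤ T0 / 2) (y : ℝ) (hy : |y| ≤ Y) :
    ‖riemannZeta (1/2 + Complex.I * (T0 + y : ℝ)) - ∑ m ∈ Finset.Icc 1 N, dco N T0 m * ee (-((T0 + y) * Real.log m))‖
      ≤ 6 * (1 + 2 * T0) / Real.sqrt N + 2 * Real.sqrt N * Y / T0 ^ 2 := by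
  have hyy := abs_le.mp hy
  have h := zeta_approx N hN (T0 + y)
  have e : ∑ m ∈ Finset.Icc 1 N, dco N T0 m * ee (-((T0 + y) * Real.log m)) =
      zN N (T0 + y) + (pole N (T0+y) - (Real.sqrt N : ℂ) / (1/2 - Complex.I * T0) * ee (-((T0 + y) * Real.log N))) := by
    unfold zN dco
    simp_rw [sub_mul, Finset.sum_sub_distrib, ite_mul, zero_mul]
    rw [Finset.sum_ite_eq' ]
    simp only [Finset.mem_Icc, le_refl, and_true, hN, if_true]
    ring
  rw [e, ← sub_sub]
  refine (norm_sub_le _ _).trans ?_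
  apply add_le_add
  · refine h.trans ?_
    gcongr
    rw [abs_of_nonneg (by linarith)]; linarith
  · have e2 : pole N (T0+y) - (Real.sqrt N : ℂ) / (1/2 - Complex.I * T0) * ee (-((T0 + y) * Real.log N)) =
        (Real.sqrt N : ℂ) * ee (-((T0 + y) * Real.log N)) * (Complex.I * y / ((1/2 - Complex.I * (T0 + y : ℝ)) * (1/2 - Complex.I * T0))) := by
      unfold pole
      have h1 := half_sub_ne (T0 + y)
      have h2 := half_sub_ne T0
      rw [div_mul_eq_mul_div, div_sub_div _ _ h1 h2, mul_div_assoc']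
      congr 1; push_cast; ring
    rw [e2, norm_mul, norm_mul, ee_norm, mul_one, Complex.norm_real, Real.norm_of_nonneg (by positivity), norm_div,
      norm_mul, norm_mul, Complex.norm_I, one_mul, Complex.norm_real, Real.norm_eq_abs]
    have h1 := half_sub_norm (T0 + y)
    have h2 := half_sub_norm T0
    rw [abs_of_nonneg (by linarith)] at h1 h2
    have h1' : T0 / 2 ≤ ‖(1/2 - Complex.I * (T0 + y : ℝ) : ℂ)‖ := by linarith
    have hY0 : 0 ≤ Y := (abs_nonneg y).trans hy
    calc Real.sqrt N * (|y| / (‖(1/2 - Complex.I * (T0 + y : ℝ) : ℂ)‖ * ‖(1/2 - Complex.I * T0 : ℂ)‖)) ≤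
        Real.sqrt N * (Y / (T0/2 * T0)) := by gcongr
      _ = _ := by field_simp


/-- Fejér kernel. -/
noncomputable def fej (N : ℕ) (x : ℝ) : ℝ :=
  ∑ j ∈ Finset.range N, (1 + 2 * ∑ k ∈ Finset.range j, Real.cos (2 * (k + 1) * x))

lemma dir_id (j : ℕ) (x : ℝ) : Real.sin x * (1 + 2 * ∑ k ∈ Finset.range j, Real.cos (2 * (k + 1) * x)) = Real.sin ((2 * j + 1) * x) := by
  induction j with
  | zero => simp
  | succ j ih =>
    rw [Finset.sum_range_succ]
    have h1 : (2 * ((j + 1 : ℕ):ℝ) + 1) * x = 2 * (j + 1) * x + x := by push_cast; ring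
    have h2 : (2 * (j:ℝ) + 1) * x = 2 * (j + 1) * x - x := by ring
    rw [h2, Real.sin_sub] at ih
    rw [h1, Real.sin_add]; linear_combination ih

lemma fej_id (N : ℕ) (x : ℝ) : Real.sin x ^ 2 * fej N x = Real.sin (N * x) ^ 2 := by
  unfold fej
  induction N with
  | zero => simp
  | succ N ih =>
    rw [Finset.sum_range_succ, mul_add, ih, sq (Real.sin x), mul_assoc, dir_id]
    have h1 : (2 * (N:ℝ) + 1) * x = N * x + (N + 1 : ℕ) * x := by push_cast; ring
    have h2 : x = (N + 1 : ℕ) * x - N * x := by push_cast; ring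
    rw [h1]
    nth_rewrite 2 [h2]
    rw [Real.sin_add, Real.sin_sub]
    have c1 := Real.sin_sq_add_cos_sq (N * x)
    have c2 := Real.sin_sq_add_cos_sq ((N + 1 : ℕ) * x)
    linear_combination (Real.sin ((N + 1 : ℕ) * x)^2) * c1 - Real.sin (N * x)^2 * c2

@[fun_prop]
lemma fej_cont (N : ℕ) : Continuous (fej N) := by unfold fej; fun_prop

lemma fej_int (N : ℕ) : ∫ x in (0:ℝ)..(Real.pi/2), fej N x = N * (Real.pi / 2) := by
  unfold fej
  rw [intervalIntegral.integral_finsetSum (fun i _ => by apply Continuous.intervalIntegrable; fun_prop)]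
  have : ∀ j ∈ Finset.range N, ∫ x in (0:ℝ)..(Real.pi/2), (1 + 2 * ∑ k ∈ Finset.range j, Real.cos (2 * (k + 1) * x)) = Real.pi / 2 := by
    intro j _
    rw [intervalIntegral.integral_add (by simp) (by apply Continuous.intervalIntegrable; fun_prop),
      intervalIntegral.integral_const_mul, intervalIntegral.integral_finsetSum (fun i _ => by apply Continuous.intervalIntegrable; fun_prop)]
    have h0 : ∀ k ∈ Finset.range j, ∫ x in (0:ℝ)..(Real.pi/2), Real.cos (2 * (k + 1) * x) = 0 := by
      intro k _
      rw [intervalIntegral.integral_comp_mul_left (fun x => Real.cos x) (by positivity), integral_cos]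
      have : 2 * ((k:ℝ) + 1) * (Real.pi / 2) = ((k + 1 : ℕ) : ℝ) * Real.pi := by push_cast; ring
      rw [this, Real.sin_nat_mul_pi]; simp
    rw [Finset.sum_congr rfl h0]; simp
  rw [Finset.sum_congr rfl this]; simp

lemma sinc_int_nat (N : ℕ) (hN : 1 ≤ N) : (1 - 1 / N) * (Real.pi / 2) ≤ ∫ x in (0:ℝ)..(N * (Real.pi / 2)), Real.sinc x ^ 2 := by
  have hN0 : (0:ℝ) < N := by exact_mod_cast hN
  have hs : (N:ℝ) * ∫ x in (0:ℝ)..(Real.pi / 2), Real.sinc (N * x) ^ 2 = ∫ x in (0:ℝ)..(N * (Real.pi / 2)), Real.sinc x ^ 2 := by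
    rw [intervalIntegral.integral_comp_mul_left (fun x => Real.sinc x ^ 2) hN0.ne', smul_eq_mul, mul_zero, mul_inv_cancel_left₀ hN0.ne']
  have hcs := Real.continuous_sinc
  have hm : ∫ x in (0:ℝ)..(Real.pi/2), (fej N x - 1) ≤ ∫ x in (0:ℝ)..(Real.pi/2), (N:ℝ)^2 * Real.sinc (N * x) ^ 2 := by
    apply intervalIntegral.integral_mono_on_of_le_Ioo (by positivity)
    · apply Continuous.intervalIntegrable; fun_prop
    · apply Continuous.intervalIntegrable; fun_prop
    · intro x hx
      have hx0 : 0 < x := hx.1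
      rw [Real.sinc_of_ne_zero (by positivity)]
      have hsin : 0 < Real.sin x := Real.sin_pos_of_pos_of_lt_pi hx0 (by linarith [hx.2, Real.pi_pos])
      have hcos : 0 < Real.cos x := Real.cos_pos_of_mem_Ioo ⟨by linarith [hx.1, Real.pi_pos], hx.2⟩
      have htan : x * Real.cos x ≤ Real.sin x := by
        have := (Real.lt_tan hx0 hx.2).le
        rw [Real.tan_eq_sin_div_cos, le_div_iff₀ hcos] at this; exact this
      have hid := fej_id N x
      have e : (N:ℝ)^2 * (Real.sin (N * x) / (N * x))^2 = Real.sin x ^ 2 * fej N x / x^2 := by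
        rw [hid]; field_simp
      rw [e, le_div_iff₀ (by positivity)]
      have hk : x^2 ≤ Real.sin x ^2 + x^2 * Real.sin x^2 := by
        have : (x * Real.cos x)^2 ≤ Real.sin x ^2 := by gcongr
        rw [mul_pow, Real.cos_sq'] at this; linarith
      have hf : 0 ≤ fej N x := by
        have h1 : 0 ≤ Real.sin x ^ 2 * fej N x := by rw [hid]; positivity
        exact nonneg_of_mul_nonneg_right h1 (by positivity)
      have hf1 : Real.sin x ^ 2 * fej N x ≤ 1 := by rw [hid]; exact Real.sin_sq_le_one _
      nlinarith [mul_le_mul_of_nonneg_right hk hf, mul_le_mul_of_nonneg_left hf1 (sq_nonneg x)]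
  rw [intervalIntegral.integral_sub (by apply Continuous.intervalIntegrable; fun_prop) (by simp), fej_int,
    intervalIntegral.integral_const_mul, intervalIntegral.integral_const, smul_eq_mul] at hm
  rw [← hs]
  have : (N:ℝ) * ((1 - 1 / N) * (Real.pi / 2)) ≤ N * (N * ∫ x in (0:ℝ)..(Real.pi / 2), Real.sinc (N * x) ^ 2) := by
    have e1 : (N:ℝ) * ((1 - 1 / N) * (Real.pi / 2)) = N * (Real.pi/2) - Real.pi/2 := by field_simp
    rw [e1]; nlinarith
  exact le_of_mul_le_mul_left this hN0

lemma sinc_int (ε : ℝ) (hε : 0 < ε) : ∃ Y0 : ℝ, 0 < Y0 ∧ ∀ Y, Y0 ≤ Y → Real.pi / 2 - ε ≤ ∫ x in (0:ℝ)..Y, Real.sinc x ^ 2 := by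
  obtain ⟨N, hN⟩ := exists_nat_gt (2 / ε + 1)
  have hN0 : (0:ℝ) < N := lt_trans (by positivity) hN
  have hN1 : 1 ≤ N := by exact_mod_cast hN0
  refine ⟨N * (Real.pi/2), by positivity, fun Y hY => ?_⟩
  have h1 := sinc_int_nat N hN1
  have h2 : ∫ x in (0:ℝ)..(N * (Real.pi / 2)), Real.sinc x ^ 2 ≤ ∫ x in (0:ℝ)..Y, Real.sinc x ^ 2 := by
    apply intervalIntegral.integral_mono_interval le_rfl (by positivity) hY
    · filter_upwards with x; positivity
    · exact (Real.continuous_sinc.pow 2).intervalIntegrable _ _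
  have h3 : 1 / (N:ℝ) * (Real.pi/2) ≤ ε := by
    rw [one_div_mul_eq_div, div_le_iff₀ hN0]
    have : 2 / ε < N := by linarith
    rw [div_lt_iff₀ hε] at this
    linarith [Real.pi_lt_four]
  linarith

/-- The short exponential integral. -/
noncomputable def cc (h u : ℝ) : ℂ := ∫ v in (0:ℝ)..h, ee (v * u)

lemma cc_norm_le (h u : ℝ) (hh : 0 ≤ h) : ‖cc h u‖ ≤ h := by
  unfold cc
  have := intervalIntegral.norm_integral_le_of_norm_le_const (a := 0) (b := h) (f := fun v => ee (v * u)) (C := 1)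
    (fun v _ => (ee_norm _).le)
  rwa [one_mul, sub_zero, abs_of_nonneg hh] at this

lemma cc_lip (h u u' : ℝ) (hh : 0 ≤ h) : ‖cc h u - cc h u'‖ ≤ h ^ 2 * |u - u'| := by
  unfold cc
  rw [← intervalIntegral.integral_sub (by apply Continuous.intervalIntegrable; fun_prop) (by apply Continuous.intervalIntegrable; fun_prop)]
  have := intervalIntegral.norm_integral_le_of_norm_le_const (a := 0) (b := h) (f := fun v => ee (v * u) - ee (v * u')) (C := h * |u - u'|)
    (fun v hv => by
      rw [Set.uIoc_of_le hh] at hv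
      refine (ee_sub_le _ _).trans ?_
      rw [← mul_sub, abs_mul, abs_of_pos hv.1]
      gcongr; exact hv.2)
  rw [sub_zero, abs_of_nonneg hh] at this
  linarith

lemma cc_norm_sq (h u : ℝ) (hh : 0 < h) : ‖cc h u‖ ^ 2 = h ^ 2 * Real.sinc (h / 2 * u) ^ 2 := by
  by_cases hu : u = 0
  · subst hu
    simp [cc, ee_zero]
  · have hc : (Complex.I * u) ≠ 0 := by simp [hu]
    have e : cc h u = (ee (h * u) - 1) / (Complex.I * u) := by
      unfold cc
      have := integral_exp_mul_complex (a := 0) (b := h) hc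
      have e2 : ∀ v : ℝ, ee (v * u) = Complex.exp (Complex.I * u * v) := by
        intro v; unfold ee; push_cast; ring_nf
      simp_rw [e2]
      rw [this]; simp
    rw [e, norm_div, div_pow, norm_mul, Complex.norm_I, one_mul, Complex.norm_real, Real.norm_eq_abs, sq_abs,
      Real.sinc_of_ne_zero (by positivity), ← Complex.normSq_eq_norm_sq, ee_eq_cos]
    have : Complex.normSq ((Real.cos (h * u) : ℂ) + (Real.sin (h*u) : ℂ) * Complex.I - 1) = 4 * Real.sin (h / 2 * u)^2 := by
      rw [Complex.normSq_apply]
      simp only [Complex.add_re, Complex.sub_re, Complex.ofReal_re, Complex.mul_re, Complex.I_re, Complex.ofReal_im, Complex.I_im,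
        Complex.add_im, Complex.sub_im, Complex.mul_im, Complex.one_re, Complex.one_im]
      have h2 : h * u = 2 * (h/2 * u) := by ring
      rw [h2, Real.cos_two_mul, Real.sin_two_mul]
      have := Real.sin_sq_add_cos_sq (h/2*u)
      set s := Real.sin (h/2*u); set c := Real.cos (h/2*u)
      have hs : c^2 = 1 - s^2 := by linarith
      ring_nf
      rw [show c^4 = (c^2)^2 by ring, hs]; ring
    rw [this]; field_simp; ring

lemma cc_sq_lip (h u u' : ℝ) (hh : 0 ≤ h) : ‖cc h u‖^2 ≤ ‖cc h u'‖^2 + 2 * h^3 * |u - u'| := by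
  have h1 := cc_lip h u u' hh
  have h2 := norm_sub_norm_le (cc h u) (cc h u')
  have h3 := cc_norm_le h u hh
  have h4 := cc_norm_le h u' hh
  have h5 : (‖cc h u‖ - ‖cc h u'‖) * (‖cc h u‖ + ‖cc h u'‖) ≤ h^2 * |u - u'| * (2 * h) := by
    have : 0 ≤ ‖cc h u‖ + ‖cc h u'‖ := by positivity
    calc _ ≤ (h^2 * |u - u'|) * (‖cc h u‖ + ‖cc h u'‖) := by gcongr; linarith
      _ ≤ _ := by gcongr; linarith
  nlinarith

lemma cc_cont (h : ℝ) (hh : 0 < h) : Continuous (fun u => ‖cc h u‖^2) := by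
  have : (fun u => ‖cc h u‖^2) = fun u => h ^ 2 * Real.sinc (h / 2 * u) ^ 2 := funext fun u => cc_norm_sq h u hh
  rw [this]
  have := Real.continuous_sinc
  fun_prop

lemma S_sum_ge (L h : ℝ) (hh : 0 < h) (K M : ℕ) (hK : 1 ≤ K) (hKM : K ≤ M) :
    ∫ y in (K:ℝ)..M, ‖cc h (L - Real.log y)‖^2 / y ≤
      ∑ n ∈ Finset.Ioc K M, (‖cc h (L - Real.log n)‖^2 / n + (2 * h^3 + h^2) / K^2) := by
  have hK0 : (0:ℝ) < K := by exact_mod_cast hK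
  have hIItg : ∀ a b : ℝ, (K:ℝ) ≤ a → a ≤ b → IntervalIntegrable (fun y : ℝ => ‖cc h (L - Real.log y)‖^2 / y) MeasureTheory.volume a b := by
    intro a b ha hb
    apply ContinuousOn.intervalIntegrable
    rw [Set.uIcc_of_le hb]
    apply ContinuousOn.div
    · apply (cc_cont h hh).comp_continuousOn
      apply ContinuousOn.sub continuousOn_const
      apply Real.continuousOn_log.mono
      intro x hx; simp; linarith [hx.1]
    · exact continuousOn_id
    · intro x hx; linarith [hx.1]
  induction M, hKM using Nat.le_induction with
  | base => simp
  | succ M hKM ih =>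
    have hKM' : (K:ℝ) ≤ M := by exact_mod_cast hKM
    rw [← Finset.insert_Ioc_right_eq_Ioc_add_one hKM, Finset.sum_insert (by simp)]
    have hadd := intervalIntegral.integral_add_adjacent_intervals (hIItg K M le_rfl hKM') (hIItg M ((M+1:ℕ):ℝ) hKM' (by push_cast; linarith))
    rw [← hadd, add_comm]
    apply add_le_add _ ih
    set n : ℝ := ((M+1:ℕ):ℝ) with hn
    have hn' : n = M + 1 := by rw [hn]; push_cast; ring
    have hM0 : (0:ℝ) < M := by linarith
    calc ∫ y in (M:ℝ)..n, ‖cc h (L - Real.log y)‖^2 / y ≤ ∫ y in (M:ℝ)..n, (‖cc h (L - Real.log n)‖^2 / n + (2 * h^3 + h^2) / K^2) := by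
          apply intervalIntegral.integral_mono_on (by linarith) (hIItg _ _ hKM' (by linarith)) (by simp)
          intro y hy
          have hy0 : 0 < y := by linarith [hy.1]
          have hKy : (K:ℝ) ≤ y := by linarith [hy.1]
          have hlog : |(L - Real.log y) - (L - Real.log n)| ≤ 1 / K := by
            have h1 : Real.log y ≤ Real.log n := Real.log_le_log hy0 hy.2
            have h2 : Real.log n - Real.log y ≤ n / y - 1 := by
              rw [← Real.log_div (by linarith) (by linarith)]
              exact Real.log_le_sub_one_of_pos (by apply div_pos <;> linarith)
            have h3 : n / y - 1 ≤ 1 / K := by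
              rw [div_sub_one hy0.ne']
              gcongr; linarith [hy.1]
            rw [abs_le]; constructor <;> linarith [show (0:ℝ) < 1/K by positivity]
          have hg := cc_sq_lip h (L - Real.log y) (L - Real.log n) hh.le
          have hgn : ‖cc h (L - Real.log n)‖^2 ≤ h^2 := by
            have := cc_norm_le h (L - Real.log n) hh.le
            gcongr
          set A := ‖cc h (L - Real.log n)‖^2 with hA
          have hA0 : 0 ≤ A := by positivity
          have hg2 : ‖cc h (L - Real.log y)‖^2 ≤ A + 2 * h^3 / K := by
            have : 2 * h^3 * |(L - Real.log y) - (L - Real.log n)| ≤ 2 * h^3 * (1/K) := by gcongr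
            rw [mul_one_div] at this; linarith
          have e1 : ‖cc h (L - Real.log y)‖^2 / y ≤ (A + 2 * h^3 / K) / y := by gcongr
          have e2 : 2 * h^3 / K / y ≤ 2 * h^3 / K^2 := by
            rw [div_div, sq]; gcongr
          have e3 : A / y ≤ A / n + h^2 / K^2 := by
            have : A / y - A / n = A * ((n - y) / (y * n)) := by
              have : n ≠ 0 := by linarith
              field_simp
            have h4 : A * ((n - y) / (y * n)) ≤ h^2 * (1 / (K * K)) := by
              have : 0 ≤ n - y := by linarith [hy.2]
              have : 0 < n := by linarith
              gcongr
              · linarith [hy.1]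
              · linarith
            rw [mul_one_div, ← sq] at h4; linarith
          rw [add_div] at e1 ⊢
          linarith
      _ = _ := by
          rw [intervalIntegral.integral_const, smul_eq_mul, show n - M = 1 by linarith, one_mul]

lemma S_subst (L h : ℝ) (hh : 0 < h) (a b : ℝ) (ha : 0 < a) (hab : a ≤ b) :
    ∫ y in a..b, ‖cc h (L - Real.log y)‖^2 / y = ∫ u in (L - Real.log b)..(L - Real.log a), ‖cc h u‖^2 := by
  have hc := cc_cont h hh
  have hd : ∀ y ∈ Set.uIcc a b, HasDerivAt (fun y => -∫ u in (0:ℝ)..(L - Real.log y), ‖cc h u‖^2) (‖cc h (L - Real.log y)‖^2 / y) y := by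
    intro y hy
    rw [Set.uIcc_of_le hab] at hy
    have hy0 : 0 < y := by linarith [hy.1]
    have h1 : HasDerivAt (fun z => ∫ u in (0:ℝ)..z, ‖cc h u‖^2) (‖cc h (L - Real.log y)‖^2) (L - Real.log y) :=
      intervalIntegral.integral_hasDerivAt_right (hc.intervalIntegrable _ _) hc.stronglyMeasurable.stronglyMeasurableAtFilter hc.continuousAt
    have h2 : HasDerivAt (fun y => L - Real.log y) (-y⁻¹) y := (Real.hasDerivAt_log hy0.ne').const_sub L
    refine (h1.comp y h2).neg.congr_deriv ?_
    rw [div_eq_mul_inv]; ring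
  rw [intervalIntegral.integral_eq_sub_of_hasDerivAt hd]
  · rw [sub_neg_eq_add, add_comm, ← sub_eq_add_neg]
    rw [intervalIntegral.integral_interval_sub_left (hc.intervalIntegrable _ _) (hc.intervalIntegrable _ _)]
  · apply ContinuousOn.intervalIntegrable
    rw [Set.uIcc_of_le hab]
    apply ContinuousOn.div
    · apply hc.comp_continuousOn
      apply ContinuousOn.sub continuousOn_const
      apply Real.continuousOn_log.mono
      intro x hx; simp; linarith [hx.1]
    · exact continuousOn_id
    · intro x hx; linarith [hx.1]

lemma cc_int (h b : ℝ) (hh : 0 < h) : ∫ u in (0:ℝ)..b, ‖cc h u‖^2 = 2 * h * ∫ x in (0:ℝ)..(h/2*b), Real.sinc x^2 := by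
  simp_rw [cc_norm_sq h _ hh]
  rw [intervalIntegral.integral_const_mul, intervalIntegral.integral_comp_mul_left (fun x => Real.sinc x^2) (by positivity), smul_eq_mul, mul_zero]
  field_simp


noncomputable def KK (L : ℝ) : ℕ := ⌈Real.exp (7 * L / 8)⌉₊
noncomputable def MM (L : ℝ) : ℕ := ⌊Real.exp (L - Real.exp (-L / 4))⌋₊
noncomputable def NN (L : ℝ) : Finset ℕ := Finset.Ioc (KK L) (MM L)
noncomputable def SS (L h : ℝ) : ℝ := ∑ n ∈ NN L, ‖cc h (L - Real.log n)‖^2 / n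

lemma NN_mem (L : ℝ) (n : ℕ) (hn : n ∈ NN L) :
    1 ≤ n ∧ Real.exp (7 * L / 8) ≤ n ∧ Real.log n ≤ L - Real.exp (-L / 4) ∧ (n:ℝ) ≤ Real.exp L := by
  unfold NN at hn
  rw [Finset.mem_Ioc] at hn
  have h0 : 1 ≤ n := by omega
  have h0' : (0:ℝ) < n := by exact_mod_cast h0
  have h1 : Real.exp (7 * L / 8) ≤ n := (Nat.le_ceil _).trans (by exact_mod_cast hn.1.le)
  have h2 : (n:ℝ) ≤ Real.exp (L - Real.exp (-L / 4)) :=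
    (Nat.cast_le.mpr hn.2).trans (Nat.floor_le (Real.exp_pos _).le)
  refine ⟨h0, h1, ?_, ?_⟩
  · rw [← Real.log_exp (L - Real.exp (-L/4))]
    exact Real.log_le_log h0' h2
  · refine h2.trans (Real.exp_le_exp.mpr ?_)
    linarith [Real.exp_pos (-L/4)]

lemma MM_le (L : ℝ) : (MM L : ℝ) ≤ Real.exp L := by
  refine (Nat.floor_le (Real.exp_pos _).le).trans (Real.exp_le_exp.mpr ?_)
  linarith [Real.exp_pos (-L/4)]

lemma NN_card (L : ℝ) : ((NN L).card : ℝ) ≤ Real.exp L := by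
  refine le_trans ?_ (MM_le L)
  unfold NN
  rw [Nat.card_Ioc]
  exact_mod_cast Nat.sub_le _ _

lemma SS_upper (L h : ℝ) (hh : 0 ≤ h) : SS L h ≤ h^2 * Real.exp (L / 8) := by
  unfold SS
  calc ∑ n ∈ NN L, ‖cc h (L - Real.log n)‖^2 / n ≤ ∑ n ∈ NN L, h^2 / Real.exp (7 * L / 8) := by
        apply Finset.sum_le_sum
        intro n hn
        have := (NN_mem L n hn).2.1
        have := cc_norm_le h (L - Real.log n) hh
        gcongr
    _ = (NN L).card * (h^2 / Real.exp (7 * L / 8)) := by rw [Finset.sum_const, nsmul_eq_mul]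
    _ ≤ Real.exp L * (h^2 / Real.exp (7 * L / 8)) := by
        have := NN_card L
        gcongr
    _ = h^2 * Real.exp (L/8) := by
        rw [mul_div_assoc', div_eq_iff (Real.exp_pos _).ne', mul_assoc, ← Real.exp_add, mul_comm]; ring_nf

lemma sum_inv_upper (L : ℝ) : ∑ n ∈ NN L, 1 / (n:ℝ) ≤ Real.exp (L / 8) := by
  calc ∑ n ∈ NN L, 1 / (n:ℝ) ≤ ∑ n ∈ NN L, 1 / Real.exp (7 * L / 8) := by
        apply Finset.sum_le_sum
        intro n hn
        have := (NN_mem L n hn).2.1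
        gcongr
    _ = (NN L).card * (1 / Real.exp (7 * L / 8)) := by rw [Finset.sum_const, nsmul_eq_mul]
    _ ≤ Real.exp L * (1 / Real.exp (7 * L / 8)) := by
        have := NN_card L
        gcongr
    _ = Real.exp (L/8) := by
        rw [mul_div_assoc', div_eq_iff (Real.exp_pos _).ne', ← Real.exp_add, mul_one]; ring_nf

lemma S_lower (ε : ℝ) (hε : 0 < ε) : ∃ L0 Y0 : ℝ, ∀ L, L0 ≤ L → ∀ h, 0 < h → Y0 ≤ h * L → h ≤ Real.exp (L / 100) →
    (Real.pi - ε) * h ≤ SS L h := by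
  obtain ⟨Y0, hY0, hY⟩ := sinc_int (ε/4) (by positivity)
  have htend : Tendsto (fun L : ℝ => Real.exp (-(L / 5))) atTop (nhds 0) := by
    apply Real.tendsto_exp_neg_atTop_nhds_zero.comp
    exact tendsto_id.atTop_div_const (by norm_num)
  have hev := htend.eventually (gt_mem_nhds (show (0:ℝ) < ε / 10 by positivity))
  obtain ⟨L1, hL1⟩ := eventually_atTop.mp hev
  refine ⟨max 1000 L1, 32 * Y0, fun L hL h hh hhL hhe => ?_⟩
  have hL1000 : 1000 ≤ L := (le_max_left _ _).trans hL
  have hsmall := hL1 L ((le_max_right _ _).trans hL)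
  set δ := Real.exp (-L/4) with hδ
  have hδ0 : 0 < δ := Real.exp_pos _
  have hδ1 : δ ≤ 1 := by rw [hδ, Real.exp_le_one_iff]; linarith
  -- K bounds
  have hK1 : 1 ≤ KK L := Nat.one_le_ceil_iff.mpr (Real.exp_pos _)
  have hKge : Real.exp (7 * L / 8) ≤ KK L := Nat.le_ceil _
  have hKle : (KK L : ℝ) ≤ Real.exp (15 * L / 16) := by
    have h1 := (Nat.ceil_lt_add_one (Real.exp_pos (7 * L / 8)).le).le
    have h2 : 1 ≤ Real.exp (7 * L / 8) := Real.one_le_exp (by linarith)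
    have h3 : (2:ℝ) ≤ Real.exp (L/16) := by linarith [Real.add_one_le_exp (L/16)]
    have h4 : Real.exp (15 * L / 16) = Real.exp (7 * L / 8) * Real.exp (L/16) := by
      rw [← Real.exp_add]; ring_nf
    rw [h4]
    unfold KK; nlinarith [Real.exp_pos (7*L/8)]
  -- M bounds
  have hMge : Real.exp (L - 2 * δ) ≤ MM L := by
    have h1 : Real.exp (L - δ) < MM L + 1 := Nat.lt_floor_add_one _
    have h2 : Real.exp (L - δ) = Real.exp (L - 2*δ) * Real.exp δ := by rw [← Real.exp_add]; ring_nf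
    have h3 := Real.add_one_le_exp δ
    have h4 : 1 ≤ Real.exp (L - 2 * δ) * δ := by
      rw [hδ, ← Real.exp_add, ← hδ]; apply Real.one_le_exp; linarith
    nlinarith [Real.exp_pos (L - 2 * δ)]
  have hKM : KK L ≤ MM L := by
    have : (KK L : ℝ) ≤ MM L := hKle.trans (le_trans (Real.exp_le_exp.mpr (by linarith)) hMge)
    exact_mod_cast this
  have hK0 : (0:ℝ) < KK L := by exact_mod_cast hK1
  have hM0 : (0:ℝ) < MM L := lt_of_lt_of_le (Real.exp_pos _) hMge
  have h1 := S_sum_ge L h hh (KK L) (MM L) hK1 hKM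
  rw [Finset.sum_add_distrib, Finset.sum_const, nsmul_eq_mul, S_subst L h hh _ _ hK0 (by exact_mod_cast hKM)] at h1
  have hSS : ∑ n ∈ Finset.Ioc (KK L) (MM L), ‖cc h (L - Real.log n)‖^2 / n = SS L h := rfl
  rw [hSS] at h1
  have hlogK : L / 16 ≤ L - Real.log (KK L) := by
    have := Real.log_le_log hK0 hKle
    rw [Real.log_exp] at this; linarith
  have hlogM : L - Real.log (MM L) ≤ 2 * δ := by
    have := Real.log_le_log (Real.exp_pos _) hMge
    rw [Real.log_exp] at this; linarith
  have hc := cc_cont h hh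
  have h2 : ∫ u in (2*δ)..(L/16), ‖cc h u‖^2 ≤ ∫ u in (L - Real.log (MM L))..(L - Real.log (KK L)), ‖cc h u‖^2 := by
    apply intervalIntegral.integral_mono_interval hlogM (by linarith) hlogK
    · filter_upwards with x; positivity
    · exact hc.intervalIntegrable _ _
  have h3 : ∫ u in (2*δ)..(L/16), ‖cc h u‖^2 = (∫ u in (0:ℝ)..(L/16), ‖cc h u‖^2) - ∫ u in (0:ℝ)..(2*δ), ‖cc h u‖^2 := by
    rw [intervalIntegral.integral_interval_sub_left (hc.intervalIntegrable _ _) (hc.intervalIntegrable _ _)]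
  have h4 : ∫ u in (0:ℝ)..(2*δ), ‖cc h u‖^2 ≤ 2 * δ * h^2 := by
    calc ∫ u in (0:ℝ)..(2*δ), ‖cc h u‖^2 ≤ ∫ u in (0:ℝ)..(2*δ), h^2 := by
          apply intervalIntegral.integral_mono_on (by positivity) (hc.intervalIntegrable _ _) (by simp)
          intro u _
          have := cc_norm_le h u hh.le
          gcongr
      _ = _ := by simp
  rw [cc_int h _ hh] at h3
  have h5 := hY (h/2 * (L/16)) (by nlinarith)
  have h6 : ((Finset.Ioc (KK L) (MM L)).card : ℝ) * ((2 * h^3 + h^2) / (KK L)^2) ≤ (2 * h^3 + h^2) * Real.exp (-(3*L/4)) := by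
    have hcard := NN_card L
    unfold NN at hcard
    calc _ ≤ Real.exp L * ((2 * h^3 + h^2) / (Real.exp (7 * L / 8))^2) := by gcongr
      _ = _ := by
        rw [← Real.exp_nat_mul, mul_div_assoc', div_eq_iff (Real.exp_pos _).ne', mul_assoc, ← Real.exp_add, mul_comm]
        congr 2; push_cast; ring
  -- smallness
  have hE : 1 ≤ Real.exp (L/100) := Real.one_le_exp (by linarith)
  have h7 : h * δ ≤ Real.exp (-(L/5)) := by
    calc h * δ ≤ Real.exp (L/100) * δ := by gcongr
      _ = Real.exp (L/100 + -L/4) := by rw [hδ, Real.exp_add]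
      _ ≤ _ := Real.exp_le_exp.mpr (by linarith)
  have h8 : (2 * h^2 + h) * Real.exp (-(3*L/4)) ≤ 3 * Real.exp (-(L/5)) := by
    have : 2 * h^2 + h ≤ 3 * Real.exp (L/50) := by
      have e : Real.exp (L/50) = Real.exp (L/100)^2 := by rw [← Real.exp_nat_mul]; congr 1; push_cast; ring
      rw [e]; nlinarith
    calc _ ≤ 3 * Real.exp (L/50) * Real.exp (-(3*L/4)) := by gcongr
      _ = 3 * Real.exp (L/50 + -(3*L/4)) := by rw [Real.exp_add]; ring
      _ ≤ _ := by gcongr; linarith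
  have h9 : (2 * h^3 + h^2) * Real.exp (-(3*L/4)) ≤ 3 * Real.exp (-(L/5)) * h := by
    calc _ = (2 * h^2 + h) * Real.exp (-(3*L/4)) * h := by ring
      _ ≤ _ := by gcongr
  have h10 : 2 * δ * h^2 ≤ 2 * Real.exp (-(L/5)) * h := by nlinarith
  nlinarith


lemma theta_cont : Continuous (fun t => ee (RSTheta t)) := by
  have h : (fun t => ee (RSTheta t)) = fun t : ℝ => Complex.Gamma (1 / 4 + Complex.I * t / 2) /
      ‖Complex.Gamma (1 / 4 + Complex.I * t / 2)‖ * ee (-(t / 2 * Real.log Real.pi)) := funext ee_theta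
  rw [h]
  have hG : Continuous (fun t : ℝ => Complex.Gamma (1 / 4 + Complex.I * t / 2)) := by
    rw [continuous_iff_continuousAt]
    intro t
    have h1 : ContinuousAt Complex.Gamma (1 / 4 + Complex.I * t / 2) := by
      apply DifferentiableAt.continuousAt (𝕜 := ℂ)
      apply Complex.differentiableAt_Gamma
      intro m hm
      have := congrArg Complex.re hm
      simp at this
      have h0 : (0:ℝ) ≤ m := by positivity
      linarith
    exact ContinuousAt.comp (f := fun t : ℝ => (1 / 4 + Complex.I * t / 2 : ℂ)) h1 (by fun_prop)
  apply Continuous.mul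
  · apply hG.div
    · exact Complex.continuous_ofReal.comp hG.norm
    · intro t; exact_mod_cast (norm_ne_zero_iff.mpr (gam_ne t))
  · fun_prop

lemma half_ne_one (t : ℝ) : (1 / 2 + Complex.I * t : ℂ) ≠ 1 := by
  intro h
  have := congrArg Complex.re h
  norm_num at this

lemma zeta_cont : Continuous (fun t : ℝ => riemannZeta (1 / 2 + Complex.I * t)) := by
  rw [continuous_iff_continuousAt]
  intro t
  exact ContinuousAt.comp (f := fun t : ℝ => (1 / 2 + Complex.I * t : ℂ)) (differentiableAt_riemannZeta (half_ne_one t)).continuousAt (by fun_prop)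

lemma HardyZ_cont : Continuous HardyZ := by
  unfold HardyZ
  exact Complex.continuous_re.comp (theta_cont.mul zeta_cont)

lemma HardyZ_eq (t : ℝ) : (HardyZ t : ℂ) = ee (RSTheta t) * riemannZeta (1 / 2 + Complex.I * t) := by
  have hz : (1 / 2 + Complex.I * t : ℂ) ≠ 0 := by
    intro h
    have := congrArg Complex.re h
    norm_num at this
  have hz2 : (1 / 2 + Complex.I * (-t : ℝ) : ℂ) ≠ 0 := by
    intro h
    have := congrArg Complex.re h
    norm_num at this
  set G := Complex.Gamma (1 / 4 + Complex.I * t / 2) with hG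
  have hGne : G ≠ 0 := gam_ne t
  have hpi : (Real.pi : ℂ) ≠ 0 := by exact_mod_cast Real.pi_ne_zero
  have hgr : ∀ u : ℝ, Complex.Gammaℝ (1 / 2 + Complex.I * u) =
      (Real.exp (-(Real.log Real.pi) / 4) : ℂ) * ee (-(u / 2 * Real.log Real.pi)) * Complex.Gamma (1 / 4 + Complex.I * u / 2) := by
    intro u
    rw [Complex.Gammaℝ_def, Complex.cpow_def_of_ne_zero hpi]
    congr 1
    · unfold ee
      rw [Complex.ofReal_exp, ← Complex.exp_add, ← Complex.ofReal_log Real.pi_pos.le]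
      push_cast; ring_nf
    · congr 1; ring
  -- completed zeta is real
  have hcr : (starRingEnd ℂ) (completedRiemannZeta (1 / 2 + Complex.I * t)) = completedRiemannZeta (1 / 2 + Complex.I * t) := by
    have e1 : completedRiemannZeta (1 / 2 + Complex.I * t) = riemannZeta (1 / 2 + Complex.I * t) * Complex.Gammaℝ (1 / 2 + Complex.I * t) := by
      rw [riemannZeta_def_of_ne_zero hz, div_mul_cancel₀]
      apply Complex.Gammaℝ_ne_zero_of_re_pos; simp
    have e2 : completedRiemannZeta (1 / 2 + Complex.I * (-t : ℝ)) = riemannZeta (1 / 2 + Complex.I * (-t : ℝ)) * Complex.Gammaℝ (1 / 2 + Complex.I * (-t : ℝ)) := by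
      rw [riemannZeta_def_of_ne_zero hz2, div_mul_cancel₀]
      apply Complex.Gammaℝ_ne_zero_of_re_pos; simp
    have c1 : (starRingEnd ℂ) (1 / 2 + Complex.I * t) = 1 / 2 + Complex.I * (-t : ℝ) := by
      simp [Complex.conj_ofNat]
    have c2 : (starRingEnd ℂ) (1 / 4 + Complex.I * t / 2) = 1 / 4 + Complex.I * (-t : ℝ) / 2 := by
      simp [Complex.conj_ofNat]
    have e3 : completedRiemannZeta (1 / 2 + Complex.I * (-t : ℝ)) = completedRiemannZeta (1 / 2 + Complex.I * t) := by
      rw [← completedRiemannZeta_one_sub]; congr 1; push_cast; ring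
    rw [← e3, e2]
    nth_rewrite 1 [← e2]
    rw [e3, e1, map_mul, ← riemannZeta_conj, c1]
    congr 1
    rw [hgr, hgr, map_mul, map_mul, ← Complex.Gamma_conj, ee_conj, Complex.conj_ofReal, c2]
    congr 3; ring
  have hreal : (starRingEnd ℂ) (ee (RSTheta t) * riemannZeta (1 / 2 + Complex.I * t)) = ee (RSTheta t) * riemannZeta (1 / 2 + Complex.I * t) := by
    have : ee (RSTheta t) * riemannZeta (1 / 2 + Complex.I * t) =
      ((‖G‖ * Real.exp (-(Real.log Real.pi) / 4) : ℝ) : ℂ)⁻¹ * completedRiemannZeta (1 / 2 + Complex.I * t) := by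
      rw [riemannZeta_def_of_ne_zero hz, hgr, ee_theta, ← hG]
      have h1 : (‖G‖ : ℂ) ≠ 0 := by exact_mod_cast norm_ne_zero_iff.mpr hGne
      have h2 : (Real.exp (-(Real.log Real.pi) / 4) : ℂ) ≠ 0 := by exact_mod_cast (Real.exp_pos _).ne'
      have h3 := ee_ne_zero (-(t / 2 * Real.log Real.pi))
      rw [Complex.ofReal_mul]
      generalize (Real.exp (-(Real.log Real.pi) / 4) : ℂ) = E at *
      generalize ee (-(t / 2 * Real.log Real.pi)) = F at *
      generalize completedRiemannZeta (1 / 2 + Complex.I * t) = C at *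
      field_simp
    rw [this, map_mul, hcr, ← Complex.ofReal_inv, Complex.conj_ofReal]
  have := Complex.conj_eq_iff_re.mp hreal
  rw [← this]; rfl


lemma JJ_trivial (V X ξ q : ℝ) (hX : 0 ≤ X) : ‖JJ V X ξ q‖ ≤ J0 V X := by
  have := win_bound V X 1 hX (fun x => ee (ξ * x + q * x^2)) (fun x _ => (ee_norm _).le)
  rw [one_mul] at this; exact this

lemma J0_nonneg (V X : ℝ) (hX : 0 ≤ X) : 0 ≤ J0 V X :=
  intervalIntegral.integral_nonneg (by linarith) (fun x _ => (gw_pos V x).le)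

lemma single_sum (V X ξ q : ℝ) (s : Finset ℕ) (α : ℕ → ℂ) (f : ℕ → ℝ) :
    ∫ x in (-X)..X, (gw V x : ℂ) * (ee (ξ * x + q * x^2) * ∑ m ∈ s, α m * ee (-(x * f m))) =
      ∑ m ∈ s, α m * JJ V X (ξ - f m) q := by
  have e : ∀ x : ℝ, (gw V x : ℂ) * (ee (ξ * x + q * x^2) * ∑ m ∈ s, α m * ee (-(x * f m))) =
      ∑ m ∈ s, α m * ((gw V x : ℂ) * ee ((ξ - f m) * x + q * x^2)) := by
    intro x
    rw [Finset.mul_sum, Finset.mul_sum]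
    apply Finset.sum_congr rfl
    intro m _
    have h : ee ((ξ - f m) * x + q * x^2) = ee (ξ * x + q * x^2) * ee (-(x * f m)) := by
      rw [← ee_add]; congr 1; ring
    rw [h]; ring
  simp_rw [e]
  rw [intervalIntegral.integral_finsetSum (fun m _ => by apply Continuous.intervalIntegrable; fun_prop)]
  apply Finset.sum_congr rfl
  intro m _
  rw [intervalIntegral.integral_const_mul]; rfl

lemma near_sum (L ρ : ℝ) (s : Finset ℕ) (hρ0 : 0 < ρ) (hρ : ρ ≤ 1) (hs : ∀ m ∈ s, 1 ≤ m ∧ |L - Real.log m| < ρ) :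
    ∑ m ∈ s, 1 / Real.sqrt m ≤ (3 * ρ * Real.exp L + 1) * (2 * Real.exp (-(L/2))) := by
  have hm : ∀ m ∈ s, Real.exp (L - ρ) < m ∧ (m:ℝ) < Real.exp (L + ρ) := by
    intro m hm
    obtain ⟨h1, h2⟩ := hs m hm
    have h1' : (0:ℝ) < m := by exact_mod_cast h1
    rw [abs_lt] at h2
    constructor
    · rw [← Real.lt_log_iff_exp_lt h1']; linarith
    · rw [← Real.log_lt_iff_lt_exp h1']; linarith
  have hcard : (s.card : ℝ) ≤ 3 * ρ * Real.exp L + 1 := by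
    have hsub : s ⊆ Finset.Ioc ⌊Real.exp (L - ρ)⌋₊ ⌊Real.exp (L + ρ)⌋₊ := by
      intro m hms
      rw [Finset.mem_Ioc]
      exact ⟨(Nat.floor_lt (Real.exp_pos _).le).mpr (hm m hms).1, Nat.le_floor (hm m hms).2.le⟩
    have h1 : s.card ≤ ⌊Real.exp (L + ρ)⌋₊ - ⌊Real.exp (L - ρ)⌋₊ := by
      rw [← Nat.card_Ioc]; exact Finset.card_le_card hsub
    have hle : ⌊Real.exp (L - ρ)⌋₊ ≤ ⌊Real.exp (L + ρ)⌋₊ := Nat.floor_mono (Real.exp_le_exp.mpr (by linarith))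
    have h2 : (s.card : ℝ) ≤ (⌊Real.exp (L + ρ)⌋₊ : ℝ) - ⌊Real.exp (L - ρ)⌋₊ := by
      rw [← Nat.cast_sub hle]; exact_mod_cast h1
    have h3 := Nat.floor_le (Real.exp_pos (L + ρ)).le
    have h4 := (Nat.lt_floor_add_one (Real.exp (L - ρ))).le
    have h5 : Real.exp ρ - Real.exp (-ρ) ≤ 3 * ρ := by
      have ha : Real.exp ρ ≤ 1 + 2 * ρ := by
        have := Real.abs_exp_sub_one_le (x := ρ) (by rw [abs_of_pos hρ0]; exact hρ)
        rw [abs_of_pos hρ0] at this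
        linarith [le_abs_self (Real.exp ρ - 1)]
      linarith [Real.add_one_le_exp (-ρ)]
    have h6 : Real.exp (L + ρ) - Real.exp (L - ρ) ≤ 3 * ρ * Real.exp L := by
      rw [Real.exp_add, sub_eq_add_neg L, Real.exp_add]
      nlinarith [Real.exp_pos L]
    linarith
  calc ∑ m ∈ s, 1 / Real.sqrt m ≤ ∑ m ∈ s, 2 * Real.exp (-(L/2)) := by
        apply Finset.sum_le_sum
        intro m hms
        have h1 := (hm m hms).1
        have h2 : Real.exp (L/2) / 2 ≤ Real.sqrt m := by
          apply Real.le_sqrt_of_sq_le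
          refine le_trans ?_ h1.le
          rw [div_pow, ← Real.exp_nat_mul, sub_eq_add_neg, Real.exp_add]
          have h3 : Real.exp (-1) ≤ Real.exp (-ρ) := Real.exp_le_exp.mpr (by linarith)
          have h4 : (1/4:ℝ) ≤ Real.exp (-1) := by
            rw [Real.exp_neg, one_div]
            gcongr
            linarith [Real.exp_one_lt_d9]
          rw [show ((2:ℕ):ℝ) * (L/2) = L by push_cast; ring]
          nlinarith [Real.exp_pos L]
        calc 1 / Real.sqrt m ≤ 1 / (Real.exp (L/2) / 2) := by gcongr
          _ = 2 * Real.exp (-(L/2)) := by rw [Real.exp_neg]; field_simp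
    _ = s.card * (2 * Real.exp (-(L/2))) := by rw [Finset.sum_const, nsmul_eq_mul]
    _ ≤ _ := by gcongr

lemma dco_sum (N : ℕ) (T0 V X L q ρ : ℝ) (hN : 1 ≤ N) (hT : 1 ≤ T0) (hV : 0 < V) (hX : 0 ≤ X)
    (hρ0 : 0 < ρ) (hρ : ρ ≤ 1) (hNL : L + 1 ≤ Real.log N) (hq : q^2 * V^4 ≤ 1) :
    ∑ m ∈ Finset.Icc 1 N, ‖dco N T0 m‖ * ‖JJ V X (L - Real.log m) q‖ ≤
      2 * V * ((3 * ρ * Real.exp L + 1) * (2 * Real.exp (-(L/2))) +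
        N * (2 * Real.sqrt N) * (Real.exp (-(ρ^2 * V^2 / 8)) + 2 * Real.exp (-(X^2 / (2 * V^2))))) := by
  rw [← Finset.sum_filter_add_sum_filter_not _ (fun m : ℕ => |L - Real.log m| < ρ), mul_add]
  have hJ := J0_le V X hV hX
  apply add_le_add
  · have hns := near_sum L ρ ((Finset.Icc 1 N).filter (fun m : ℕ => |L - Real.log m| < ρ)) hρ0 hρ (by
      intro m hm
      rw [Finset.mem_filter, Finset.mem_Icc] at hm
      exact ⟨hm.1.1, hm.2⟩)
    calc _ ≤ ∑ m ∈ (Finset.Icc 1 N).filter (fun m : ℕ => |L - Real.log m| < ρ), 2 * V * (1 / Real.sqrt m) := by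
          apply Finset.sum_le_sum
          intro m hm
          rw [Finset.mem_filter, Finset.mem_Icc] at hm
          have hmN : m ≠ N := by
            rintro rfl
            have := hm.2
            rw [abs_lt] at this; linarith
          rw [dco_eq N T0 m hmN, Complex.norm_real, Real.norm_of_nonneg (by positivity), mul_comm]
          gcongr
          exact (JJ_trivial V X _ _ hX).trans hJ
      _ = 2 * V * ∑ m ∈ (Finset.Icc 1 N).filter (fun m : ℕ => |L - Real.log m| < ρ), (1 / Real.sqrt m) := by rw [Finset.mul_sum]
      _ ≤ _ := by gcongr
  · set κ := (Real.exp (-(ρ^2 * V^2 / 8)) + 2 * Real.exp (-(X^2 / (2 * V^2)))) with hκ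
    have hκ0 : 0 < κ := by positivity
    calc _ ≤ ∑ m ∈ (Finset.Icc 1 N).filter (fun m : ℕ => ¬ |L - Real.log m| < ρ), (2 * Real.sqrt N) * (2 * V * κ) := by
          apply Finset.sum_le_sum
          intro m hm
          rw [Finset.mem_filter, Finset.mem_Icc, not_lt] at hm
          gcongr
          · exact dco_le N T0 hT m hm.1.1 hN
          · refine (JJ_bound V X _ q hV hX).trans ?_
            rw [hκ]
            have h1 : ρ^2 ≤ (L - Real.log m)^2 := by
              rw [← sq_abs (L - Real.log m)]; gcongr; exact hm.2
            have h2 : ρ^2 * V^2 / 8 ≤ (L - Real.log m)^2 * V^2 / (4 * (1 + q^2 * V^4)) := by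
              calc ρ^2 * V^2 / 8 ≤ (L - Real.log m)^2 * V^2 / (4 * (1 + 1)) := by
                    rw [show (4:ℝ) * (1+1) = 8 by norm_num]
                    exact div_le_div_of_nonneg_right (mul_le_mul_of_nonneg_right h1 (by positivity)) (by norm_num)
                _ ≤ _ := by gcongr
            have h3 := Real.exp_le_exp.mpr (neg_le_neg h2)
            exact mul_le_mul_of_nonneg_left (by linarith) (by positivity)
      _ ≤ N * ((2 * Real.sqrt N) * (2 * V * κ)) := by
          rw [Finset.sum_const, nsmul_eq_mul]
          gcongr
          refine (Finset.card_filter_le _ _).trans ?_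
          simp
      _ = _ := by ring

lemma small_core (T0 V X ρ : ℝ) (N : ℕ) (hN : 1 ≤ N) (hT : 10 ≤ T0) (hV : 0 < V) (hX : 0 ≤ X) (hX2 : X ≤ T0 / 2)
    (hρ0 : 0 < ρ) (hρ : ρ ≤ 1) (hNL : 1/2 * Real.log T0 + 201 ≤ Real.log N) (hq : (7 / T0)^2 * V^4 ≤ 1) :
    ‖∫ x in (-X)..X, (gw V x : ℂ) * (HardyZ (T0 + x) : ℂ)‖ ≤
      2 * V * (168 * X^3 / T0^2 * (20 * Real.sqrt (2 * T0)) + (6 * (1 + 2 * T0) / Real.sqrt N + 2 * Real.sqrt N * X / T0 ^ 2) +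
        ((3 * ρ * (Real.exp 200 * Real.sqrt T0) + 1) * (2 * (Real.exp 100 * (1 / Real.sqrt (Real.sqrt T0)))) +
        N * (2 * Real.sqrt N) * (Real.exp (-(ρ^2 * V^2 / 8)) + 2 * Real.exp (-(X^2 / (2 * V^2)))))) := by
  obtain ⟨L, q, hL, hqq, hth, -⟩ := theta_approx T0 hT
  have hT0 : 0 < T0 := by linarith
  rw [abs_le] at hL
  set D : ℝ → ℂ := fun x => ∑ m ∈ Finset.Icc 1 N, dco N T0 m * ee (-((T0 + x) * Real.log m)) with hD
  set E1 := 168 * X^3 / T0^2 * (20 * Real.sqrt (2 * T0)) with hE1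
  set E2 := 6 * (1 + 2 * T0) / Real.sqrt N + 2 * Real.sqrt N * X / T0 ^ 2 with hE2
  have hDc : Continuous D := by rw [hD]; fun_prop
  have hZc := HardyZ_cont
  have hsplit : ∫ x in (-X)..X, (gw V x : ℂ) * (HardyZ (T0 + x) : ℂ) =
      (∫ x in (-X)..X, (gw V x : ℂ) * ((HardyZ (T0 + x) : ℂ) - ee (RSTheta T0) * ee (L * x + q * x^2/2) * D x)) +
      ∫ x in (-X)..X, (gw V x : ℂ) * (ee (RSTheta T0) * ee (L * x + q * x^2/2) * D x) := by
    rw [← intervalIntegral.integral_add (by apply Continuous.intervalIntegrable; fun_prop) (by apply Continuous.intervalIntegrable; fun_prop)]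
    congr 1; ext x; ring
  rw [hsplit]
  have hmain : ∫ x in (-X)..X, (gw V x : ℂ) * (ee (RSTheta T0) * ee (L * x + q * x^2/2) * D x) =
      ee (RSTheta T0) * ∑ m ∈ Finset.Icc 1 N, (dco N T0 m * ee (-(T0 * Real.log m))) * JJ V X (L - Real.log m) (q/2) := by
    rw [← single_sum, ← intervalIntegral.integral_const_mul]
    congr 1; ext x
    have : D x = ∑ m ∈ Finset.Icc 1 N, dco N T0 m * ee (-(T0 * Real.log m)) * ee (-(x * Real.log m)) := by
      rw [hD]
      apply Finset.sum_congr rfl; intro m _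
      rw [show -((T0 + x) * Real.log m) = -(T0 * Real.log m) + -(x * Real.log m) by ring, ee_add]; ring
    rw [this, show L * x + q * x^2/2 = L * x + q/2 * x^2 by ring]; ring
  have hA : ‖∫ x in (-X)..X, (gw V x : ℂ) * ((HardyZ (T0 + x) : ℂ) - ee (RSTheta T0) * ee (L * x + q * x^2/2) * D x)‖ ≤ (E1 + E2) * J0 V X := by
    apply win_bound V X _ hX
    intro x hx
    rw [HardyZ_eq]
    have hx' := abs_le.mp hx
    set z := riemannZeta (1/2 + Complex.I * (T0 + x : ℝ)) with hz
    have e : ee (RSTheta (T0 + x)) * z - ee (RSTheta T0) * ee (L * x + q * x^2/2) * D x =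
      (ee (RSTheta (T0 + x)) - ee (RSTheta T0) * ee (L * x + q * x^2/2)) * z + ee (RSTheta T0) * ee (L * x + q * x^2/2) * (z - D x) := by ring
    rw [e]
    refine (norm_add_le _ _).trans (add_le_add ?_ ?_)
    · rw [norm_mul]
      have h1 := hth x (hx.trans hX2)
      have h2 := zeta_bound (T0 + x) (by linarith)
      rw [hE1]
      gcongr
      · refine h1.trans ?_
        gcongr
      · refine h2.trans ?_
        gcongr
        linarith
    · rw [norm_mul, norm_mul, ee_norm, ee_norm, one_mul, one_mul]
      exact zeta_dir N hN T0 X (by linarith) hX2 x hx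
  have hB : ‖∫ x in (-X)..X, (gw V x : ℂ) * (ee (RSTheta T0) * ee (L * x + q * x^2/2) * D x)‖ ≤
      2 * V * ((3 * ρ * Real.exp L + 1) * (2 * Real.exp (-(L/2))) +
        N * (2 * Real.sqrt N) * (Real.exp (-(ρ^2 * V^2 / 8)) + 2 * Real.exp (-(X^2 / (2 * V^2))))) := by
    rw [hmain, norm_mul, ee_norm, one_mul]
    refine (norm_sum_le _ _).trans (le_trans (Finset.sum_le_sum (fun m _ => ?_)) (dco_sum N T0 V X L (q/2) ρ hN (by linarith) hV hX hρ0 hρ (by linarith) ?_))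
    · rw [norm_mul, norm_mul, ee_norm, mul_one]
    · refine le_trans ?_ hq
      refine mul_le_mul_of_nonneg_right ?_ (by positivity)
      rw [← sq_abs]
      refine pow_le_pow_left₀ (abs_nonneg _) ?_ 2
      rw [abs_div, abs_of_pos (by norm_num : (0:ℝ) < 2), div_le_iff₀ (by norm_num)]
      refine hqq.trans (le_of_eq ?_); ring
  have hJ := J0_le V X hV hX
  have hE1n : 0 ≤ E1 := by positivity
  have hE2n : 0 ≤ E2 := by positivity
  have hsT : Real.sqrt T0 = Real.exp (1/2 * Real.log T0) := by
    rw [Real.sqrt_eq_rpow, Real.rpow_def_of_pos hT0, mul_comm]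
  have hsT2 : 1 / Real.sqrt (Real.sqrt T0) = Real.exp (-(1/4 * Real.log T0)) := by
    rw [hsT, Real.sqrt_eq_rpow, ← Real.exp_mul, Real.exp_neg, one_div]; congr 2; ring
  have hl1 : Real.exp L ≤ Real.exp 200 * Real.sqrt T0 := by
    rw [hsT, ← Real.exp_add]; gcongr; linarith
  have hl2 : Real.exp (-(L/2)) ≤ Real.exp 100 * (1 / Real.sqrt (Real.sqrt T0)) := by
    rw [hsT2, ← Real.exp_add]; gcongr; linarith
  calc _ ≤ (E1 + E2) * J0 V X + 2 * V * ((3 * ρ * Real.exp L + 1) * (2 * Real.exp (-(L/2))) +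
        N * (2 * Real.sqrt N) * (Real.exp (-(ρ^2 * V^2 / 8)) + 2 * Real.exp (-(X^2 / (2 * V^2))))) :=
        (norm_add_le _ _).trans (add_le_add hA hB)
    _ ≤ (E1 + E2) * (2 * V) + 2 * V * ((3 * ρ * (Real.exp 200 * Real.sqrt T0) + 1) * (2 * (Real.exp 100 * (1 / Real.sqrt (Real.sqrt T0)))) +
        N * (2 * Real.sqrt N) * (Real.exp (-(ρ^2 * V^2 / 8)) + 2 * Real.exp (-(X^2 / (2 * V^2))))) := by
        gcongr
    _ = _ := by ring


lemma ev_pow (C a b : ℝ) (h : a < b) : ∀ᶠ T : ℝ in atTop, C * T ^ a ≤ T ^ b := by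
  have h1 := tendsto_rpow_atTop (show 0 < b - a by linarith)
  filter_upwards [h1.eventually_ge_atTop C, eventually_gt_atTop 0] with T hT h0
  calc C * T ^ a ≤ T ^ (b - a) * T ^ a := by gcongr
    _ = T ^ b := by rw [← Real.rpow_add h0]; congr 1; ring

lemma ev_exp (C a b c d : ℝ) (hc : 0 < c) (hd : 0 < d) :
    ∀ᶠ T : ℝ in atTop, C * T ^ a * Real.exp (-(c * T ^ d)) ≤ T ^ b := by
  have h1 := (isLittleO_exp_neg_mul_rpow_atTop (a := c) hc ((b - a - 1) / d)).bound (show (0:ℝ) < 1 by norm_num)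
  have h2 := (tendsto_rpow_atTop hd).eventually h1
  filter_upwards [h2, ev_pow C (b - 1) b (by linarith), eventually_gt_atTop 0, ev_pow |C| (b-1) b (by linarith)] with T hT hp h0 hp2
  rw [Real.norm_of_nonneg (Real.exp_pos _).le, Real.norm_of_nonneg (by positivity), one_mul, ← Real.rpow_mul h0.le,
    mul_div_cancel₀ _ hd.ne'] at hT
  have hT' : Real.exp (-(c * T ^ d)) ≤ T ^ (b - a - 1) := by rw [← neg_mul]; exact hT
  calc C * T ^ a * Real.exp (-(c * T ^ d)) ≤ |C| * T ^ a * Real.exp (-(c * T ^ d)) := by gcongr; exact le_abs_self C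
    _ ≤ |C| * T ^ a * T ^ (b - a - 1) := by gcongr
    _ = |C| * T ^ (b - 1) := by rw [mul_assoc, ← Real.rpow_add h0]; congr 2; ring
    _ ≤ _ := hp2

lemma rpow_pow' (T a : ℝ) (n : ℕ) (h : 0 < T) : (T ^ a) ^ n = T ^ (a * n) := by
  rw [Real.rpow_mul h.le, Real.rpow_natCast]

lemma ceil_bd (T : ℝ) (h : 1 ≤ T) : 1 ≤ ⌈T ^ (5/2:ℝ)⌉₊ ∧ T ^ (5/2:ℝ) ≤ (⌈T ^ (5/2:ℝ)⌉₊ : ℝ) ∧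
    (⌈T ^ (5/2:ℝ)⌉₊ : ℝ) ≤ 2 * T ^ (5/2:ℝ) ∧ T ^ (5/4:ℝ) ≤ Real.sqrt ⌈T ^ (5/2:ℝ)⌉₊ ∧
    Real.sqrt ⌈T ^ (5/2:ℝ)⌉₊ ≤ 2 * T ^ (5/4:ℝ) := by
  have h0 : 0 < T := by linarith
  have h1 : 1 ≤ T ^ (5/2:ℝ) := Real.one_le_rpow h (by norm_num)
  have h2 := Nat.le_ceil (T ^ (5/2:ℝ))
  have h3 := (Nat.ceil_lt_add_one (a := T ^ (5/2:ℝ)) (by linarith)).le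
  have e : (T ^ (5/4:ℝ))^2 = T ^ (5/2:ℝ) := by rw [rpow_pow' T _ _ h0]; norm_num
  refine ⟨?_, h2, by linarith, ?_, ?_⟩
  · rw [Nat.one_le_ceil_iff]; linarith
  · apply Real.le_sqrt_of_sq_le; rw [e]; exact h2
  · apply Real.sqrt_le_iff.mpr
    refine ⟨by positivity, ?_⟩
    rw [mul_pow, e]; linarith

lemma small_asym : ∀ᶠ T : ℝ in atTop, ∀ T0 : ℝ, T ≤ T0 → T0 ≤ 2 * T →
    ‖∫ x in (-(T ^ (0.42:ℝ)))..(T ^ (0.42:ℝ)), (gw (T ^ (0.4:ℝ)) x : ℂ) * (HardyZ (T0 + x) : ℂ)‖ ≤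
      T ^ (0.4:ℝ) * T ^ (-0.1:ℝ) := by
  have hlog := Real.tendsto_log_atTop.eventually_ge_atTop 300
  filter_upwards [hlog, eventually_ge_atTop 10, ev_pow 2 0.42 1 (by norm_num), ev_pow 49 (-0.4) 0 (by norm_num),
    ev_pow (10*168*40) (-0.24) (-0.1) (by norm_num), ev_pow 300 (-0.25) (-0.1) (by norm_num),
    ev_pow 40 (-0.33) (-0.1) (by norm_num),
    ev_pow (10 * ((6 * Real.exp 200 + 1) * (2 * Real.exp 100))) (-0.13) (-0.1) (by norm_num),
    ev_exp 240 3.75 (-0.1) (1/8) 0.04 (by norm_num) (by norm_num)] with T hlT hT hX hV h1 h2 h3 h4 h5 T0 hT0 hT02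
  have h0 : 0 < T := by linarith
  have h00 : 0 < T0 := by linarith
  have hT1 : 1 ≤ T := by linarith
  obtain ⟨n1, n2, n3, n4, n5⟩ := ceil_bd T hT1
  set N := ⌈T ^ (5/2:ℝ)⌉₊ with hN
  rw [Real.rpow_one] at hX
  rw [Real.rpow_zero] at hV
  have hρ1 : T ^ (-0.38:ℝ) ≤ 1 := Real.rpow_le_one_of_one_le_of_nonpos hT1 (by norm_num)
  have core := small_core T0 (T ^ (0.4:ℝ)) (T ^ (0.42:ℝ)) (T ^ (-0.38:ℝ)) N n1 (by linarith) (by positivity) (by positivity)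
    (by linarith) (by positivity) hρ1 (by
      have a1 : Real.log T0 ≤ Real.log 2 + Real.log T := by
        rw [← Real.log_mul (by norm_num) h0.ne']; exact Real.log_le_log h00 hT02
      have a2 : (5/2) * Real.log T ≤ Real.log N := by
        rw [← Real.log_rpow h0]; exact Real.log_le_log (by positivity) n2
      have a3 := Real.log_two_lt_d9
      linarith) (by
      rw [rpow_pow' _ _ _ h0]
      calc (7/T0)^2 * T ^ ((0.4:ℝ) * (4:ℕ)) ≤ (7/T)^2 * T ^ ((0.4:ℝ) * (4:ℕ)) := by gcongr
        _ = 49 * T ^ (-0.4:ℝ) := by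
          rw [div_pow, ← Real.rpow_natCast T 2, show (7:ℝ)^2 = 49 by norm_num, div_mul_eq_mul_div, mul_div_assoc, ← Real.rpow_sub h0]
          norm_num
        _ ≤ 1 := hV)
  refine core.trans ?_
  have sT : Real.sqrt T = T ^ (1/2:ℝ) := Real.sqrt_eq_rpow T
  have s1 : Real.sqrt (2 * T0) ≤ 2 * T ^ (1/2:ℝ) := by
    rw [← sT]; apply Real.sqrt_le_iff.mpr
    refine ⟨by positivity, ?_⟩
    rw [mul_pow, Real.sq_sqrt h0.le]; linarith
  have s2 : Real.sqrt T0 ≤ 2 * T ^ (1/2:ℝ) := (Real.sqrt_le_sqrt (by linarith)).trans s1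
  have s3 : 1 / Real.sqrt (Real.sqrt T0) ≤ T ^ (-0.25:ℝ) := by
    have : Real.sqrt (Real.sqrt T) = T ^ (1/4:ℝ) := by
      rw [sT, Real.sqrt_eq_rpow, ← Real.rpow_mul h0.le]; norm_num
    calc 1 / Real.sqrt (Real.sqrt T0) ≤ 1 / Real.sqrt (Real.sqrt T) := by gcongr
      _ = T ^ (-0.25:ℝ) := by rw [this, one_div, ← Real.rpow_neg h0.le]; norm_num
  have t1 : 168 * (T ^ (0.42:ℝ))^3 / T0^2 * (20 * Real.sqrt (2 * T0)) ≤ T ^ (-0.1:ℝ) / 10 := by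
    calc _ ≤ 168 * (T ^ (0.42:ℝ))^3 / T^2 * (20 * (2 * T ^ (1/2:ℝ))) := by gcongr
      _ = 168 * 40 * T ^ (-0.24:ℝ) := by
        rw [rpow_pow' _ _ _ h0, ← Real.rpow_natCast T 2, mul_div_assoc, ← Real.rpow_sub h0]
        rw [show (-0.24:ℝ) = (0.42 * (3:ℕ) - (2:ℕ)) + 1/2 by norm_num, Real.rpow_add h0]; ring
      _ ≤ _ := by linarith
  have t2 : 6 * (1 + 2 * T0) / Real.sqrt N ≤ T ^ (-0.1:ℝ) / 10 := by
    calc _ ≤ 6 * (5 * T) / T ^ (5/4:ℝ) := by gcongr; linarith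
      _ = 30 * T ^ (-0.25:ℝ) := by
        rw [show (-0.25:ℝ) = 1 - 5/4 by norm_num, Real.rpow_sub h0, Real.rpow_one]; ring
      _ ≤ _ := by linarith
  have t3 : 2 * Real.sqrt N * T ^ (0.42:ℝ) / T0 ^ 2 ≤ T ^ (-0.1:ℝ) / 10 := by
    calc _ ≤ 2 * (2 * T ^ (5/4:ℝ)) * T ^ (0.42:ℝ) / T ^ 2 := by gcongr
      _ = 4 * T ^ (-0.33:ℝ) := by
        rw [show (-0.33:ℝ) = 5/4 + 0.42 - (2:ℕ) by norm_num, Real.rpow_sub h0, Real.rpow_add h0, Real.rpow_natCast]; ring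
      _ ≤ _ := by linarith
  have t4 : (3 * T ^ (-0.38:ℝ) * (Real.exp 200 * Real.sqrt T0) + 1) * (2 * (Real.exp 100 * (1 / Real.sqrt (Real.sqrt T0)))) ≤ T ^ (-0.1:ℝ) / 10 := by
    have u1 : 1 ≤ T ^ (0.12:ℝ) := Real.one_le_rpow hT1 (by norm_num)
    calc _ ≤ (3 * T ^ (-0.38:ℝ) * (Real.exp 200 * (2 * T ^ (1/2:ℝ))) + T ^ (0.12:ℝ)) * (2 * (Real.exp 100 * T ^ (-0.25:ℝ))) := by gcongr
      _ = (6 * Real.exp 200 + 1) * (2 * Real.exp 100) * T ^ (-0.13:ℝ) := by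
        rw [show (-0.13:ℝ) = 0.12 + -0.25 by norm_num, Real.rpow_add h0, show (0.12:ℝ) = -0.38 + 1/2 by norm_num, Real.rpow_add h0]; ring
      _ ≤ _ := by linarith
  have t5 : N * (2 * Real.sqrt N) * (Real.exp (-((T ^ (-0.38:ℝ))^2 * (T ^ (0.4:ℝ))^2 / 8)) + 2 * Real.exp (-((T ^ (0.42:ℝ))^2 / (2 * (T ^ (0.4:ℝ))^2)))) ≤ T ^ (-0.1:ℝ) / 10 := by
    have e1 : (T ^ (-0.38:ℝ))^2 * (T ^ (0.4:ℝ))^2 / 8 = 1/8 * T ^ (0.04:ℝ) := by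
      rw [← mul_pow, ← Real.rpow_add h0, rpow_pow' _ _ _ h0]; norm_num; ring
    have e2 : (T ^ (0.42:ℝ))^2 / (2 * (T ^ (0.4:ℝ))^2) = 1/2 * T ^ (0.04:ℝ) := by
      rw [rpow_pow' _ _ _ h0, rpow_pow' _ _ _ h0, show (0.04:ℝ) = 0.42 * (2:ℕ) - 0.4 * (2:ℕ) by norm_num, Real.rpow_sub h0]; ring
    rw [e1, e2]
    have u1 : 0 < T ^ (0.04:ℝ) := by positivity
    have u2 : Real.exp (-(1/2 * T ^ (0.04:ℝ))) ≤ Real.exp (-(1/8 * T ^ (0.04:ℝ))) := by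
      apply Real.exp_le_exp.mpr; linarith
    calc _ ≤ (2 * T ^ (5/2:ℝ)) * (2 * (2 * T ^ (5/4:ℝ))) * (Real.exp (-(1/8 * T ^ (0.04:ℝ))) + 2 * Real.exp (-(1/8 * T ^ (0.04:ℝ)))) := by gcongr
      _ = 24 * T ^ (3.75:ℝ) * Real.exp (-(1/8 * T ^ (0.04:ℝ))) := by
        rw [show (3.75:ℝ) = 5/2 + 5/4 by norm_num, Real.rpow_add h0]; ring
      _ ≤ _ := by linarith
  have u : 0 < T ^ (-0.1:ℝ) := by positivity
  have hVp : 0 < T ^ (0.4:ℝ) := by positivity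
  calc _ ≤ 2 * T ^ (0.4:ℝ) * (T ^ (-0.1:ℝ) / 2) := by
        apply mul_le_mul_of_nonneg_left _ (by positivity)
        linarith
    _ = _ := by ring

lemma small_final : ∀ᶠ T : ℝ in atTop, ∀ h : ℝ, 0 < h → h ≤ T ^ (0.01:ℝ) → ∀ s : ℝ, |s| = 1 →
    ¬ (∀ η ∈ Set.Ioo T (T + T ^ (0.5001:ℝ)), Real.sqrt (2 * Real.pi * h) ≤ s * ∫ u in η..(η + h), HardyZ u) := by
  filter_upwards [small_asym, eventually_ge_atTop 1, ev_pow 4 0.42 0.5001 (by norm_num), ev_pow 2 0.5001 1 (by norm_num),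
    ev_pow 4 0.01 1 (by norm_num), ev_pow 4 (-0.095) 0 (by norm_num)] with T hsm hT h1 h2 h3 h4 h h0 hh s hs hall
  have hT0 : 0 < T := lt_of_lt_of_le one_pos hT
  rw [Real.rpow_one] at h2 h3
  rw [Real.rpow_zero] at h4
  set V := T ^ (0.4:ℝ) with hV
  set X := T ^ (0.42:ℝ) with hX
  have hVp : 0 < V := by positivity
  have hXp : 0 < X := by positivity
  have hVX : V ≤ X := Real.rpow_le_rpow_of_exponent_le hT (by norm_num)
  set T0 := T + T ^ (0.5001:ℝ) / 2 with hT0d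
  have hZc := HardyZ_cont
  -- Fubini
  have fub : ∫ x in (-X)..X, gw V x * (∫ v in (0:ℝ)..h, HardyZ (T0 + v + x)) =
      ∫ v in (0:ℝ)..h, ∫ x in (-X)..X, gw V x * HardyZ (T0 + v + x) := by
    have hc : Continuous (Function.uncurry (fun x v => gw V x * HardyZ (T0 + v + x))) := by
      simp only [Function.uncurry_def]; fun_prop
    have hIItg : MeasureTheory.IntegrableOn (Function.uncurry (fun x v => gw V x * HardyZ (T0 + v + x)))
        (Set.uIoc (-X) X ×ˢ Set.uIoc 0 h) := by
      have h5 : MeasureTheory.IntegrableOn (Function.uncurry (fun x v => gw V x * HardyZ (T0 + v + x)))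
        (Set.uIcc (-X) X ×ˢ Set.uIcc 0 h) := hc.continuousOn.integrableOn_compact (isCompact_uIcc.prod isCompact_uIcc)
      exact h5.mono_set (Set.prod_mono Set.uIoc_subset_uIcc Set.uIoc_subset_uIcc)
    have := MeasureTheory.intervalIntegral_intervalIntegral_swap hIItg
    rw [← this]
    congr 1; ext x; rw [intervalIntegral.integral_const_mul]
  have shift : ∀ x, ∫ v in (0:ℝ)..h, HardyZ (T0 + v + x) = ∫ u in (T0 + x)..(T0 + x + h), HardyZ u := by
    intro x
    have := intervalIntegral.integral_comp_add_left (f := HardyZ) (a := 0) (b := h) (T0 + x)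
    rw [add_zero] at this
    rw [← this]
    congr 1; ext v; congr 1; ring
  have upper : ‖∫ v in (0:ℝ)..h, ∫ x in (-X)..X, gw V x * HardyZ (T0 + v + x)‖ ≤ V * T ^ (-0.1:ℝ) * |h - 0| := by
    apply intervalIntegral.norm_integral_le_of_norm_le_const
    intro v hv
    rw [Set.uIoc_of_le h0.le] at hv
    have := hsm (T0 + v) (by have := hv.1; have : 0 < T ^ (0.5001:ℝ) := by positivity
                             linarith) (by linarith [hv.2])
    have e : (∫ x in (-X)..X, (gw V x : ℂ) * (HardyZ (T0 + v + x) : ℂ)) = ((∫ x in (-X)..X, gw V x * HardyZ (T0 + v + x) : ℝ) : ℂ) := by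
      rw [← intervalIntegral.integral_ofReal]; congr 1; ext x; push_cast; rfl
    rw [e, Complex.norm_real] at this
    exact this
  have hIc : Continuous (fun x => ∫ v in (0:ℝ)..h, HardyZ (T0 + v + x)) := by
    apply intervalIntegral.continuous_parametric_intervalIntegral_of_continuous' 
    simp only [Function.uncurry_def]; fun_prop
  have lower : Real.sqrt (2 * Real.pi * h) * J0 V X ≤ s * ∫ x in (-X)..X, gw V x * (∫ v in (0:ℝ)..h, HardyZ (T0 + v + x)) := by
    unfold J0
    rw [← intervalIntegral.integral_const_mul, ← intervalIntegral.integral_const_mul]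
    apply intervalIntegral.integral_mono_on (by linarith)
    · apply Continuous.intervalIntegrable; fun_prop
    · apply Continuous.intervalIntegrable; fun_prop
    · intro x hx
      have hm := hall (T0 + x) ⟨by linarith [hx.1], by linarith [hx.2]⟩
      rw [shift]
      have := mul_le_mul_of_nonneg_left hm (gw_pos V x).le
      linarith
  have hJ := le_J0 V X hVp hVX
  rw [fub] at lower
  rw [sub_zero, abs_of_pos h0, Real.norm_eq_abs] at upper
  set I := ∫ v in (0:ℝ)..h, ∫ x in (-X)..X, gw V x * HardyZ (T0 + v + x)
  have hsI : s * I ≤ |I| := by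
    calc s * I ≤ |s * I| := le_abs_self _
      _ = |I| := by rw [abs_mul, hs, one_mul]
  have hr : Real.sqrt h ≤ Real.sqrt (2 * Real.pi * h) := by
    apply Real.sqrt_le_sqrt; nlinarith [Real.pi_gt_three]
  have hsq : Real.sqrt h * Real.sqrt h = h := Real.mul_self_sqrt h0.le
  have hsp : 0 < Real.sqrt h := Real.sqrt_pos.mpr h0
  have hs2 : Real.sqrt h ≤ T ^ (0.005:ℝ) := by
    apply Real.sqrt_le_iff.mpr
    refine ⟨by positivity, ?_⟩
    rw [rpow_pow' _ _ _ hT0]; convert hh using 2; norm_num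
  have c1 : Real.sqrt h * (V / 2) ≤ V * T ^ (-0.1:ℝ) * h := by
    calc _ ≤ Real.sqrt (2 * Real.pi * h) * J0 V X := by gcongr
      _ ≤ _ := by linarith
  have c2 : T ^ (-0.1:ℝ) * Real.sqrt h ≤ 1 / 4 := by
    calc _ ≤ T ^ (-0.1:ℝ) * T ^ (0.005:ℝ) := by gcongr
      _ = T ^ (-0.095:ℝ) := by rw [← Real.rpow_add hT0]; norm_num
      _ ≤ _ := by linarith
  have c3 : V * T ^ (-0.1:ℝ) * h ≤ Real.sqrt h * (V / 4) := by
    calc V * T ^ (-0.1:ℝ) * h = V * Real.sqrt h * (T ^ (-0.1:ℝ) * Real.sqrt h) := by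
          rw [mul_assoc, mul_assoc]; congr 1; rw [mul_left_comm, hsq]
      _ ≤ V * Real.sqrt h * (1/4) := by gcongr
      _ = _ := by ring
  nlinarith [mul_pos hVp hsp]

open scoped ComplexConjugate

lemma bilin_sum (V X ξ q : ℝ) (s t : Finset ℕ) (α β : ℕ → ℂ) (f g : ℕ → ℝ) :
    ∫ x in (-X)..X, (gw V x : ℂ) * (ee (ξ * x + q * x^2) * (∑ m ∈ s, α m * ee (-(x * f m))) * (∑ n ∈ t, β n * ee (-(x * g n)))) =
      ∑ m ∈ s, ∑ n ∈ t, α m * β n * JJ V X (ξ - f m - g n) q := by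
  have e : ∀ x : ℝ, (gw V x : ℂ) * (ee (ξ * x + q * x^2) * (∑ m ∈ s, α m * ee (-(x * f m))) * (∑ n ∈ t, β n * ee (-(x * g n)))) =
      ∑ m ∈ s, ∑ n ∈ t, α m * β n * ((gw V x : ℂ) * ee ((ξ - f m - g n) * x + q * x^2)) := by
    intro x
    rw [mul_assoc, Finset.sum_mul_sum, Finset.mul_sum, Finset.mul_sum]
    apply Finset.sum_congr rfl
    intro m _
    rw [Finset.mul_sum, Finset.mul_sum]
    apply Finset.sum_congr rfl
    intro n _
    have h : ee ((ξ - f m - g n) * x + q * x^2) = ee (ξ * x + q * x^2) * ee (-(x * f m)) * ee (-(x * g n)) := by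
      rw [← ee_add, ← ee_add]; congr 1; ring
    rw [h]; ring
  simp_rw [e]
  rw [intervalIntegral.integral_finsetSum (fun m _ => by apply Continuous.intervalIntegrable; fun_prop)]
  apply Finset.sum_congr rfl
  intro m _
  rw [intervalIntegral.integral_finsetSum (fun m _ => by apply Continuous.intervalIntegrable; fun_prop)]
  apply Finset.sum_congr rfl
  intro n _
  rw [intervalIntegral.integral_const_mul]; rfl

lemma log_sep (L : ℝ) (m n : ℕ) (hm : 1 ≤ m) (hn : 1 ≤ n) (hne : m ≠ n) (hL : (n:ℝ) ≤ Real.exp L) :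
    Real.exp (-L) / 2 ≤ |Real.log n - Real.log m| := by
  have hm0 : (0:ℝ) < m := by exact_mod_cast hm
  have hn0 : (0:ℝ) < n := by exact_mod_cast hn
  have hn1 : (1:ℝ) ≤ n := by exact_mod_cast hn
  have h1 : Real.exp (-L) ≤ 1 / n := by
    rw [Real.exp_neg, ← one_div]; gcongr
  have key : 1 / (2 * (n:ℝ)) ≤ |Real.log n - Real.log m| := by
    rcases lt_or_gt_of_ne hne with h | h
    · refine le_trans ?_ (le_abs_self _)
      rw [← Real.log_div hn0.ne' hm0.ne']
      have h2 := Real.one_sub_inv_le_log_of_pos (show 0 < (n:ℝ)/m by positivity)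
      refine le_trans ?_ h2
      rw [inv_div, div_le_iff₀ (by positivity)]
      have : (m:ℝ) + 1 ≤ n := by exact_mod_cast h
      have e : (1 - (m:ℝ)/n) * (2 * n) = 2 * (n - m) := by field_simp
      rw [e]; linarith
    · rw [abs_sub_comm]
      refine le_trans ?_ (le_abs_self _)
      rw [← Real.log_div hm0.ne' hn0.ne']
      have h2 := Real.one_sub_inv_le_log_of_pos (show 0 < (m:ℝ)/n by positivity)
      refine le_trans ?_ h2
      have h3 : (n:ℝ) + 1 ≤ m := by exact_mod_cast h
      rw [inv_div, le_sub_iff_add_le, div_add_div _ _ (by positivity) hm0.ne', div_le_one (by positivity)]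
      nlinarith
  have : 1 / (2 * (n:ℝ)) = 1 / n / 2 := by field_simp
  linarith

lemma diag_bilin (V X K L ε a b : ℝ) (hX : 0 ≤ X) (hKn : 0 ≤ K) (ha : 0 ≤ a) (s t : Finset ℕ) (hts : t ⊆ s)
    (hs : ∀ m ∈ s, 1 ≤ m) (ht : ∀ n ∈ t, (n:ℝ) ≤ Real.exp L) (hε : |ε| ≤ Real.exp (-L) / 4)
    (hK : ∀ ξ, Real.exp (-L) / 4 ≤ |ξ| → ‖JJ V X ξ 0‖ ≤ K)
    (α β : ℕ → ℂ) (γ : ℕ → ℝ) (hα : ∀ m ∈ s, ‖α m‖ ≤ a) (hβ : ∀ n ∈ t, ‖β n‖ ≤ b) (hγ : ∀ n ∈ t, ‖α n * β n‖ ≤ γ n) :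
    ‖(∫ x in (-X)..X, (gw V x : ℂ) * (ee (ε * x + 0 * x^2) * (∑ m ∈ s, α m * ee (-(x * Real.log m))) * (∑ n ∈ t, β n * ee (-(x * (-Real.log n))))))
      - (∑ n ∈ t, α n * β n) * (J0 V X : ℂ)‖ ≤ s.card * t.card * (a * b * K) + (∑ n ∈ t, γ n) * (|ε| * X * J0 V X) := by
  rw [bilin_sum, Finset.sum_comm]
  have hJ := J0_nonneg V X hX
  have e : ∀ n ∈ t, ∑ m ∈ s, α m * β n * JJ V X (ε - Real.log m - -Real.log n) 0 =
      α n * β n * JJ V X ε 0 + ∑ m ∈ s.erase n, α m * β n * JJ V X (ε - Real.log m - -Real.log n) 0 := by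
    intro n hn
    rw [← Finset.add_sum_erase s _ (hts hn)]
    congr 3; ring
  rw [Finset.sum_congr rfl e, Finset.sum_add_distrib, add_sub_right_comm, Finset.sum_mul, ← Finset.sum_sub_distrib, add_comm]
  refine (norm_add_le _ _).trans (add_le_add ?_ ?_)
  · calc _ ≤ ∑ n ∈ t, ∑ m ∈ s.erase n, (a * b * K) := by
          refine (norm_sum_le _ _).trans (Finset.sum_le_sum (fun n hn => (norm_sum_le _ _).trans (Finset.sum_le_sum (fun m hm => ?_))))
          rw [Finset.mem_erase] at hm
          rw [norm_mul, norm_mul]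
          have h1 := hα m hm.2
          have h2 := hβ n hn
          have h3 : ‖JJ V X (ε - Real.log m - -Real.log n) 0‖ ≤ K := by
            apply hK
            have h4 := log_sep L m n (hs m hm.2) (hs n (hts hn)) hm.1 (ht n hn)
            have h5 : |Real.log n - Real.log m| ≤ |ε - Real.log m - -Real.log n| + |ε| := by
              calc |Real.log n - Real.log m| = |(ε - Real.log m - -Real.log n) - ε| := by congr 1; ring
                _ ≤ _ := abs_sub _ _
            linarith
          have hb : 0 ≤ b := (norm_nonneg _).trans h2
          gcongr
      _ ≤ ∑ n ∈ t, (s.card * (a * b * K)) := by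
          apply Finset.sum_le_sum
          intro n hn
          have hb : 0 ≤ b := (norm_nonneg _).trans (hβ n hn)
          rw [Finset.sum_const, nsmul_eq_mul]
          gcongr
          exact Finset.erase_subset _ _
      _ = _ := by rw [Finset.sum_const, nsmul_eq_mul]; ring
  · rw [Finset.sum_mul]
    refine (norm_sum_le _ _).trans (Finset.sum_le_sum (fun n hn => ?_))
    rw [← mul_sub, norm_mul]
    exact mul_le_mul (hγ n hn) (JJ_diff V X ε hX) (norm_nonneg _) ((norm_nonneg _).trans (hγ n hn))

/-- Coefficients of the approximating polynomial. -/
noncomputable def bb (L T0 h : ℝ) (n : ℕ) : ℂ := ((1 / Real.sqrt n : ℝ) : ℂ) * ee (-(T0 * Real.log n)) * cc h (L - Real.log n)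

/-- The approximating polynomial. -/
noncomputable def AA (L T0 h x : ℝ) : ℂ := ∑ n ∈ NN L, bb L T0 h n * ee (-(x * Real.log n))

@[fun_prop]
lemma AA_cont (L T0 h : ℝ) : Continuous (AA L T0 h) := by unfold AA; fun_prop

lemma bb_norm (L T0 h : ℝ) (hh : 0 ≤ h) (n : ℕ) : ‖bb L T0 h n‖ ≤ 1 / Real.sqrt n * h := by
  unfold bb
  rw [norm_mul, norm_mul, ee_norm, mul_one, Complex.norm_real, Real.norm_of_nonneg (by positivity)]
  gcongr
  exact cc_norm_le h _ hh

lemma inv_sqrt_le (n : ℕ) (hn : 1 ≤ n) : 1 / Real.sqrt n ≤ 1 := by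
  have : 1 ≤ Real.sqrt n := by rw [Real.one_le_sqrt]; exact_mod_cast hn
  rw [div_le_one (by linarith)]; exact this

lemma bb_le (L T0 h : ℝ) (hh : 0 ≤ h) (n : ℕ) (hn : 1 ≤ n) : ‖bb L T0 h n‖ ≤ h := by
  refine (bb_norm L T0 h hh n).trans ?_
  have := inv_sqrt_le n hn
  nlinarith

lemma AA_conj (L T0 h x : ℝ) : conj (AA L T0 h x) = ∑ n ∈ NN L, conj (bb L T0 h n) * ee (-(x * (-Real.log n))) := by
  unfold AA
  rw [map_sum]
  apply Finset.sum_congr rfl; intro n _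
  rw [map_mul, ee_conj]; congr 2; ring

lemma bb_sq (L T0 h : ℝ) : ∑ n ∈ NN L, bb L T0 h n * conj (bb L T0 h n) = ((SS L h : ℝ) : ℂ) := by
  unfold SS
  push_cast
  apply Finset.sum_congr rfl; intro n _
  rw [Complex.mul_conj, Complex.normSq_eq_norm_sq]
  unfold bb
  rw [norm_mul, norm_mul, ee_norm, mul_one, Complex.norm_real, Real.norm_of_nonneg (by positivity), mul_pow, div_pow,
    Real.sq_sqrt (by positivity)]
  push_cast; ring

lemma AA_sq (V X K L T0 h : ℝ) (hX : 0 ≤ X) (hKn : 0 ≤ K) (hh : 0 ≤ h)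
    (hK : ∀ ξ, Real.exp (-L) / 4 ≤ |ξ| → ‖JJ V X ξ 0‖ ≤ K) :
    ∫ x in (-X)..X, gw V x * ‖AA L T0 h x‖^2 ≤ SS L h * J0 V X + (Real.exp L)^2 * (h^2 * K) := by
  have h1 := diag_bilin V X K L 0 h h hX hKn hh (NN L) (NN L) (subset_refl _) (fun m hm => (NN_mem L m hm).1)
    (fun m hm => (NN_mem L m hm).2.2.2) (by rw [abs_zero]; positivity) hK (bb L T0 h) (fun n => conj (bb L T0 h n))
    (fun n => ‖bb L T0 h n * conj (bb L T0 h n)‖) (fun m hm => bb_le L T0 h hh m (NN_mem L m hm).1)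
    (fun m hm => by rw [RCLike.norm_conj]; exact bb_le L T0 h hh m (NN_mem L m hm).1) (fun _ _ => le_rfl)
  rw [bb_sq] at h1
  have e : (∫ x in (-X)..X, (gw V x : ℂ) * (ee (0 * x + 0 * x^2) * (∑ m ∈ NN L, bb L T0 h m * ee (-(x * Real.log m))) * (∑ n ∈ NN L, conj (bb L T0 h n) * ee (-(x * (-Real.log n)))))) =
      ((∫ x in (-X)..X, gw V x * ‖AA L T0 h x‖^2 : ℝ) : ℂ) := by
    rw [← intervalIntegral.integral_ofReal]
    congr 1; ext x
    rw [← AA_conj, zero_mul, zero_mul, zero_add, ee_zero, one_mul]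
    change (gw V x : ℂ) * (AA L T0 h x * _) = _
    rw [Complex.mul_conj, Complex.normSq_eq_norm_sq]; push_cast; ring
  rw [e, ← Complex.ofReal_mul, ← Complex.ofReal_sub, Complex.norm_real, abs_zero, zero_mul, zero_mul, mul_zero, add_zero, Real.norm_eq_abs] at h1
  have h2 := (abs_le.mp h1).2
  have h3 : (((NN L).card : ℝ) * (NN L).card) * (h * h * K) ≤ (Real.exp L)^2 * (h^2 * K) := by
    rw [sq, sq]
    have := NN_card L
    gcongr
  linarith

lemma AA_cross (V X K L T0 h q : ℝ) (hKn : 0 ≤ K) (hh : 0 ≤ h)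
    (hK : ∀ ξ, 2 * Real.exp (-L/4) ≤ ξ → ‖JJ V X ξ q‖ ≤ K) :
    ‖∫ x in (-X)..X, (gw V x : ℂ) * (ee (2 * L * x + q * x^2) * AA L T0 h x * AA L T0 h x)‖ ≤ (Real.exp L)^2 * (h^2 * K) := by
  unfold AA
  rw [bilin_sum]
  calc _ ≤ ∑ n ∈ NN L, ∑ m ∈ NN L, (h * h * K) := by
          refine (norm_sum_le _ _).trans (Finset.sum_le_sum (fun n hn => (norm_sum_le _ _).trans (Finset.sum_le_sum (fun m hm => ?_))))
          rw [norm_mul, norm_mul]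
          have h1 := bb_le L T0 h hh m (NN_mem L m hm).1
          have h2 := bb_le L T0 h hh n (NN_mem L n hn).1
          have h3 : ‖JJ V X (2 * L - Real.log n - Real.log m) q‖ ≤ K := by
            apply hK
            linarith [(NN_mem L m hm).2.2.1, (NN_mem L n hn).2.2.1]
          gcongr
    _ = ((NN L).card : ℝ) * (NN L).card * (h * h * K) := by rw [Finset.sum_const, Finset.sum_const, nsmul_eq_mul, nsmul_eq_mul]; ring
    _ ≤ _ := by
      rw [sq, sq]
      have := NN_card L
      gcongr

/-- The Dirichlet polynomial model of the short integral. -/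
noncomputable def PP (N : ℕ) (L q T0 h x : ℝ) : ℂ :=
  ∫ v in (0:ℝ)..h, ee (L * v + q * x * v) * ∑ m ∈ Finset.Icc 1 N, dco N T0 m * ee (-((T0 + (x + v)) * Real.log m))

@[fun_prop]
lemma PP_cont (N : ℕ) (L q T0 h : ℝ) : Continuous (PP N L q T0 h) := by
  unfold PP
  apply intervalIntegral.continuous_parametric_intervalIntegral_of_continuous'
  simp only [Function.uncurry_def]; fun_prop

lemma PP_AA (N : ℕ) (V X K L q T0 h : ℝ) (hN : 1 ≤ N) (hT : 1 ≤ T0) (hX : 0 ≤ X) (hKn : 0 ≤ K) (hh : 0 ≤ h)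
    (hNL : Real.exp L < N) (hq : |q| * h ≤ Real.exp (-L) / 4)
    (hK : ∀ ξ, Real.exp (-L) / 4 ≤ |ξ| → ‖JJ V X ξ 0‖ ≤ K) :
    ‖(∫ x in (-X)..X, (gw V x : ℂ) * (PP N L q T0 h x * conj (AA L T0 h x))) - ((SS L h * J0 V X : ℝ) : ℂ)‖ ≤
      (N * Real.exp L * (2 * Real.sqrt N * h * K) + Real.exp (L/8) * h * (|q| * h * X * J0 V X)) * h := by
  have hJ := J0_nonneg V X hX
  set G : ℝ → ℝ → ℂ := fun x v => (gw V x : ℂ) * (ee (L * v + q * x * v) * (∑ m ∈ Finset.Icc 1 N, dco N T0 m * ee (-((T0 + (x + v)) * Real.log m))) * conj (AA L T0 h x)) with hG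
  have hAc : Continuous (fun x => conj (AA L T0 h x)) := Complex.continuous_conj.comp (AA_cont L T0 h)
  have hc : Continuous (Function.uncurry G) := by
    simp only [Function.uncurry_def, hG]; fun_prop
  have hIItg : MeasureTheory.IntegrableOn (Function.uncurry G) (Set.uIoc (-X) X ×ˢ Set.uIoc 0 h) := by
    have h5 : MeasureTheory.IntegrableOn (Function.uncurry G)
        (Set.uIcc (-X) X ×ˢ Set.uIcc 0 h) := hc.continuousOn.integrableOn_compact (isCompact_uIcc.prod isCompact_uIcc)
    exact h5.mono_set (Set.prod_mono Set.uIoc_subset_uIcc Set.uIoc_subset_uIcc)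
  have fub := MeasureTheory.intervalIntegral_intervalIntegral_swap hIItg
  have e1 : (∫ x in (-X)..X, (gw V x : ℂ) * (PP N L q T0 h x * conj (AA L T0 h x))) = ∫ x in (-X)..X, ∫ v in (0:ℝ)..h, G x v := by
    congr 1; ext x
    simp only [hG]
    rw [intervalIntegral.integral_const_mul, intervalIntegral.integral_mul_const]; rfl
  set α : ℝ → ℕ → ℂ := fun v m => dco N T0 m * ee (L * v - (T0 + v) * Real.log m) with hα
  set β : ℕ → ℂ := fun n => conj (bb L T0 h n) with hβ
  have hNNsub : ∀ n ∈ NN L, n ∈ Finset.Icc 1 N ∧ n ≠ N := by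
    intro n hn
    have h1 := NN_mem L n hn
    have h2 : (n:ℝ) < N := h1.2.2.2.trans_lt hNL
    have h3 : n < N := by exact_mod_cast h2
    exact ⟨Finset.mem_Icc.mpr ⟨h1.1, h3.le⟩, h3.ne⟩
  have e2 : ∀ v, ∫ x in (-X)..X, G x v = ∫ x in (-X)..X, (gw V x : ℂ) * (ee ((q * v) * x + 0 * x^2) * (∑ m ∈ Finset.Icc 1 N, α v m * ee (-(x * Real.log m))) * (∑ n ∈ NN L, β n * ee (-(x * (-Real.log n))))) := by
    intro v
    congr 1; ext x
    simp only [hG, hβ]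
    rw [← AA_conj]
    congr 2
    rw [Finset.mul_sum, Finset.mul_sum]
    apply Finset.sum_congr rfl; intro m _
    simp only [hα]
    have : ee (L * v + q * x * v) * ee (-((T0 + (x + v)) * Real.log m)) = ee (q * v * x + 0 * x ^ 2) * ee (L * v - (T0 + v) * Real.log m) * ee (-(x * Real.log m)) := by
      rw [← ee_add, ← ee_add, ← ee_add]; congr 1; ring
    linear_combination (dco N T0 m) * this
  have bound : ∀ v ∈ Set.uIoc 0 h, ‖(∫ x in (-X)..X, G x v) - (∑ n ∈ NN L, α v n * β n) * (J0 V X : ℂ)‖ ≤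
      N * Real.exp L * (2 * Real.sqrt N * h * K) + Real.exp (L/8) * h * (|q| * h * X * J0 V X) := by
    intro v hv
    rw [Set.uIoc_of_le hh] at hv
    have hqv : |q * v| ≤ |q| * h := by
      rw [abs_mul, abs_of_pos hv.1]
      exact mul_le_mul_of_nonneg_left hv.2 (abs_nonneg _)
    rw [e2]
    refine (diag_bilin V X K L (q * v) (2 * Real.sqrt N) h hX hKn (by positivity) (Finset.Icc 1 N) (NN L) (fun n hn => (hNNsub n hn).1)
      (fun m hm => (Finset.mem_Icc.mp hm).1) (fun n hn => (NN_mem L n hn).2.2.2) (hqv.trans hq) hK (α v) β (fun n => h * (1 / (n:ℝ)))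
      ?_ ?_ ?_).trans ?_
    · intro m hm
      simp only [hα]
      rw [norm_mul, ee_norm, mul_one]
      exact dco_le N T0 hT m (Finset.mem_Icc.mp hm).1 hN
    · intro n hn
      simp only [hβ]
      rw [RCLike.norm_conj]; exact bb_le L T0 h hh n (NN_mem L n hn).1
    · intro n hn
      simp only [hα, hβ]
      rw [norm_mul, norm_mul, ee_norm, mul_one, RCLike.norm_conj, dco_eq N T0 n (hNNsub n hn).2, Complex.norm_real, Real.norm_of_nonneg (by positivity)]
      calc 1 / Real.sqrt n * ‖bb L T0 h n‖ ≤ 1 / Real.sqrt n * (1 / Real.sqrt n * h) := by gcongr; exact bb_norm L T0 h hh n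
        _ = h * (1 / (Real.sqrt n * Real.sqrt n)) := by ring
        _ = _ := by rw [Real.mul_self_sqrt (by positivity)]
    · rw [← Finset.mul_sum, Nat.card_Icc, Nat.add_sub_cancel, mul_comm h]
      have := NN_card L
      have := sum_inv_upper L
      gcongr
  have hαc : ∀ n, Continuous (fun v => α v n) := by intro n; simp only [hα]; fun_prop
  have e3 : ∫ v in (0:ℝ)..h, (∑ n ∈ NN L, α v n * β n) * (J0 V X : ℂ) = ((SS L h * J0 V X : ℝ) : ℂ) := by
    rw [intervalIntegral.integral_mul_const, intervalIntegral.integral_finsetSum (fun n _ => by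
      apply Continuous.intervalIntegrable; have := hαc n; fun_prop)]
    push_cast
    rw [← bb_sq L T0 h]
    congr 1
    apply Finset.sum_congr rfl; intro n hn
    rw [intervalIntegral.integral_mul_const]
    congr 1
    simp only [hα, bb, cc]
    rw [dco_eq N T0 n (hNNsub n hn).2, mul_assoc, ← intervalIntegral.integral_const_mul, ← intervalIntegral.integral_const_mul]
    apply intervalIntegral.integral_congr
    intro v _
    simp only
    rw [← ee_add]; congr 2; ring
  have hc2 : Continuous (fun v => ∫ x in (-X)..X, G x v) := by
    apply intervalIntegral.continuous_parametric_intervalIntegral_of_continuous'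
    exact hc.comp continuous_swap
  rw [e1, fub, ← e3, ← intervalIntegral.integral_sub (hc2.intervalIntegrable _ _) (by
    apply Continuous.intervalIntegrable; fun_prop)]
  refine (intervalIntegral.norm_integral_le_of_norm_le_const bound).trans ?_
  rw [sub_zero, abs_of_nonneg hh]

open scoped ComplexConjugate

lemma PP_approx (N : ℕ) (T0 X h L q : ℝ) (hN : 1 ≤ N) (hT : 10 ≤ T0) (hX : 0 ≤ X) (hh : 0 ≤ h) (hX4 : X ≤ T0 / 4) (hh4 : h ≤ T0 / 4)
    (hth : ∀ x v, |x| ≤ T0/4 → 0 ≤ v → v ≤ T0/4 → ‖ee (RSTheta (T0+x+v)) - ee (RSTheta (T0+x)) * ee (L*v + q*x*v)‖ ≤ 168*x^2*v/T0^2 + 28*v^2/T0)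
    (x : ℝ) (hx : |x| ≤ X) :
    ‖((∫ u in (T0 + x)..(T0 + x + h), HardyZ u : ℝ) : ℂ) - ee (RSTheta (T0 + x)) * PP N L q T0 h x‖ ≤
      ((168 * X^2 * h / T0^2 + 28 * h^2 / T0) * (20 * Real.sqrt (2 * T0)) +
        (6 * (1 + 2 * T0) / Real.sqrt N + 2 * Real.sqrt N * (X + h) / T0 ^ 2)) * h := by
  have hx' := abs_le.mp hx
  have hZc := HardyZ_cont
  have e1 : ((∫ u in (T0 + x)..(T0 + x + h), HardyZ u : ℝ) : ℂ) = ∫ v in (0:ℝ)..h, (HardyZ (T0 + x + v) : ℂ) := by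
    rw [intervalIntegral.integral_ofReal]
    have := intervalIntegral.integral_comp_add_left (f := HardyZ) (a := 0) (b := h) (T0 + x)
    rw [add_zero] at this
    rw [← this]
  unfold PP
  rw [e1, ← intervalIntegral.integral_const_mul, ← intervalIntegral.integral_sub (by apply Continuous.intervalIntegrable; fun_prop) (by apply Continuous.intervalIntegrable; fun_prop)]
  refine (intervalIntegral.norm_integral_le_of_norm_le_const ?_).trans (by rw [sub_zero, abs_of_nonneg hh])
  intro v hv
  rw [Set.uIoc_of_le hh] at hv
  have hv1 := hv.1
  have hv2 := hv.2
  rw [HardyZ_eq]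
  have hxv : |x + v| ≤ X + h := by
    rw [abs_le]; constructor <;> linarith
  have h1 := hth x v (hx.trans hX4) hv1.le (hv2.trans hh4)
  have h2 := zeta_bound (T0 + x + v) (by linarith)
  have h3 := zeta_dir N hN T0 (X + h) (by linarith) (by linarith) (x + v) hxv
  rw [← add_assoc] at h3
  rw [show T0 + (x + v) = T0 + x + v by ring]
  set z := riemannZeta (1/2 + Complex.I * (T0 + x + v : ℝ)) with hz
  set D := ∑ m ∈ Finset.Icc 1 N, dco N T0 m * ee (-((T0 + x + v) * Real.log m)) with hD
  have e : ee (RSTheta (T0 + x + v)) * z - ee (RSTheta (T0 + x)) * (ee (L * v + q * x * v) * D) =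
    (ee (RSTheta (T0+x+v)) - ee (RSTheta (T0+x)) * ee (L*v + q*x*v)) * z + ee (RSTheta (T0+x)) * ee (L*v + q*x*v) * (z - D) := by ring
  rw [e]
  refine (norm_add_le _ _).trans (add_le_add ?_ ?_)
  · rw [norm_mul]
    have hxsq : x^2 ≤ X^2 := by rw [← sq_abs x]; exact pow_le_pow_left₀ (abs_nonneg _) hx 2
    have hT0 : 0 < T0 := by linarith
    refine mul_le_mul (h1.trans ?_) (h2.trans ?_) (norm_nonneg _) (by positivity)
    · gcongr
    · gcongr
      linarith
  · rw [norm_mul, norm_mul, ee_norm, ee_norm, one_mul, one_mul]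
    exact h3

lemma pointwise (F e e2 : ℝ) (θ P A G : ℂ) (hθ : ‖θ‖ = 1) (h1 : ‖(F:ℂ) - θ * P‖ ≤ e) (h2 : ‖θ * θ - G‖ ≤ e2) :
    4 * (P * conj A).re - 2 * e - (2 + 2 * e + 2 * e2) * ‖A‖^2 - 2 * (G * A * A).re ≤ F^2 := by
  have he : 0 ≤ e := (norm_nonneg _).trans h1
  have hθc : θ * conj θ = 1 := by rw [Complex.mul_conj, Complex.normSq_eq_norm_sq, hθ]; norm_num
  -- Re(F conj(θA)) = F * Re(θA)
  set R := (θ * A).re with hR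
  have a1 : ((F:ℂ) * conj (θ * A)).re = F * R := by
    rw [Complex.re_ofReal_mul, Complex.conj_re]
  have a2 : (F:ℂ) * conj (θ * A) = P * conj A + ((F:ℂ) - θ * P) * conj (θ * A) := by
    rw [map_mul]; linear_combination (P * conj A) * hθc
  have hA : ‖conj (θ * A)‖ = ‖A‖ := by rw [RCLike.norm_conj, norm_mul, hθ, one_mul]
  have a3 : |(((F:ℂ) - θ * P) * conj (θ * A)).re| ≤ e * ‖A‖ := by
    refine (Complex.abs_re_le_norm _).trans ?_
    rw [norm_mul, hA]; gcongr
  have a4 : F * R = (P * conj A).re + (((F:ℂ) - θ * P) * conj (θ * A)).re := by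
    rw [← a1, a2, Complex.add_re]
  -- see the identity below
  have b1 : 2 * R^2 = ‖A‖^2 + (θ * A * (θ * A)).re := by
    have : ‖A‖^2 = ‖θ * A‖^2 := by rw [norm_mul, hθ, one_mul]
    rw [this, ← Complex.normSq_eq_norm_sq, Complex.normSq_apply, Complex.mul_re (θ * A) (θ * A), hR]; ring
  have b2 : θ * A * (θ * A) = G * A * A + (θ * θ - G) * A * A := by ring
  have b3 : ((θ * θ - G) * A * A).re ≤ e2 * ‖A‖^2 := by
    refine (Complex.re_le_norm _).trans ?_
    rw [norm_mul, norm_mul, mul_assoc, ← sq ‖A‖]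
    exact mul_le_mul_of_nonneg_right h2 (by positivity)
  rw [b2, Complex.add_re] at b1
  have a5 := (abs_le.mp a3).1
  have a6 : 2 * ‖A‖ ≤ 1 + ‖A‖^2 := by nlinarith [sq_nonneg (‖A‖ - 1)]
  have a7 : e * (2 * ‖A‖) ≤ e * (1 + ‖A‖^2) := by gcongr
  nlinarith [sq_nonneg (F - 2 * R)]

lemma large_core (N : ℕ) (T0 V X h L q K K2 M e e2 : ℝ) (hN : 1 ≤ N) (hT : 10 ≤ T0) (hX : 0 ≤ X) (hh : 0 ≤ h) (hX4 : X ≤ T0 / 4) (hh4 : h ≤ T0 / 4)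
    (hth1 : ∀ x, |x| ≤ T0/2 → ‖ee (RSTheta (T0+x)) - ee (RSTheta T0) * ee (L*x + q*x^2/2)‖ ≤ 168*|x|^3/T0^2)
    (hth : ∀ x v, |x| ≤ T0/4 → 0 ≤ v → v ≤ T0/4 → ‖ee (RSTheta (T0+x+v)) - ee (RSTheta (T0+x)) * ee (L*v + q*x*v)‖ ≤ 168*x^2*v/T0^2 + 28*v^2/T0)
    (hKn : 0 ≤ K) (hK2n : 0 ≤ K2) (hNL : Real.exp L < N) (hq : |q| * h ≤ Real.exp (-L) / 4)
    (hK : ∀ ξ, Real.exp (-L) / 4 ≤ |ξ| → ‖JJ V X ξ 0‖ ≤ K)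
    (hK2 : ∀ ξ, 2 * Real.exp (-L/4) ≤ ξ → ‖JJ V X ξ q‖ ≤ K2)
    (he : ((168 * X^2 * h / T0^2 + 28 * h^2 / T0) * (20 * Real.sqrt (2 * T0)) +
        (6 * (1 + 2 * T0) / Real.sqrt N + 2 * Real.sqrt N * (X + h) / T0 ^ 2)) * h ≤ e)
    (he2 : 336 * X^3 / T0^2 ≤ e2)
    (hM : ∀ x, |x| ≤ X → (∫ u in (T0 + x)..(T0 + x + h), HardyZ u)^2 ≤ M) :
    4 * (SS L h * J0 V X - (N * Real.exp L * (2 * Real.sqrt N * h * K) + Real.exp (L/8) * h * (|q| * h * X * J0 V X)) * h)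
      - 2 * e * J0 V X - (2 + 2 * e + 2 * e2) * (SS L h * J0 V X + (Real.exp L)^2 * (h^2 * K)) - 2 * ((Real.exp L)^2 * (h^2 * K2)) ≤ M * J0 V X := by
  have hT0 : 0 < T0 := by linarith
  have he20 : 0 ≤ e2 := le_trans (by positivity) he2
  have he0 : 0 ≤ e := le_trans (by positivity) he
  have hPc := PP_cont N L q T0 h
  have hAc := AA_cont L T0 h
  have hAcc : Continuous (fun x => conj (AA L T0 h x)) := Complex.continuous_conj.comp (AA_cont L T0 h)
  set P := PP N L q T0 h with hP
  set A := AA L T0 h with hA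
  set G : ℝ → ℂ := fun x => ee (2 * RSTheta T0) * ee (2 * L * x + q * x^2) with hG
  have hGc : Continuous G := by rw [hG]; fun_prop
  have pw : ∀ x ∈ Set.Icc (-X) X, gw V x * (4 * (P x * conj (A x)).re - 2 * e - (2 + 2 * e + 2 * e2) * ‖A x‖^2 - 2 * (G x * A x * A x).re) ≤ gw V x * M := by
    intro x hx
    have hx' : |x| ≤ X := abs_le.mpr hx
    apply mul_le_mul_of_nonneg_left _ (gw_pos V x).le
    refine (pointwise (∫ u in (T0 + x)..(T0 + x + h), HardyZ u) e e2 (ee (RSTheta (T0 + x))) (P x) (A x) (G x) (ee_norm _) ?_ ?_).trans (hM x hx')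
    · exact (PP_approx N T0 X h L q hN hT hX hh hX4 hh4 hth x hx').trans he
    · have h1 := hth1 x (by linarith)
      have e : ee (RSTheta (T0 + x)) * ee (RSTheta (T0 + x)) - G x =
        (ee (RSTheta (T0+x)) - ee (RSTheta T0) * ee (L*x + q*x^2/2)) * (ee (RSTheta (T0+x)) + ee (RSTheta T0) * ee (L*x + q*x^2/2)) := by
        have : G x = (ee (RSTheta T0) * ee (L*x + q*x^2/2)) * (ee (RSTheta T0) * ee (L*x + q*x^2/2)) := by
          simp only [hG]
          rw [← ee_add, ← ee_add, ← ee_add]; congr 1; ring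
        rw [this]; ring
      rw [e, norm_mul]
      have h2 : ‖ee (RSTheta (T0+x)) + ee (RSTheta T0) * ee (L*x + q*x^2/2)‖ ≤ 2 := by
        refine (norm_add_le _ _).trans ?_
        rw [norm_mul, ee_norm, ee_norm, ee_norm]; norm_num
      calc _ ≤ 168*|x|^3/T0^2 * 2 := by gcongr
        _ ≤ 168*X^3/T0^2 * 2 := by gcongr
        _ = 336 * X^3 / T0^2 := by ring
        _ ≤ _ := he2
  have hmono := intervalIntegral.integral_mono_on (μ := MeasureTheory.volume) (show -X ≤ X by linarith) (by
    apply Continuous.intervalIntegrable; fun_prop) (by apply Continuous.intervalIntegrable; fun_prop) pw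
  rw [intervalIntegral.integral_mul_const] at hmono
  change _ ≤ J0 V X * M at hmono
  set I1 := ∫ x in (-X)..X, (gw V x : ℂ) * (P x * conj (A x)) with hI1
  set I2 := ∫ x in (-X)..X, gw V x * ‖A x‖^2 with hI2
  set I3 := ∫ x in (-X)..X, (gw V x : ℂ) * (G x * A x * A x) with hI3
  have r1 : ∫ x in (-X)..X, gw V x * (P x * conj (A x)).re = I1.re := by
    have := (Complex.reCLM).intervalIntegral_comp_comm (μ := MeasureTheory.volume) (a := -X) (b := X) (f := fun x => (gw V x : ℂ) * (P x * conj (A x))) (by apply Continuous.intervalIntegrable; fun_prop)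
    rw [hI1, ← Complex.reCLM_apply, ← this]
    congr 1; ext x; rw [Complex.reCLM_apply, Complex.re_ofReal_mul]
  have r3 : ∫ x in (-X)..X, gw V x * (G x * A x * A x).re = I3.re := by
    have := (Complex.reCLM).intervalIntegral_comp_comm (μ := MeasureTheory.volume) (a := -X) (b := X) (f := fun x => (gw V x : ℂ) * (G x * A x * A x)) (by apply Continuous.intervalIntegrable; fun_prop)
    rw [hI3, ← Complex.reCLM_apply, ← this]
    congr 1; ext x; rw [Complex.reCLM_apply, Complex.re_ofReal_mul]
  have expand : ∫ x in (-X)..X, gw V x * (4 * (P x * conj (A x)).re - 2 * e - (2 + 2 * e + 2 * e2) * ‖A x‖^2 - 2 * (G x * A x * A x).re) =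
      4 * I1.re - 2 * e * J0 V X - (2 + 2 * e + 2 * e2) * I2 - 2 * I3.re := by
    rw [← r1, ← r3, hI2, J0, ← intervalIntegral.integral_const_mul, ← intervalIntegral.integral_const_mul, ← intervalIntegral.integral_const_mul, ← intervalIntegral.integral_const_mul,
      ← intervalIntegral.integral_sub, ← intervalIntegral.integral_sub, ← intervalIntegral.integral_sub]
    · congr 1; ext x; ring
    all_goals (apply Continuous.intervalIntegrable; fun_prop)
  rw [expand] at hmono
  have b1 := PP_AA N V X K L q T0 h hN (by linarith) hX hKn hh hNL hq hK
  have b2 := AA_sq V X K L T0 h hX hKn hh hK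
  have b3 := AA_cross V X K2 L T0 h q hK2n hh hK2
  have c1 : SS L h * J0 V X - (N * Real.exp L * (2 * Real.sqrt N * h * K) + Real.exp (L/8) * h * (|q| * h * X * J0 V X)) * h ≤ I1.re := by
    have := (Complex.abs_re_le_norm _).trans b1
    rw [Complex.sub_re, Complex.ofReal_re] at this
    linarith [(abs_le.mp this).1]
  have c3 : I3.re ≤ (Real.exp L)^2 * (h^2 * K2) := by
    refine (Complex.re_le_norm _).trans ?_
    have : I3 = ee (2 * RSTheta T0) * ∫ x in (-X)..X, (gw V x : ℂ) * (ee (2 * L * x + q * x^2) * A x * A x) := by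
      rw [hI3, ← intervalIntegral.integral_const_mul]
      congr 1; ext x; simp only [hG]; ring
    rw [this, norm_mul, ee_norm, one_mul]; exact b3
  have c2 : (2 + 2 * e + 2 * e2) * I2 ≤ (2 + 2 * e + 2 * e2) * (SS L h * J0 V X + (Real.exp L)^2 * (h^2 * K)) := by
    gcongr
  linarith


lemma large_e : ∀ᶠ T : ℝ in atTop, ∀ T0 h : ℝ, T ≤ T0 → T0 ≤ 2 * T → 0 ≤ h → h ≤ T ^ (0.001:ℝ) →
    ((168 * (T ^ (0.50008:ℝ))^2 * h / T0^2 + 28 * h^2 / T0) * (20 * Real.sqrt (2 * T0)) +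
        (6 * (1 + 2 * T0) / Real.sqrt ⌈T ^ (5/2:ℝ)⌉₊ + 2 * Real.sqrt ⌈T ^ (5/2:ℝ)⌉₊ * (T ^ (0.50008:ℝ) + h) / T0 ^ 2)) * h ≤ T ^ (-0.2:ℝ)
    ∧ 336 * (T ^ (0.50008:ℝ))^3 / T0^2 ≤ T ^ (-0.2:ℝ) := by
  filter_upwards [eventually_ge_atTop 1, ev_pow 7878 (-0.2489) (-0.2) (by norm_num), ev_pow 336 (-0.49976) (-0.2) (by norm_num)] with T hT h1 h2 T0 h hT0 hT02 h0 hh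
  have hTp : 0 < T := by linarith
  obtain ⟨n1, n2, n3, n4, n5⟩ := ceil_bd T hT
  have sT : Real.sqrt T = T ^ (1/2:ℝ) := Real.sqrt_eq_rpow T
  have s1 : Real.sqrt (2 * T0) ≤ 2 * T ^ (1/2:ℝ) := by
    rw [← sT]; apply Real.sqrt_le_iff.mpr
    refine ⟨by positivity, ?_⟩
    rw [mul_pow, Real.sq_sqrt hTp.le]; linarith
  constructor
  · have a1 : 168 * (T ^ (0.50008:ℝ))^2 * h / T0^2 ≤ 168 * T ^ (-0.998:ℝ) := by
      calc _ ≤ 168 * (T ^ (0.50008:ℝ))^2 * T ^ (0.001:ℝ) / T^2 := by gcongr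
        _ = 168 * T ^ (-0.99884:ℝ) := by
          rw [rpow_pow' _ _ _ hTp, ← Real.rpow_natCast T 2, mul_assoc, ← Real.rpow_add hTp, mul_div_assoc, ← Real.rpow_sub hTp]; norm_num
        _ ≤ _ := by gcongr <;> norm_num <;> linarith
    have a2 : 28 * h^2 / T0 ≤ 28 * T ^ (-0.998:ℝ) := by
      calc _ ≤ 28 * (T ^ (0.001:ℝ))^2 / T := by gcongr
        _ = _ := by
          rw [rpow_pow' _ _ _ hTp, mul_div_assoc]
          nth_rewrite 2 [← Real.rpow_one T]
          rw [← Real.rpow_sub hTp]; norm_num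
    have a3 : (168 * (T ^ (0.50008:ℝ))^2 * h / T0^2 + 28 * h^2 / T0) * (20 * Real.sqrt (2 * T0)) ≤ 7840 * T ^ (-0.2499:ℝ) := by
      calc _ ≤ (168 * T ^ (-0.998:ℝ) + 28 * T ^ (-0.998:ℝ)) * (20 * (2 * T ^ (1/2:ℝ))) := by gcongr
        _ = 7840 * T ^ (-0.498:ℝ) := by
          rw [show (-0.498:ℝ) = -0.998 + 1/2 by norm_num, Real.rpow_add hTp]; ring
        _ ≤ _ := by gcongr <;> norm_num <;> linarith
    have a4 : 6 * (1 + 2 * T0) / Real.sqrt ⌈T ^ (5/2:ℝ)⌉₊ ≤ 30 * T ^ (-0.2499:ℝ) := by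
      calc _ ≤ 6 * (5 * T) / T ^ (5/4:ℝ) := by gcongr; linarith
        _ = 30 * T ^ (-0.25:ℝ) := by
          rw [show (-0.25:ℝ) = 1 - 5/4 by norm_num, Real.rpow_sub hTp, Real.rpow_one]; ring
        _ ≤ _ := by gcongr <;> norm_num <;> linarith
    have hhX : h ≤ T ^ (0.50008:ℝ) := hh.trans (Real.rpow_le_rpow_of_exponent_le hT (by norm_num))
    have a5 : 2 * Real.sqrt ⌈T ^ (5/2:ℝ)⌉₊ * (T ^ (0.50008:ℝ) + h) / T0 ^ 2 ≤ 8 * T ^ (-0.2499:ℝ) := by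
      calc _ ≤ 2 * (2 * T ^ (5/4:ℝ)) * (T ^ (0.50008:ℝ) + T ^ (0.50008:ℝ)) / T ^ 2 := by gcongr
        _ = 8 * T ^ (-0.24992:ℝ) := by
          rw [show (-0.24992:ℝ) = 5/4 + 0.50008 - (2:ℕ) by norm_num, Real.rpow_sub hTp, Real.rpow_add hTp, Real.rpow_natCast]; ring
        _ ≤ _ := by gcongr <;> norm_num <;> linarith
    calc _ ≤ (7840 * T ^ (-0.2499:ℝ) + (30 * T ^ (-0.2499:ℝ) + 8 * T ^ (-0.2499:ℝ))) * T ^ (0.001:ℝ) := by gcongr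
      _ = 7878 * T ^ (-0.2489:ℝ) := by
        rw [show (-0.2489:ℝ) = -0.2499 + 0.001 by norm_num, Real.rpow_add hTp]; ring
      _ ≤ _ := h1
  · calc _ ≤ 336 * (T ^ (0.50008:ℝ))^3 / T^2 := by gcongr
      _ = 336 * T ^ (-0.49976:ℝ) := by
          rw [rpow_pow' _ _ _ hTp, ← Real.rpow_natCast T 2, mul_div_assoc, ← Real.rpow_sub hTp]; norm_num
      _ ≤ _ := h2

/-- The small constant in the exponential decay. -/
noncomputable def c0 : ℝ := Real.exp (-402) / 1000

lemma c0_pos : 0 < c0 := by unfold c0; positivity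

lemma c0_le : c0 ≤ 1/2 ∧ c0 ≤ Real.exp (-402) / 64 ∧ c0 ≤ Real.exp (-102) / 197 := by
  unfold c0
  have h1 : Real.exp (-402) ≤ Real.exp (-102) := Real.exp_le_exp.mpr (by norm_num)
  have h2 : Real.exp (-102) ≤ 1 := by rw [Real.exp_le_one_iff]; norm_num
  have h3 := Real.exp_pos (-402)
  refine ⟨by linarith, by linarith, by linarith⟩

lemma exp_of_log (T a b : ℝ) (hT : 0 < T) : Real.exp (a * Real.log T + b) = Real.exp b * T ^ a := by
  rw [Real.rpow_def_of_pos hT, ← Real.exp_add]; congr 1; ring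

lemma large_K (T L q : ℝ) (hT : 1 ≤ T) (hL1 : 1/2 * Real.log T - 201 ≤ L) (hL2 : L ≤ 1/2 * Real.log T + 201) (hq : |q| ≤ 14 / T) :
    (∀ ξ, Real.exp (-L) / 4 ≤ |ξ| → ‖JJ (T ^ (0.50005:ℝ)) (T ^ (0.50008:ℝ)) ξ 0‖ ≤ 6 * T ^ (0.50005:ℝ) * Real.exp (-(c0 * T ^ (0.00006:ℝ)))) ∧
    (∀ ξ, 2 * Real.exp (-L/4) ≤ ξ → ‖JJ (T ^ (0.50005:ℝ)) (T ^ (0.50008:ℝ)) ξ q‖ ≤ 6 * T ^ (0.50005:ℝ) * Real.exp (-(c0 * T ^ (0.00006:ℝ)))) := by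
  have hTp : 0 < T := by linarith
  obtain ⟨k1, k2, k3⟩ := c0_le
  set V := T ^ (0.50005:ℝ) with hV
  set X := T ^ (0.50008:ℝ) with hX
  set E := Real.exp (-(c0 * T ^ (0.00006:ℝ))) with hE
  have hVp : 0 < V := by positivity
  have hXp : 0 < X := by positivity
  have x1 : Real.exp (-(X^2 / (2 * V^2))) ≤ E := by
    apply Real.exp_le_exp.mpr; apply neg_le_neg
    have : X^2 / (2 * V^2) = 1/2 * T ^ (0.00006:ℝ) := by
      rw [hX, hV, rpow_pow' _ _ _ hTp, rpow_pow' _ _ _ hTp, show (0.00006:ℝ) = 0.50008 * (2:ℕ) - 0.50005 * (2:ℕ) by norm_num, Real.rpow_sub hTp]; ring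
    rw [this]; gcongr
  have fin : ∀ ξ q', c0 * T ^ (0.00006:ℝ) ≤ ξ^2 * V^2 / (4 * (1 + q'^2 * V^4)) → ‖JJ V X ξ q'‖ ≤ 6 * V * E := by
    intro ξ q' hle
    refine (JJ_bound V X ξ q' hVp hXp.le).trans ?_
    have x2 : Real.exp (-(ξ^2 * V^2 / (4 * (1 + q'^2 * V^4)))) ≤ E := Real.exp_le_exp.mpr (neg_le_neg hle)
    calc _ ≤ 2 * V * (E + 2 * E) := by gcongr
      _ = _ := by ring
  constructor
  · intro ξ hξ
    apply fin
    have e1 : Real.exp (-201) * T ^ (-1/2:ℝ) ≤ Real.exp (-L) := by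
      rw [← exp_of_log T (-1/2) (-201) hTp]; apply Real.exp_le_exp.mpr; linarith
    have e2 : (Real.exp (-201) * T ^ (-1/2:ℝ) / 4)^2 ≤ ξ^2 := by
      rw [← sq_abs ξ]; apply pow_le_pow_left₀ (by positivity); linarith
    have e3 : (Real.exp (-201) * T ^ (-1/2:ℝ) / 4)^2 * V^2 / 4 = Real.exp (-402) / 64 * T ^ (0.0001:ℝ) := by
      rw [show (-402:ℝ) = (2:ℕ) * (-201) by norm_num, Real.exp_nat_mul, show (0.0001:ℝ) = -1/2 * (2:ℕ) + 0.50005 * (2:ℕ) by norm_num, Real.rpow_add hTp,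
        ← rpow_pow' _ _ _ hTp, ← rpow_pow' _ _ _ hTp]; ring
    calc c0 * T ^ (0.00006:ℝ) ≤ Real.exp (-402) / 64 * T ^ (0.0001:ℝ) := by gcongr <;> norm_num <;> linarith
      _ = (Real.exp (-201) * T ^ (-1/2:ℝ) / 4)^2 * V^2 / 4 := e3.symm
      _ ≤ ξ^2 * V^2 / 4 := by
        apply div_le_div_of_nonneg_right _ (by norm_num)
        exact mul_le_mul_of_nonneg_right e2 (by positivity)
      _ = _ := by norm_num
  · intro ξ hξ
    apply fin
    have e1 : Real.exp (-51) * T ^ (-1/8:ℝ) ≤ Real.exp (-L/4) := by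
      rw [← exp_of_log T (-1/8) (-51) hTp]; apply Real.exp_le_exp.mpr; linarith
    have e2 : (2 * (Real.exp (-51) * T ^ (-1/8:ℝ)))^2 ≤ ξ^2 := by
      apply pow_le_pow_left₀ (by positivity); linarith
    have e4 : 1 + q^2 * V^4 ≤ 197 * T ^ (0.0002:ℝ) := by
      have q1 : q^2 ≤ (14/T)^2 := by rw [← sq_abs q]; exact pow_le_pow_left₀ (abs_nonneg _) hq 2
      have q2 : (14/T)^2 * V^4 = 196 * T ^ (0.0002:ℝ) := by
        rw [hV, rpow_pow' _ _ _ hTp, div_pow, ← Real.rpow_natCast T 2, show (0.0002:ℝ) = 0.50005 * (4:ℕ) - (2:ℕ) by norm_num, Real.rpow_sub hTp]; ring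
      have q3 : 1 ≤ T ^ (0.0002:ℝ) := Real.one_le_rpow hT (by norm_num)
      have q4 := mul_le_mul_of_nonneg_right q1 (show 0 ≤ V^4 by positivity)
      linarith
    have e3 : (2 * (Real.exp (-51) * T ^ (-1/8:ℝ)))^2 * V^2 / (4 * (197 * T ^ (0.0002:ℝ))) = Real.exp (-102) / 197 * T ^ (0.7499:ℝ) := by
      rw [show (-102:ℝ) = (2:ℕ) * (-51) by norm_num, Real.exp_nat_mul, show (0.7499:ℝ) = -1/8 * (2:ℕ) + 0.50005 * (2:ℕ) - 0.0002 by norm_num, Real.rpow_sub hTp, Real.rpow_add hTp,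
        ← rpow_pow' _ _ _ hTp, ← rpow_pow' _ _ _ hTp]; ring
    calc c0 * T ^ (0.00006:ℝ) ≤ Real.exp (-102) / 197 * T ^ (0.7499:ℝ) := by gcongr <;> norm_num <;> linarith
      _ = _ := e3.symm
      _ ≤ ξ^2 * V^2 / (4 * (1 + q^2 * V^4)) := by
        apply div_le_div₀ (by positivity) _ (by positivity) (by linarith)
        exact mul_le_mul_of_nonneg_right e2 (by positivity)


set_option maxHeartbeats 4000000 in
lemma large_final (ε : ℝ) (hε : 0 < ε) : ∃ Y0 : ℝ, ∀ᶠ T : ℝ in atTop, ∀ h : ℝ, Y0 ≤ h * Real.log T → T ^ (-0.001:ℝ) ≤ h → h ≤ T ^ (0.001:ℝ) →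
    ¬ (∀ η ∈ Set.Ioo T (T + T ^ (0.5001:ℝ)), (∫ u in η..(η + h), HardyZ u)^2 ≤ (1 - ε) * (2 * Real.pi * h)) := by
  obtain ⟨L0, Y0, hS⟩ := S_lower ε hε
  refine ⟨4 * |Y0|, ?_⟩
  filter_upwards [large_e, eventually_ge_atTop 10, Real.tendsto_log_atTop.eventually_ge_atTop (1000 + 4 * |L0|),
    ev_pow 4 0.50008 0.5001 (by norm_num), ev_pow 4 0.50008 1 (by norm_num), ev_pow 2 0.5001 1 (by norm_num), ev_pow 4 0.001 1 (by norm_num),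
    ev_pow (56 * Real.exp 201) (-0.999) (-0.5) (by norm_num), ev_pow (2 * Real.exp 201) (1/2) (5/2) (by norm_num),
    ev_pow (Real.exp 2) 0.001 0.005 (by norm_num),
    ev_exp (4 * (2 * (Real.exp 201 * (2 * 2 * 12)))) 4.252 (-0.1) c0 0.00006 c0_pos (by norm_num),
    ev_pow (4 * 14 * Real.exp 26) (-0.43442) (-0.1) (by norm_num), ev_pow 2 (-0.2) (-0.1) (by norm_num),
    ev_pow (4 * Real.exp 26) (-0.1355) (-0.1) (by norm_num),
    ev_exp (8 * (Real.exp 201)^2 * 12) 1.002 (-0.1) c0 0.00006 c0_pos (by norm_num),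
    ev_pow (5 / (2 * ε)) (-0.1) (-0.001) (by norm_num)] with T hE hT hlog p1 p2 p3 p4 p5 p6 p7 p8 p9 p10 p11 p12 p13 h hY hh1 hh2 hall
  have hTp : 0 < T := lt_of_lt_of_le (by norm_num) hT
  have hT1 : 1 ≤ T := le_trans (by norm_num) hT
  rw [Real.rpow_one] at p2 p3 p4
  set U := T ^ (0.5001:ℝ) with hU
  set V := T ^ (0.50005:ℝ) with hV
  set X := T ^ (0.50008:ℝ) with hX
  set N := ⌈T ^ (5/2:ℝ)⌉₊ with hN
  obtain ⟨n1, n2, n3, n4, n5⟩ := ceil_bd T hT1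
  rw [← hN] at n1 n2 n3 n4 n5
  have hUp : 0 < U := by positivity
  have hVp : 0 < V := by positivity
  have hXp : 0 < X := by positivity
  have hVX : V ≤ X := Real.rpow_le_rpow_of_exponent_le hT1 (by norm_num)
  have hhp : 0 < h := lt_of_lt_of_le (by positivity) hh1
  set T0 := T + U / 2 with hT0
  have hT0a : T ≤ T0 := by linarith
  have hT0b : T0 ≤ 2 * T := by linarith
  have hT0p : 0 < T0 := by linarith
  obtain ⟨L, q, hL, hq, hth1, hth2⟩ := theta_approx T0 (by linarith)
  have hl1 : Real.log T ≤ Real.log T0 := Real.log_le_log hTp hT0a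
  have hl2 : Real.log T0 ≤ Real.log T + 1 := by
    have a1 : Real.log T0 ≤ Real.log 2 + Real.log T := by
      rw [← Real.log_mul (by norm_num) hTp.ne']; exact Real.log_le_log hT0p hT0b
    linarith [Real.log_two_lt_d9]
  rw [abs_le] at hL
  have hLa : 1/2 * Real.log T - 200 ≤ L := by linarith
  have hLb : L ≤ 1/2 * Real.log T + 201 := by linarith
  clear hl1 hl2 hL
  have hq' : |q| ≤ 14 / T := hq.trans (by gcongr)
  obtain ⟨hK, hK2⟩ := large_K T L q hT1 (by linarith) hLb hq'
  rw [← hV, ← hX] at hK hK2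
  set E := Real.exp (-(c0 * T ^ (0.00006:ℝ))) with hEd
  have hEp : 0 < E := Real.exp_pos _
  obtain ⟨he, he2⟩ := hE T0 h hT0a hT0b hhp.le hh2
  set e := T ^ (-0.2:ℝ) with hed
  have hep : 0 < e := by positivity
  have xL : Real.exp L ≤ Real.exp 201 * T ^ (1/2:ℝ) := by
    rw [← exp_of_log T _ _ hTp]; exact Real.exp_le_exp.mpr hLb
  have xL8 : Real.exp (L/8) ≤ Real.exp 26 * T ^ (1/16:ℝ) := by
    rw [← exp_of_log T _ _ hTp]; apply Real.exp_le_exp.mpr; linarith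
  have xLn : Real.exp (-201) * T ^ (-0.5:ℝ) ≤ Real.exp (-L) := by
    rw [← exp_of_log T _ _ hTp]; apply Real.exp_le_exp.mpr; linarith
  have hqh : |q| * h ≤ Real.exp (-L) / 4 := by
    calc |q| * h ≤ 14 / T * T ^ (0.001:ℝ) := by gcongr
      _ = 14 * T ^ (-0.999:ℝ) := by
        rw [show (-0.999:ℝ) = 0.001 - 1 by norm_num, Real.rpow_sub hTp, Real.rpow_one]; ring
      _ = Real.exp (-201) * (56 * Real.exp 201 * T ^ (-0.999:ℝ)) / 4 := by
        rw [Real.exp_neg]; field_simp; norm_num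
      _ ≤ Real.exp (-201) * (T ^ (-0.5:ℝ)) / 4 := by gcongr
      _ ≤ _ := by linarith
  have hNL : Real.exp L < N := by
    have : 0 < T ^ (1/2:ℝ) := by positivity
    have : 0 < Real.exp 201 * T ^ (1/2:ℝ) := by positivity
    linarith
  have core := large_core N T0 V X h L q (6 * V * E) (6 * V * E) ((1 - ε) * (2 * Real.pi * h)) e e n1 (by linarith) hXp.le hhp.le (by linarith) (by linarith)
    hth1 hth2 (by positivity) (by positivity) hNL hqh hK hK2 he he2 (by
      intro x hx
      have := abs_le.mp hx
      exact hall (T0 + x) ⟨by linarith, by linarith⟩)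
  have hJ := le_J0 V X hVp hVX
  set J := J0 V X with hJd
  have hJp : 0 < J := by linarith
  have hSl := hS L (by linarith [le_abs_self L0, abs_nonneg L0]) h hhp (by
      have h1 : Real.log T / 4 ≤ L := by linarith [abs_nonneg L0]
      have h2 : h * (Real.log T / 4) ≤ h * L := by gcongr
      linarith [le_abs_self Y0]) (by
      refine hh2.trans ?_
      have h1 : Real.exp (-2) * T ^ (0.005:ℝ) ≤ Real.exp (L / 100) := by
        rw [← exp_of_log T _ _ hTp]; apply Real.exp_le_exp.mpr; linarith
      refine le_trans ?_ h1
      calc T ^ (0.001:ℝ) = Real.exp (-2) * (Real.exp 2 * T ^ (0.001:ℝ)) := by rw [Real.exp_neg]; field_simp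
        _ ≤ _ := by gcongr)
  have hSu := SS_upper L h hhp.le
  set S := SS L h with hSd
  -- error terms
  have t1 : 4 * ((N * Real.exp L * (2 * Real.sqrt N * h * (6 * V * E))) * h) ≤ T ^ (-0.1:ℝ) * J := by
    calc _ ≤ 4 * ((2 * T ^ (5/2:ℝ)) * (Real.exp 201 * T ^ (1/2:ℝ)) * (2 * (2 * T ^ (5/4:ℝ)) * T ^ (0.001:ℝ) * (6 * (2 * J) * E)) * T ^ (0.001:ℝ)) := by
          have hV2 : V ≤ 2 * J := by linarith
          gcongr
      _ = (4 * (2 * (Real.exp 201 * (2 * 2 * 12))) * T ^ (4.252:ℝ) * E) * J := by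
          rw [show (4.252:ℝ) = 5/2 + 1/2 + 5/4 + 0.001 + 0.001 by norm_num, Real.rpow_add hTp, Real.rpow_add hTp, Real.rpow_add hTp, Real.rpow_add hTp]; ring
      _ ≤ _ := by gcongr
  have t2 : 4 * ((Real.exp (L/8) * h * (|q| * h * X * J)) * h) ≤ T ^ (-0.1:ℝ) * J := by
    calc _ ≤ 4 * (((Real.exp 26 * T ^ (1/16:ℝ)) * T ^ (0.001:ℝ) * (14 / T * T ^ (0.001:ℝ) * T ^ (0.50008:ℝ) * J)) * T ^ (0.001:ℝ)) := by gcongr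
      _ = (4 * 14 * Real.exp 26 * T ^ (-0.43442:ℝ)) * J := by
          rw [show (-0.43442:ℝ) = 1/16 + 0.001 + 0.001 + 0.50008 + 0.001 - 1 by norm_num, Real.rpow_sub hTp, Real.rpow_one, Real.rpow_add hTp, Real.rpow_add hTp, Real.rpow_add hTp, Real.rpow_add hTp]; ring
      _ ≤ _ := by gcongr
  have t3 : 2 * e * J ≤ T ^ (-0.1:ℝ) * J := by gcongr
  have t4 : (4 * e) * (S * J) ≤ T ^ (-0.1:ℝ) * J := by
    have : S ≤ (T ^ (0.001:ℝ))^2 * (Real.exp 26 * T ^ (1/16:ℝ)) := hSu.trans (by gcongr)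
    calc _ ≤ (4 * e) * (((T ^ (0.001:ℝ))^2 * (Real.exp 26 * T ^ (1/16:ℝ))) * J) := by gcongr
      _ = (4 * Real.exp 26 * T ^ (-0.1355:ℝ)) * J := by
          rw [hed, show (-0.1355:ℝ) = -0.2 + 0.001 + 0.001 + 1/16 by norm_num, Real.rpow_add hTp, Real.rpow_add hTp, Real.rpow_add hTp]; ring
      _ ≤ _ := by gcongr
  have he1 : e ≤ 1 := Real.rpow_le_one_of_one_le_of_nonpos hT1 (by norm_num)
  have t5 : (4 + 4 * e) * ((Real.exp L)^2 * (h^2 * (6 * V * E))) ≤ T ^ (-0.1:ℝ) * J := by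
    calc _ ≤ (4 + 4 * 1) * ((Real.exp 201 * T ^ (1/2:ℝ))^2 * ((T ^ (0.001:ℝ))^2 * (6 * (2 * J) * E))) := by
          have hV2 : V ≤ 2 * J := by linarith
          gcongr
      _ = (8 * (Real.exp 201)^2 * 12 * T ^ (1.002:ℝ) * E) * J := by
          rw [show (1.002:ℝ) = 1/2 + 1/2 + 0.001 + 0.001 by norm_num, Real.rpow_add hTp, Real.rpow_add hTp, Real.rpow_add hTp]; ring
      _ ≤ _ := by gcongr
  set τ := T ^ (-0.1:ℝ) with hτ
  have fin1 : 2 * S * J - 5 * τ * J ≤ ((1 - ε) * (2 * Real.pi * h)) * J := by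
    have : 4 * (S * J - (N * Real.exp L * (2 * Real.sqrt N * h * (6 * V * E)) + Real.exp (L/8) * h * (|q| * h * X * J)) * h)
      - 2 * e * J - (2 + 2 * e + 2 * e) * (S * J + (Real.exp L)^2 * (h^2 * (6 * V * E))) - 2 * ((Real.exp L)^2 * (h^2 * (6 * V * E))) =
      2 * S * J - 4 * ((N * Real.exp L * (2 * Real.sqrt N * h * (6 * V * E))) * h) - 4 * ((Real.exp (L/8) * h * (|q| * h * X * J)) * h)
       - 2 * e * J - (4 * e) * (S * J) - (4 + 4 * e) * ((Real.exp L)^2 * (h^2 * (6 * V * E))) := by ring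
    linarith
  have fin2 : 2 * S - 5 * τ ≤ (1 - ε) * (2 * Real.pi * h) := by
    apply le_of_mul_le_mul_right _ hJp
    linarith
  have fin3 : 5 * τ ≤ 2 * ε * h := by
    have : 5 / (2 * ε) * τ ≤ h := p13.trans hh1
    rw [div_mul_eq_mul_div, div_le_iff₀ (by positivity)] at this
    linarith
  have hpi := Real.pi_gt_three
  nlinarith [mul_pos hε hhp]


lemma exists_eta (H : ℝ → ℝ) (hH : Admissible H) (ε : ℝ) (hε : 0 < ε) (hε1 : ε < 1) :
    ∀ᶠ T : ℝ in atTop, ∃ η ∈ Set.Ioo T (T + T ^ (0.5001:ℝ)),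
      |(|∫ u in η..(η + H T), HardyZ u| / Real.sqrt (2 * Real.pi * H T)) - 1| ≤ ε := by
  obtain ⟨Y0, hlarge⟩ := large_final ε hε
  have hll : Tendsto (fun T => Real.log (Real.log T)) atTop atTop :=
    Real.tendsto_log_atTop.comp Real.tendsto_log_atTop
  have hlo := (isLittleO_log_rpow_atTop (show (0:ℝ) < 0.001 by norm_num)).bound (show (0:ℝ) < 1 by norm_num)
  filter_upwards [hlarge, small_final, hH, hll.eventually_ge_atTop (1000 + |Y0|),
    Real.tendsto_log_atTop.eventually_ge_atTop 1, eventually_ge_atTop 10, hlo]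
    with T hl hs hA h1 h2 h3 h4
  have hTp : 0 < T := by linarith
  have hT1 : 1 ≤ T := by linarith
  have hlp : 0 < Real.log T := by linarith
  have hpp : 0 < T ^ (0.001:ℝ) := by positivity
  rw [one_mul, Real.norm_of_nonneg hlp.le, Real.norm_of_nonneg hpp.le] at h4
  obtain ⟨hA1, hA2⟩ := hA
  rw [div_lt_iff₀ hlp] at hA1
  generalize H T = h at *
  have b0 : 1 ≤ h * Real.log T := by linarith [abs_nonneg Y0]
  have hhp : 0 < h := by
    by_contra hc
    push Not at hc
    nlinarith
  have b1 : T ^ (-0.001:ℝ) ≤ h := by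
    rw [show (-0.001:ℝ) = -(0.001) by norm_num, Real.rpow_neg hTp.le, inv_le_iff_one_le_mul₀ hpp]
    nlinarith
  have b2 : h ≤ T ^ (0.001:ℝ) := by
    refine hA2.le.trans (Real.rpow_le_rpow_of_exponent_le hT1 ?_)
    rw [div_le_iff₀ (by linarith [abs_nonneg Y0])]
    linarith [abs_nonneg Y0]
  have b3 : h ≤ T ^ (0.01:ℝ) := b2.trans (Real.rpow_le_rpow_of_exponent_le hT1 (by norm_num))
  have hl' := hl h (by linarith [le_abs_self Y0]) b1 b2
  have hs' := hs h hhp b3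
  clear hl hs
  by_contra hcon
  push Not at hcon
  set F : ℝ → ℝ := fun η => ∫ u in η..(η + h), HardyZ u with hF
  have hIItg : ∀ a b, IntervalIntegrable HardyZ MeasureTheory.volume a b :=
    fun a b => HardyZ_cont.intervalIntegrable a b
  have hFc : Continuous F := by
    have hP : Continuous (fun x => ∫ u in (0:ℝ)..x, HardyZ u) := intervalIntegral.continuous_primitive hIItg 0
    have : F = fun η => (∫ u in (0:ℝ)..(η + h), HardyZ u) - ∫ u in (0:ℝ)..η, HardyZ u := by
      funext η
      rw [intervalIntegral.integral_interval_sub_left (hIItg _ _) (hIItg _ _)]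
    rw [this]
    exact (hP.comp (continuous_id.add continuous_const)).sub hP
  set R := Real.sqrt (2 * Real.pi * h) with hR
  have hRp : 0 < R := Real.sqrt_pos.mpr (by positivity)
  have hR2 : R ^ 2 = 2 * Real.pi * h := Real.sq_sqrt (by positivity)
  have hcon' : ∀ η ∈ Set.Ioo T (T + T ^ (0.5001:ℝ)), ε < |(|F η| / R) - 1| := hcon
  have hG : Continuous (fun η => |F η| / R) := hFc.abs.div_const R
  have hpre : IsPreconnected (Set.Ioo T (T + T ^ (0.5001:ℝ))) := isPreconnected_Ioo
  -- dichotomy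
  have key : ∀ a ∈ Set.Ioo T (T + T ^ (0.5001:ℝ)), ∀ b ∈ Set.Ioo T (T + T ^ (0.5001:ℝ)),
      |F a| / R < 1 → 1 < |F b| / R → False := by
    intro a ha b hb h1 h2
    obtain ⟨c, hc, hc'⟩ := hpre.intermediate_value ha hb hG.continuousOn ⟨h1.le, h2.le⟩
    have := hcon' c hc
    have hc2 : |F c| / R = 1 := hc'
    rw [hc2, sub_self, abs_zero] at this
    linarith
  by_cases hcase : ∃ a ∈ Set.Ioo T (T + T ^ (0.5001:ℝ)), |F a| / R < 1
  · obtain ⟨a, ha, ha1⟩ := hcase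
    apply hl'
    intro η hη
    have h5 : ¬ (1 < |F η| / R) := fun h6 => key a ha η hη ha1 h6
    have h6 := hcon' η hη
    rw [abs_of_nonpos (by linarith)] at h6
    have h7 : |F η| / R ≤ 1 - ε := by linarith
    rw [div_le_iff₀ hRp] at h7
    have h8 : (F η)^2 ≤ ((1 - ε) * R)^2 := by
      rw [← sq_abs]; gcongr
    have h9 : ((1 - ε) * R)^2 ≤ (1 - ε) * (2 * Real.pi * h) := by
      rw [mul_pow, hR2]
      have : (1 - ε)^2 ≤ 1 - ε := by nlinarith
      gcongr
    exact h8.trans h9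
  · push Not at hcase
    have hbig : ∀ η ∈ Set.Ioo T (T + T ^ (0.5001:ℝ)), R ≤ |F η| := by
      intro η hη
      have := hcase η hη
      rwa [le_div_iff₀ hRp, one_mul] at this
    have key2 : ∀ a ∈ Set.Ioo T (T + T ^ (0.5001:ℝ)), ∀ b ∈ Set.Ioo T (T + T ^ (0.5001:ℝ)),
        F a < 0 → 0 < F b → False := by
      intro a ha b hb h1 h2
      obtain ⟨c, hc, hc'⟩ := hpre.intermediate_value ha hb hFc.continuousOn ⟨h1.le, h2.le⟩
      have := hbig c hc
      rw [hc', abs_zero] at this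
      linarith
    by_cases hneg : ∃ a ∈ Set.Ioo T (T + T ^ (0.5001:ℝ)), F a < 0
    · obtain ⟨a, ha, ha1⟩ := hneg
      apply hs' (-1) (by norm_num)
      intro η hη
      have h5 : ¬ (0 < F η) := fun h6 => key2 a ha η hη ha1 h6
      have h6 := hbig η hη
      rw [abs_of_nonpos (by linarith)] at h6
      change R ≤ -1 * F η
      linarith
    · push Not at hneg
      apply hs' 1 (by norm_num)
      intro η hη
      have h6 := hbig η hη
      rw [abs_of_nonneg (hneg η hη)] at h6
      change R ≤ 1 * F η
      linarith

theorem mean_value_point_formula (H : ℝ → ℝ) (hH : Admissible H) :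
    ∃ η : ℝ → ℝ,
      (∀ᶠ T in atTop, T < η T ∧ η T < T + T ^ (0.5001 : ℝ)) ∧
      Tendsto (fun T =>
          |∫ u in (η T)..(η T + H T), HardyZ u| / Real.sqrt (2 * Real.pi * H T))
        atTop (nhds 1) := by
  have hex : ∀ T : ℝ, ∃ η : ℝ, 1 ≤ T → (η ∈ Set.Ioo T (T + T ^ (0.5001:ℝ)) ∧
      ∀ ξ ∈ Set.Ioo T (T + T ^ (0.5001:ℝ)),
        |(|∫ u in η..(η + H T), HardyZ u| / Real.sqrt (2 * Real.pi * H T)) - 1| ≤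
        |(|∫ u in ξ..(ξ + H T), HardyZ u| / Real.sqrt (2 * Real.pi * H T)) - 1| + 1 / T) := by
    intro T
    by_cases hT : 1 ≤ T
    swap
    · exact ⟨0, fun h => absurd h hT⟩
    have hTp : 0 < T := by linarith
    set g : ℝ → ℝ := fun ξ => |(|∫ u in ξ..(ξ + H T), HardyZ u| / Real.sqrt (2 * Real.pi * H T)) - 1| with hg
    set S := g '' Set.Ioo T (T + T ^ (0.5001:ℝ)) with hS
    have hne : S.Nonempty := by
      apply Set.Nonempty.image
      rw [Set.nonempty_Ioo]
      have : 0 < T ^ (0.5001:ℝ) := by positivity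
      linarith
    have hb : BddBelow S := ⟨0, by rintro _ ⟨x, _, rfl⟩; exact abs_nonneg _⟩
    obtain ⟨_, ⟨η, hη, rfl⟩, hlt⟩ := exists_lt_of_csInf_lt hne (show sInf S < sInf S + 1 / T by
      have : 0 < 1 / T := by positivity
      linarith)
    refine ⟨η, fun _ => ⟨hη, fun ξ hξ => ?_⟩⟩
    have : sInf S ≤ g ξ := csInf_le hb ⟨ξ, hξ, rfl⟩
    change g η ≤ g ξ + 1 / T
    linarith
  choose η hη using hex
  refine ⟨η, ?_, ?_⟩
  · filter_upwards [eventually_ge_atTop 1] with T hT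
    exact (hη T hT).1
  · rw [Metric.tendsto_nhds]
    intro ε hε
    have hδ : 0 < min (ε / 4) (1 / 2) := by positivity
    filter_upwards [exists_eta H hH (min (ε / 4) (1 / 2)) hδ (lt_of_le_of_lt (min_le_right _ _) (by norm_num)),
      eventually_ge_atTop 1, eventually_ge_atTop (4 / ε)] with T hT hT1 hT2
    obtain ⟨ξ, hξ, hξ2⟩ := hT
    have h1 := (hη T hT1).2 ξ hξ
    have h2 : 1 / T ≤ ε / 4 := by
      rw [div_le_iff₀ hε] at hT2
      rw [div_le_iff₀ (by linarith)]
      linarith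
    rw [Real.dist_eq]
    have := min_le_left (ε / 4) (1 / 2)
    linarith
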